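/- Let k ≥ 2, n ≥ k+1, n > 5, and suppose L_n^{(k)} = a·(10^{d1}−1)/9 + (b−a)·10^{d2} with integers 0 ≤ d2 < d1, d1 ≥ 3, 1 ≤ a ≤ 9 and 0 ≤ b ≤ 9. Then n < 1.3·10^{30}·k^8·(log k)^5. -/

import Mathlib

/-- Shifted `k`-generalized Lucas sequence: `genLucas k m` equals `L^{(k)}_{m - (k-2)}`,
so that index `m = 0` corresponds to `n = 2 - k`.  The initial values are
`L^{(k)}_{2-k} = ⋯ = L^{(k)}_{-1} = 0`, `L^{(k)}_0 = 2`, `L^{(k)}_1 = 1`, and each term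
afterwards is the sum of the `k` preceding terms. -/
def genLucas (k : ℕ) : ℕ → ℤ := fun m =>
  if h1 : m < k - 2 then 0
  else if h2 : m = k - 2 then 2
  else if h3 : m = k - 1 then 1
  else ∑ i ∈ Finset.range k, genLucas k (m - 1 - i)
decreasing_by omega

/-- The `k`-generalized Lucas number `L^{(k)}_n` for `n ≥ 0`. -/
def lucasL (k n : ℕ) : ℤ := genLucas k (n + k - 2)

lemma gL_lt {k m : ℕ} (h : m < k - 2) : genLucas k m = 0 := by
  rw [genLucas]; simp [h]
lemma gL_0 {k : ℕ} (_hk : 2 ≤ k) : genLucas k (k-2) = 2 := by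
  rw [genLucas]; simp
lemma gL_1 {k : ℕ} (hk : 2 ≤ k) : genLucas k (k-1) = 1 := by
  rw [genLucas]
  rw [dif_neg (by omega), dif_neg (by omega), dif_pos rfl]
lemma gL_sum {k m : ℕ} (hk : 2 ≤ k) (hm : k ≤ m) :
    genLucas k m = ∑ i ∈ Finset.range k, genLucas k (m - 1 - i) := by
  rw [genLucas, dif_neg (by omega), dif_neg (by omega), dif_neg (by omega)]
lemma gL_rec {k m : ℕ} (hk : 2 ≤ k) (hm : k ≤ m) :
    genLucas k (m+1) = 2 * genLucas k m - genLucas k (m-k) := by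
  rw [gL_sum hk (by omega : k ≤ m+1)]
  obtain ⟨j, rfl⟩ : ∃ j, k = j+1 := ⟨k-1, by omega⟩
  rw [Finset.sum_range_succ']
  have h2 := gL_sum hk hm
  rw [Finset.sum_range_succ] at h2
  have e : ∀ i ∈ Finset.range j, genLucas (j+1) (m+1-1-(i+1)) = genLucas (j+1) (m-1-i) := by
    intro i _; congr 1; omega
  rw [Finset.sum_congr rfl e]
  have : m - 1 - j = m - (j+1) := by omega
  rw [this] at h2
  simp only [Nat.add_sub_cancel, Nat.sub_zero]
  linarith

lemma lL_0 {k : ℕ} (hk : 2 ≤ k) : lucasL k 0 = 2 := by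
  unfold lucasL; rw [Nat.zero_add]; exact gL_0 hk
lemma lL_1 {k : ℕ} (hk : 2 ≤ k) : lucasL k 1 = 1 := by
  unfold lucasL; rw [show 1 + k - 2 = k - 1 by omega]; exact gL_1 hk
lemma lL_2 {k : ℕ} (hk : 2 ≤ k) : lucasL k 2 = 3 := by
  unfold lucasL
  rw [show 2 + k - 2 = k by omega, gL_sum hk le_rfl]
  obtain ⟨j, rfl⟩ : ∃ j, k = j+2 := ⟨k-2, by omega⟩
  rw [Finset.sum_range_succ', Finset.sum_range_succ']
  rw [Finset.sum_eq_zero]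
  · have h0 := gL_0 hk
    have h1 := gL_1 hk
    simp only [Nat.add_sub_cancel] at h0
    rw [show j + 2 - 1 = j + 1 by omega] at *
    simp [h0, h1]
  · intro i hi; simp at hi; exact gL_lt (by omega)
lemma lL_rec_lt {k n : ℕ} (hk : 2 ≤ k) (hn : 2 ≤ n) (h : n < k) :
    lucasL k (n+1) = 2 * lucasL k n := by
  unfold lucasL
  have := gL_rec hk (show k ≤ n + k - 2 by omega)
  rw [show n + 1 + k - 2 = n + k - 2 + 1 by omega, this, gL_lt (show n+k-2-k < k-2 by omega)]
  ring
lemma lL_rec {k : ℕ} (hk : 2 ≤ k) (n : ℕ) :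
    lucasL k (n+(k+1)) = 2 * lucasL k (n+k) - lucasL k n := by
  unfold lucasL
  have := gL_rec hk (show k ≤ n + k + k - 2 by omega)
  rw [show n + (k + 1) + k - 2 = n + k + k - 2 + 1 by omega, this,
    show n + k + k - 2 - k = n + k - 2 by omega]

/-- sequences killed by the char. polynomial -/
def RecS (k : ℕ) (u : ℕ → ℤ) : Prop := ∀ n, u (n+(k+1)) = 2 * u (n+k) - u n

lemma recS_shift {k : ℕ} {u : ℕ → ℤ} (hu : RecS k u) (j : ℕ) : ∃ v, RecS k v ∧
    ∀ n, (if j = 0 then -1 else 1) * u (n + 2^j*(k+1)) = u n + 2^(j+1) * v n := by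
  induction j generalizing u with
  | zero =>
    refine ⟨fun n => - u (n+k), fun n => ?_, fun n => ?_⟩
    · have := hu (n+k)
      simp only
      rw [show n + (k+1) + k = n + k + (k+1) by ring, this]; ring
    · have := hu n
      simp; rw [this]; ring
  | succ j ih =>
    obtain ⟨v, hv, h1⟩ := ih hu
    obtain ⟨v', hv', h2⟩ := ih hv
    refine ⟨fun n => v n + 2^j * v' n, fun n => ?_, fun n => ?_⟩
    · simp only [hv n, hv' n]; ring
    · have a1 := h1 n
      have a2 := h1 (n + 2^j*(k+1))
      have a3 := h2 n
      rw [show n + 2^(j+1)*(k+1) = n + 2^j*(k+1) + 2^j*(k+1) by ring]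
      simp only [Nat.succ_ne_zero, if_false]
      have hs : ((if j = 0 then -1 else 1 : ℤ))^2 = 1 := by split_ifs <;> norm_num
      generalize (if j = 0 then -1 else 1 : ℤ) = s at *
      linear_combination s * a2 + a1 + 2^(j+1) * a3 - u (n + 2^j*(k+1) + 2^j*(k+1)) * hs

lemma recS_mod {k : ℕ} {u : ℕ → ℤ} (hu : RecS k u) {j : ℕ} (hj : 1 ≤ j) (n z : ℕ) :
    (2:ℤ)^(j+1) ∣ u (n + z * (2^j*(k+1))) - u n := by
  obtain ⟨v, hv, h⟩ := recS_shift hu j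
  rw [if_neg (by omega)] at h
  induction z with
  | zero => simp
  | succ z ih =>
    have := h (n + z * (2^j*(k+1)))
    rw [show n + (z+1) * (2^j*(k+1)) = n + z * (2^j*(k+1)) + 2^j*(k+1) by ring]
    rw [one_mul] at this
    rw [this, show ∀ a b c : ℤ, a + b - c = (a - c) + b by intros; ring]
    exact dvd_add ih (dvd_mul_right _ _)

lemma recS_lin {k : ℕ} {u : ℕ → ℤ} (hu : RecS k u) {j : ℕ} (hj : 1 ≤ j) (n z : ℕ) :
    (2:ℤ)^(2*j+2) ∣ u (n + z * (2^j*(k+1))) - (u n + z * (u (n + 2^j*(k+1)) - u n)) := by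
  obtain ⟨v, hv, h⟩ := recS_shift hu j
  rw [if_neg (by omega)] at h
  simp only [one_mul] at h
  induction z with
  | zero => simp
  | succ z ih =>
    have h3 := recS_mod hv hj n z
    have := h (n + z * (2^j*(k+1)))
    rw [show n + (z+1) * (2^j*(k+1)) = n + z * (2^j*(k+1)) + 2^j*(k+1) by ring, this]
    rw [h n] at ih ⊢
    have e : u (n + z * (2 ^ j * (k + 1))) + 2 ^ (j + 1) * v (n + z * (2 ^ j * (k + 1))) -
      (u n + ((z+1:ℕ):ℤ) * (u n + 2 ^ (j + 1) * v n - u n)) =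
      (u (n + z * (2 ^ j * (k + 1))) - (u n + z * (u n + 2 ^ (j + 1) * v n - u n))) +
      2^(j+1) * (v (n + z * (2 ^ j * (k + 1))) - v n) := by push_cast; ring
    rw [e]
    refine dvd_add ih ?_
    rw [show 2*j+2 = (j+1)+(j+1) by ring, pow_add]
    exact mul_dvd_mul_left _ h3

/-- level terms -/
def tau : ℕ → ℕ → ℤ
  | 0, i => (-1)^i * 2
  | 1, i => (-1)^i * (4 * i + 1)
  | N+2, i => (-1)^i * 2^N * (8 * ((N+2+i).choose i) - 6 * ((N+1+i).choose i) + ((N+i).choose i))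

lemma tau_rec (N i : ℕ) : tau (N+1) (i+1) = 2 * tau N (i+1) - tau (N+1) i := by
  have key : ∀ a b : ℕ, ((a+1+(b+1)).choose (b+1) : ℤ) = ((a+(b+1)).choose (b+1)) + ((a+1+b).choose b) := by
    intro a b
    rw [show a+1+(b+1) = (a+(b+1)) + 1 by ring, Nat.choose_succ_succ]
    push_cast
    rw [show a + (b+1) = a+1+b by ring]; ring
  match N with
  | 0 => simp [tau]; ring
  | 1 =>
    simp only [tau]
    have h1 := key 1 i
    have h2 := key 0 i
    norm_num at h1 h2
    simp only [Nat.zero_add, pow_zero, Nat.choose_self] at *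
    have e1 : ((1 + (i+1)).choose (i+1) : ℤ) = i + 2 := by
      rw [show 1 + (i+1) = (i+1)+1 by ring, Nat.choose_succ_self_right]; push_cast; ring
    have e2 : ((1 + i).choose i : ℤ) = i + 1 := by
      rw [show 1 + i = i+1 by ring, Nat.choose_succ_self_right]; push_cast; ring
    rw [show (2 + (i+1)).choose (i+1) = (1+1 + (i+1)).choose (i+1) by rfl, key 1 i, e1,e2]
    push_cast
    ring
  | N+2 =>
    simp only [tau]
    have h1 := key (N+2) i
    have h2 := key (N+1) i
    have h3 := key N i
    rw [show N+1+2 = N+2+1 by ring, h1, show N+1+1 = N+2 by ring, show N + 2 = N+1+1 by ring, h2, h3]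
    ring

lemma tau_dvd (N i : ℕ) : (2:ℤ)^N ∣ tau (N+2) i :=
  ⟨(-1)^i * (8 * ((N+2+i).choose i) - 6 * ((N+1+i).choose i) + ((N+i).choose i)), by simp only [tau]; ring⟩

def tq (k n i : ℕ) : ℤ := if (k+1)*i ≤ n then tau (n - (k+1)*i) i else 0

lemma tq_succ_zero (k n : ℕ) (hn : 2 ≤ n) : tq k (n+1) 0 = 2 * tq k n 0 := by
  obtain ⟨j, rfl⟩ : ∃ j, n = j+2 := ⟨n-2, by omega⟩
  simp [tq, tau]; ring
lemma tq_lt {k n i : ℕ} (h : n < k+1) : tq k n (i+1) = 0 := by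
  rw [tq, if_neg]; nlinarith
lemma tq_succ (k n i : ℕ) : tq k (n+(k+1)) (i+1) = 2 * tq k (n+k) (i+1) - tq k n i := by
  have e1 : (k+1)*(i+1) = (k+1)*i + (k+1) := by ring
  unfold tq
  rcases lt_trichotomy ((k+1)*i) n with h | h | h
  · obtain ⟨N, hN⟩ : ∃ N, n = (k+1)*i + N + 1 := ⟨n - (k+1)*i - 1, by omega⟩
    rw [if_pos (by omega), if_pos (by omega), if_pos (by omega)]
    rw [show n + (k+1) - (k+1)*(i+1) = N+1 by omega, show n + k - (k+1)*(i+1) = N by omega,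
      show n - (k+1)*i = N+1 by omega, tau_rec]
  · rw [if_pos (by omega), if_neg (by omega), if_pos (by omega)]
    rw [show n + (k+1) - (k+1)*(i+1) = 0 by omega, show n - (k+1)*i = 0 by omega]
    simp [tau]; ring
  · rw [if_neg (by omega), if_neg (by omega), if_neg (by omega)]; simp

lemma lL_eq {k : ℕ} (hk : 2 ≤ k) (n : ℕ) : ∀ Q, n ≤ Q →
    lucasL k n = ∑ i ∈ Finset.range (Q+1), tq k n i := by
  induction n using Nat.strong_induction_on with
  | _ n ih =>
  intro Q hQ
  by_cases h2 : n ≤ 2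
  · rw [Finset.sum_range_succ', Finset.sum_eq_zero (fun i _ => tq_lt (by omega))]
    interval_cases n
    · simp [lL_0 hk, tq, tau]
    · simp [lL_1 hk, tq, tau]
    · simp [lL_2 hk, tq, tau]
  · obtain ⟨Q, rfl⟩ : ∃ Q', Q = Q'+1 := ⟨Q-1, by omega⟩
    rw [Finset.sum_range_succ']
    by_cases h3 : n ≤ k
    · obtain ⟨n, rfl⟩ : ∃ n', n = n'+1 := ⟨n-1, by omega⟩
      rw [lL_rec_lt hk (by omega) (by omega), ih n (by omega) (Q+1) (by omega),
        Finset.sum_range_succ', tq_succ_zero _ _ (by omega),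
        Finset.sum_eq_zero (fun i _ => tq_lt (by omega)),
        Finset.sum_eq_zero (fun i _ => tq_lt (by omega))]
      ring
    · obtain ⟨n, rfl⟩ : ∃ n', n = n'+(k+1) := ⟨n-(k+1), by omega⟩
      rw [lL_rec hk, ih (n+k) (by omega) (Q+1) (by omega), ih n (by omega) Q (by omega),
        Finset.sum_range_succ', show n+(k+1) = n+k+1 by ring, tq_succ_zero _ _ (by omega),
        show n+k+1 = n+(k+1) by ring]
      simp only [tq_succ, Finset.sum_sub_distrib, ← Finset.mul_sum]
      ring

lemma recS_lucas {k : ℕ} (hk : 2 ≤ k) : RecS k (lucasL k) := lL_rec hk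

/-- level sum: `S q = ∑_{i ≤ q} tau (N0 + (q-i) M) i` -/
def lev (k N0 : ℕ) : ℕ → ℤ
  | 0 => tau N0 0
  | q+1 => tau N0 (q+1) + lev k (N0+(k+1)) q

lemma lL_lev {k : ℕ} (hk : 2 ≤ k) (q r : ℕ) (hr : r < k+1) : lucasL k ((k+1)*q+r) = lev k r q := by
  have gen : ∀ q N0, lev k N0 q = ∑ i ∈ Finset.range (q+1), tau ((k+1)*q+N0 - (k+1)*i) i := by
    intro q
    induction q with
    | zero => intro N0; simp [lev]
    | succ q ih =>
      intro N0
      rw [lev, ih, Finset.sum_range_succ _ (q+1), add_comm]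
      congr 1
      · refine Finset.sum_congr rfl fun i _ => ?_
        congr 1
        congr 1; ring
      · congr 1; simp
  rw [gen, lL_eq hk ((k+1)*q+r) ((k+1)*q+r) le_rfl]
  have hq : q + 1 ≤ (k+1)*q+r+1 := by nlinarith
  rw [← Finset.sum_subset (Finset.range_mono hq)]
  · refine Finset.sum_congr rfl fun i hi => ?_
    rw [Finset.mem_range] at hi
    rw [tq, if_pos]
    have : (k+1)*i ≤ (k+1)*q := Nat.mul_le_mul_left _ (by omega)
    omega
  · intro i _ hi
    rw [Finset.mem_range, not_lt] at hi
    rw [tq, if_neg]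
    have : (k+1)*(q+1) ≤ (k+1)*i := Nat.mul_le_mul_left _ (by omega)
    nlinarith

noncomputable section
def frc {α : Type} (x : ℕ) (f : ℕ → α) : α := Nat.rec (f 0) (fun y _ => f (Nat.succ y)) x
def blk (y : ℕ) : ℕ :=
  Nat.mul (Nat.mul (Nat.mul y (Nat.add y 14)) (Nat.mul (Nat.add y 26) (Nat.add y 36)))
    (Nat.mul (Nat.mul (Nat.add y 44) (Nat.add y 50)) (Nat.mul (Nat.add y 54) (Nat.add y 56)))
def prb (m n : ℕ) : ℕ → ℕ → ℕ :=
  Nat.rec (fun _ acc => acc) (fun _ ih x acc =>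
    ih (Nat.add x 16) (Nat.mod (Nat.mul acc (blk (Nat.mul x (Nat.add x 15)))) m)) n
def rr1 (n x : ℕ) : ℕ := cond (Nat.beq (Nat.mod n 2) 1) x 1
def rr2 (n x : ℕ) : ℕ := cond (Nat.beq (Nat.mod (Nat.div n 2) 2) 1)
  (Nat.mul (Nat.mul x (Nat.add x 1)) (rr1 n (Nat.add x 2))) (rr1 n x)
def b4 (y : ℕ) : ℕ := Nat.mul y (Nat.add y 2)
def rr4 (n x : ℕ) : ℕ := cond (Nat.beq (Nat.mod (Nat.div n 4) 2) 1)
  (Nat.mul (b4 (Nat.mul x (Nat.add x 3))) (rr2 n (Nat.add x 4))) (rr2 n x)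
def b8 (y : ℕ) : ℕ := Nat.mul (Nat.mul y (Nat.add y 6)) (Nat.mul (Nat.add y 10) (Nat.add y 12))
def rr8 (n x : ℕ) : ℕ := cond (Nat.beq (Nat.mod (Nat.div n 8) 2) 1)
  (Nat.mul (b8 (Nat.mul x (Nat.add x 7))) (rr4 n (Nat.add x 8))) (rr4 n x)
def rp (m x n : ℕ) : ℕ :=
  prb m (Nat.div n 16) x (Nat.mod (rr8 n (Nat.add x (Nat.mul 16 (Nat.div n 16)))) m)
def inv2 (o m : ℕ) : ℕ := Nat.rec (Nat.mod o m) (fun _ x =>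
  frc x fun x => Nat.mod (Nat.mul x (Nat.add 2 (Nat.mul (Nat.sub m 1) (Nat.mul o x)))) m) 9
def zz (N i : ℕ) : ℕ := Nat.add (Nat.mul (Nat.sub (Nat.add N i) 1) (Nat.add (Nat.mul 2 N) (Nat.mul 8 i)))
  (Nat.mul N (Nat.sub N 1))
def evL (PP k : ℕ) (ws : List ℕ) : ℕ → ℕ → ℕ → ℕ :=
  List.rec (fun _ _ _ => 0) (fun w _ ih N i P => cond (Nat.ble PP (Nat.pow 2 N)) 0
    (Nat.mod (Nat.add
        (cond (Nat.beq (Nat.mod i 2) 1)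
          (Nat.sub PP (Nat.mod (Nat.mul (Nat.mul w (zz N i)) P) PP)) (Nat.mul (Nat.mul w (zz N i)) P))
        (cond (Nat.beq i 0) 0 (ih (Nat.add N (Nat.succ k)) (Nat.sub i 1)
          (Nat.mod (Nat.mul (Nat.mul P i) (rp PP (Nat.sub (Nat.add i N) 1) k)) PP)))) PP)) ws
def fv (k r : ℕ) (ws : List ℕ) (PP q : ℕ) : ℕ :=
  cond (Nat.ble 2 r) (evL PP k ws r q (rp PP (Nat.succ q) (Nat.sub r 2)))
    (Nat.add (cond (Nat.beq (Nat.mod q 2) 1)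
        (Nat.mul (Nat.sub PP 1) (cond (Nat.beq r 0) 8 (Nat.add (Nat.mul 16 q) 4)))
        (cond (Nat.beq r 0) 8 (Nat.add (Nat.mul 16 q) 4)))
      (cond (Nat.beq q 0) 0 (evL PP k ws (Nat.add r (Nat.succ k)) (Nat.sub q 1)
        (rp PP q (Nat.sub (Nat.add r (Nat.succ k)) 2)))))
def srch (fv : ℕ → ℕ → ℕ) (a PPm : ℕ) (ok : ℕ → ℕ → Bool) (fuel : ℕ) : ℕ → ℕ → Bool :=
  Nat.rec (fun _ _ => false) (fun u ih J c => cond (ok J c) true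
    (cond (Nat.beq J 1) (and (ih 2 0) (ih 2 1))
      (frc (frc (Nat.mul 16 (Nat.mul J J)) fun p => cond (Nat.ble p PPm) p PPm) fun PP =>
        frc (Nat.add c J) fun c1 =>
        frc (fv PP (Nat.sub (Nat.add u c) u)) fun x0 =>
        frc (Nat.mod (Nat.add (Nat.mul 9 x0) (Nat.mul 4 a)) PP) fun v =>
        frc (Nat.mod (Nat.add (Nat.mul 9 (fv PP (Nat.sub (Nat.add c1 u) u))) (Nat.mul (Nat.sub PP 1) (Nat.mul 9 x0))) PP)
          fun d => frc (Nat.gcd d PP) fun g => cond (Nat.beq (Nat.mod v g) 0)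
        (cond (Nat.beq g PP) (frc (Nat.mul 2 J) fun J2 => and (ih J2 c) (ih J2 c1))
          (frc (Nat.div PP g) fun mm =>
            frc (Nat.mod (Nat.mul (Nat.mul (Nat.sub mm 1) (Nat.div v g)) (inv2 (Nat.div d g) mm)) mm)
            fun z => cond (Nat.beq (Nat.mod (Nat.add v (Nat.mul z d)) PP) 0)
              (frc (Nat.mul J mm) fun J2 => frc (Nat.add c (Nat.mul J z)) fun c2 => ih J2 c2) false))
        true))) fuel
/-- continuation-passing builder of the weights; `f` is `N!` modulo `PPm^2` -/
def mk (k PPm Q : ℕ) (n : ℕ) : ℕ → ℕ → (List ℕ → Bool) → Bool :=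
  Nat.rec (fun _ _ K => K []) (fun _ ih N f K => frc (Nat.pow 2 N) fun t =>
    frc (Nat.gcd f t) fun g =>
    frc (Nat.mod (Nat.mul (inv2 (Nat.div f g) Q) (Nat.div t g)) Q) fun w =>
    cond (and (Nat.ble t PPm) (Nat.beq (Nat.mod (Nat.mul w f) Q) t))
      (frc (Nat.mod w PPm) fun w' => frc (Nat.add N (Nat.succ k)) fun N' =>
        frc (Nat.mod (Nat.mul f (rp Q (Nat.succ N) (Nat.succ k))) Q) fun f' =>
        ih N' f' (fun ws => K (w' :: ws))) false) n
def allL {α : Type} (p : α → Bool) (l : List α) : Bool := List.rec true (fun x _ ih => and (p x) ih) l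
/-- check for one residue `r`; `st` is the list of pairs `(a, c)`, started modulo `J0` -/
def chkr (k r n pm J0 : ℕ) (st : List (ℕ × ℕ)) (ok : ℕ → ℕ → ℕ → Bool) : Bool :=
  frc (Nat.pow 2 pm) fun PPm => frc (Nat.mul PPm PPm) fun Q =>
  frc (cond (Nat.ble 2 r) r (Nat.add r (Nat.succ k))) fun N =>
  frc (rp Q 1 N) fun f => mk k PPm Q n N f fun ws =>
  allL (fun p => Prod.rec (fun a c => frc (Nat.mod c J0) fun c =>
    srch (fv k r ws) a PPm (ok a) 60 J0 c) p) st
def chkB (k J0 : ℕ) (st : List (ℕ × List (ℕ × ℕ))) (Bd : ℕ) : Bool :=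
  frc (Nat.add (Nat.log2 Bd) 20) fun pm =>
  allL (fun p => Prod.rec (fun r st => cond (Nat.ble r k)
    (chkr k r (Nat.div (Nat.sub (Nat.add pm k) (cond (Nat.ble 2 r) r (Nat.add r (Nat.succ k))))
      (Nat.succ k)) pm J0 st (fun _ _ c => Nat.ble Bd c)) true) p) st
def chk (k J0 : ℕ) (st : List (ℕ × List (ℕ × ℕ))) : Bool :=
  frc (Nat.mul (Nat.pow (Nat.succ k) 35) (Nat.pow 2 240)) (chkB k J0 st)
def st0 : List (ℕ × ℕ) := [(1, 0), (2, 0), (3, 0), (4, 0), (5, 0), (6, 0), (7, 0), (8, 0), (9, 0)]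
def stA : List (ℕ × List (ℕ × ℕ)) := [(0, st0), (1, st0), (2, st0), (3, st0), (4, st0), (5, st0)]
def stB : List (ℕ × List (ℕ × ℕ)) := [(1, [(5, 29127), (7, 50972)]), (2, [(1, 7326), (1, 51459), (5, 39120), (5, 47801), (9, 53202), (9, 65535)]), (4, [(4, 60424), (4, 23213), (8, 43834), (8, 58899)])]
def stC : List (ℕ × List (ℕ × ℕ)) := [(1, [(5, 128102389400760775), (7, 80063993375475484)]), (2, [(1, 47523774525349022), (1, 29736573276571907), (5, 125906868084316368), (5, 106320885913008825), (9, 113382906488541138), (9, 144115188075855871)]), (4, [(4, 83734245859257352), (4, 132867049628064429), (8, 51548126234716986), (8, 6851229831325203)])]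
def stD : List (ℕ × List (ℕ × ℕ)) := [(1, [(5, 226337330703831787363160632045486462339052043740659583404015605483820144418148522909266375), (7, 905349322815327149452642528181945849356208174962638333616062421935280577672594091637065500)]), (2, [(1, 625623655207680678125665274591105090087620191303015557690268215857268906671251323606277278), (1, 1946563832549942458723538723801777358392223645974976750481059243701690903521201579274062083), (5, 577502283147517551362808864085385346528759126768808820487681215888781952431461603736721616), (5, 984875277909292057939444108700948570366783922235785868897522612753802203644262057079782073), (9, 1119446118941095998718559050715910611002585020624514894579713060447355988593887241127448530), (9, 2037035976334486086268445688409378161051468393665936250636140449354381299763336706183397375)]), (4, [(4, 721776924220182805146681003119925895216927667334147009990574645781011525381658676496559112), (4, 1670533795353865038102645670508697307419672002642592150154907007705298381604616788107025069), (8, 1547615017632552086212874261729012937327948949923760411475058960589679374220328959514422074), (8, 1799142523555290102034141591107764164798003271365947493650490470111706902875889152976414227)])]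
/-- `k`-independent check -/
def chkI (pm : ℕ) (ok : ℕ → ℕ → ℕ → ℕ → Bool) : Bool :=
  allL (fun p => Prod.rec (fun r st => chkr 0 r (cond (Nat.ble 2 r) 1 0) pm 1 st (ok r)) p) stA
def anyL {α : Type} (p : α → Bool) (l : List α) : Bool := List.rec false (fun x _ ih => or (p x) ih) l
def okS (JT : ℕ) (st : List (ℕ × List (ℕ × ℕ))) (r a J c : ℕ) : Bool := and (Nat.beq (Nat.mod J JT) 0)
  (anyL (fun p => Prod.rec (fun r' l => and (Nat.beq r r')
    (anyL (fun x => Prod.rec (fun a' c' => and (Nat.beq a a') (Nat.beq (Nat.mod c JT) c')) x) l)) p) st)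
end

lemma frc_eq {α : Type} (x : ℕ) (f : ℕ → α) : frc x f = f x := by cases x <;> rfl

lemma nmod (a b : ℕ) : Nat.mod a b = a % b := rfl
lemma ndiv (a b : ℕ) : Nat.div a b = a / b := rfl
lemma npow (a b : ℕ) : Nat.pow a b = a ^ b := rfl
lemma nsub (a b : ℕ) : Nat.sub a b = a - b := rfl
lemma nbeq (a b : ℕ) : Nat.beq a b = decide (a = b) := by
  rw [Bool.eq_iff_iff]; simp
lemma nble (a b : ℕ) : Nat.ble a b = decide (a ≤ b) := by
  rw [Bool.eq_iff_iff]; simp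

lemma asc_add (x m n : ℕ) : x.ascFactorial (m+n) = x.ascFactorial m * (x+m).ascFactorial n :=
  (Nat.ascFactorial_mul_ascFactorial x m n).symm

lemma prb_eq (m n : ℕ) : ∀ x acc, prb m n x acc ≡ acc * x.ascFactorial (16*n) [MOD m] := by
  induction n with
  | zero => intro x acc; simp [prb]; rfl
  | succ n ih =>
    intro x acc
    show prb m n (x+16) ((acc * blk (x*(x+15))) % m) ≡ _ [MOD m]
    refine (ih _ _).trans ?_
    rw [show 16*(n+1) = 16+16*n by ring, asc_add, ← mul_assoc]
    refine Nat.ModEq.mul_right _ ((Nat.mod_modEq _ _).trans ?_)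
    have : blk (x*(x+15)) = x.ascFactorial 16 := by
      simp only [blk, Nat.ascFactorial, Nat.mul_eq, Nat.add_eq]; ring
    rw [this]

lemma rr1_eq (n x : ℕ) : rr1 n x = x.ascFactorial (n%2) := by
  unfold rr1
  rcases Nat.mod_two_eq_zero_or_one n with h | h <;> simp [h, Nat.ascFactorial, nmod, nbeq]
lemma rr2_eq (n x : ℕ) : rr2 n x = x.ascFactorial (n%4) := by
  unfold rr2
  have e : n % 4 = 2*(n/2%2) + n%2 := by omega
  rw [e, rr1_eq, rr1_eq]
  rcases Nat.mod_two_eq_zero_or_one (n/2) with h | h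
  · simp [h, nmod, ndiv, nbeq]
  · simp [h, asc_add, Nat.ascFactorial, nmod, ndiv, nbeq]; left; ring
lemma rr4_eq (n x : ℕ) : rr4 n x = x.ascFactorial (n%8) := by
  unfold rr4
  have e : n % 8 = 4*(n/4%2) + n%4 := by omega
  rw [e, rr2_eq, rr2_eq]
  rcases Nat.mod_two_eq_zero_or_one (n/4) with h | h
  · simp [h, nmod, ndiv, nbeq]
  · simp [h, asc_add, Nat.ascFactorial, b4, nmod, ndiv, nbeq]; left; ring
lemma rr8_eq (n x : ℕ) : rr8 n x = x.ascFactorial (n%16) := by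
  unfold rr8
  have e : n % 16 = 8*(n/8%2) + n%8 := by omega
  rw [e, rr4_eq, rr4_eq]
  rcases Nat.mod_two_eq_zero_or_one (n/8) with h | h
  · simp [h, nmod, ndiv, nbeq]
  · simp [h, asc_add, Nat.ascFactorial, b8, nmod, ndiv, nbeq]; left; ring
lemma rp_eq (m x n : ℕ) : rp m x n ≡ x.ascFactorial n [MOD m] := by
  show prb m (n/16) x (rr8 n (x+16*(n/16)) % m) ≡ _ [MOD m]
  refine (prb_eq _ _ _ _).trans ?_
  have e : n = 16*(n/16) + n%16 := by omega
  conv_rhs => rw [e, asc_add, mul_comm]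
  refine Nat.ModEq.mul_right _ ((Nat.mod_modEq _ _).trans ?_)
  rw [rr8_eq]

lemma tau_asc (N i : ℕ) : 4 * tau (N+2) i * ((N+2).factorial : ℤ) =
    (-1)^i * 2^(N+2) * ((i+1).ascFactorial N : ℤ) * (zz (N+2) i : ℤ) := by
  have h0 : ((N+i).choose i : ℤ) * N.factorial = ((i+1).ascFactorial N : ℤ) := by
    have := Nat.ascFactorial_eq_factorial_mul_choose i N
    rw [show i + N = N + i by ring] at this
    rw [this, ← Nat.choose_symm_add]; push_cast; ring
  have h1 : ((N+1+i).choose i : ℤ) * (N+1) = ((N+i).choose i : ℤ) * (N+1+i) := by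
    have := Nat.add_one_mul_choose_eq (N+i) N
    have e1 : (N+i).choose N = (N+i).choose i := by rw [Nat.choose_symm_add]
    have e2 : (N+1+i).choose (N+1) = (N+1+i).choose i := by rw [Nat.choose_symm_add]
    rw [e1, show N+i+1 = N+1+i by ring, e2] at this
    have t : (((N+1+i) * (N+i).choose i : ℕ) : ℤ) = (((N+1+i).choose i * (N+1) : ℕ) : ℤ) := by rw [this]
    push_cast at t; linarith
  have h2 : ((N+2+i).choose i : ℤ) * (N+2) = ((N+1+i).choose i : ℤ) * (N+2+i) := by
    have := Nat.add_one_mul_choose_eq (N+1+i) (N+1)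
    have e1 : (N+1+i).choose (N+1) = (N+1+i).choose i := by rw [Nat.choose_symm_add]
    have e2 : (N+2+i).choose (N+2) = (N+2+i).choose i := by rw [Nat.choose_symm_add]
    rw [e1, show N+1+i+1 = N+2+i by ring, show N+1+1 = N+2 by ring, e2] at this
    have t : (((N+2+i) * (N+1+i).choose i : ℕ) : ℤ) = (((N+2+i).choose i * (N+2) : ℕ) : ℤ) := by rw [this]
    push_cast at t; linarith
  have hz : (zz (N+2) i : ℤ) = (N+1+i)*(2*(N+2)+8*i) + (N+2)*(N+1) := by
    have e : zz (N+2) i = (N+1+i)*(2*(N+2)+8*i) + (N+2)*(N+1) := by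
      show (N+2+i-1)*(2*(N+2)+8*i) + (N+2)*(N+2-1) = _
      rw [show N+2+i-1 = N+1+i by omega, show N+2-1 = N+1 by omega]
    rw [e]; push_cast; ring
  rw [hz, ← h0, Nat.factorial_succ, Nat.factorial_succ]
  simp only [tau]
  push_cast
  rw [show N+2 = N+2 from rfl]
  have key : (8 * ((N+2+i).choose i : ℤ) - 6 * ((N+1+i).choose i) + ((N+i).choose i)) * ((N+2)*(N+1)) =
      ((N+i).choose i : ℤ) * ((N+1+i)*(2*(N+2)+8*i) + (N+2)*(N+1)) := by
    linear_combination 8*((N:ℤ)+1)*h2 + (8*((N:ℤ)+2+i) - 6*(N+2)) * h1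
  rw [pow_add]
  linear_combination 4 * (-1)^i * 2^N * (N.factorial : ℤ) * key

/-- weights are correct -/
def WOK (k PPm : ℕ) : ℕ → List ℕ → Prop
  | _, [] => True
  | N, w :: ws => (∀ i, (PPm : ℤ) ∣ 4 * tau N i - (-1)^i * w * ((i+1).ascFactorial (N-2) : ℤ) * zz N i) ∧
      WOK k PPm (N+(k+1)) ws

lemma lev_dvd (k : ℕ) : ∀ q N, (2:ℤ)^N ∣ lev k (N+2) q := by
  intro q
  induction q with
  | zero => intro N; exact tau_dvd N 0
  | succ q ih =>
    intro N
    refine dvd_add (tau_dvd N _) ?_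
    rw [show N + 2 + (k+1) = (N+(k+1)) + 2 by ring]
    exact (pow_dvd_pow 2 (by omega)).trans (ih _)

lemma lev_dvd' (k q N p : ℕ) (hN : 2 ≤ N) (hp : p ≤ N) : (((2^p : ℕ)) : ℤ) ∣ 4 * lev k N q := by
  obtain ⟨M, rfl⟩ : ∃ M, N = M + 2 := ⟨N-2, by omega⟩
  push_cast
  refine (pow_dvd_pow 2 hp).trans ?_
  rw [pow_add, mul_comm]
  exact mul_dvd_mul (by norm_num) (lev_dvd k q M)

lemma evL_nil (PP k N i P : ℕ) : evL PP k [] N i P = 0 := rfl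
lemma evL_cons (PP k w : ℕ) (ws : List ℕ) (N i P : ℕ) : evL PP k (w :: ws) N i P =
    if PP ≤ 2^N then 0 else
      ((if i % 2 = 1 then PP - (w * zz N i * P) % PP else w * zz N i * P) +
        (if i = 0 then 0 else evL PP k ws (N+(k+1)) (i-1) ((P * i * rp PP (i+N-1) k) % PP))) % PP := by
  show cond (Nat.ble PP (2^N)) _ _ = _
  rw [nble, Bool.cond_decide]
  refine if_congr Iff.rfl rfl ?_
  show ((cond (Nat.beq (i%2) 1) _ _ + cond (Nat.beq i 0) _ _) % PP) = _
  rw [nbeq, nbeq, Bool.cond_decide, Bool.cond_decide]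
  rfl

lemma evL_spec (k pm p : ℕ) (hp : p ≤ pm) : ∀ (ws : List ℕ) (N i P : ℕ), 2 ≤ N → WOK k (2^pm) N ws →
    pm ≤ N + ws.length * (k+1) → P ≡ (i+1).ascFactorial (N-2) [MOD 2^p] →
    ((2^p : ℕ) : ℤ) ∣ evL (2^p) k ws N i P - 4 * lev k N i := by
  intro ws
  induction ws with
  | nil =>
    intro N i P hN _ hl _
    rw [evL_nil]
    simp only [List.length_nil, zero_mul, add_zero] at hl
    have := lev_dvd' k i N p hN (by omega)
    rw [Nat.cast_zero, zero_sub]; exact this.neg_right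
  | cons w ws ih =>
    intro N i P hN hW hl hP
    rw [evL_cons]
    by_cases h1 : 2^p ≤ 2^N
    · rw [if_pos h1]
      have : p ≤ N := (Nat.pow_le_pow_iff_right (by norm_num)).1 h1
      rw [Nat.cast_zero, zero_sub]; exact (lev_dvd' k i N p hN this).neg_right
    rw [if_neg h1]
    have hW1 : ((2^p : ℕ) : ℤ) ∣ 4 * tau N i - (-1)^i * w * ((i+1).ascFactorial (N-2) : ℤ) * zz N i :=
      (Int.natCast_dvd_natCast.2 (pow_dvd_pow 2 hp)).trans (hW.1 i)
    have hP' : ((2^p : ℕ) : ℤ) ∣ (P : ℤ) - ((i+1).ascFactorial (N-2) : ℤ) :=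
      (Nat.modEq_iff_dvd.1 hP.symm)
    have hpos : 0 < 2^p := by positivity
    have hS : ∀ T : ℕ, ((2^p : ℕ) : ℤ) ∣ (T : ℤ) - (-1)^i * ((w * zz N i * P : ℕ) : ℤ) →
        ((2^p : ℕ) : ℤ) ∣ (T : ℤ) - 4 * tau N i := by
      intro T hT
      have e : (T : ℤ) - 4 * tau N i = ((T : ℤ) - (-1)^i * ((w * zz N i * P : ℕ) : ℤ)) -
        (4 * tau N i - (-1)^i * w * ((i+1).ascFactorial (N-2) : ℤ) * zz N i) +
        ((P : ℤ) - ((i+1).ascFactorial (N-2) : ℤ)) * ((-1)^i * w * zz N i) := by push_cast; ring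
      rw [e]
      exact ((hT.sub hW1).add (hP'.mul_right _))
    have hT : ((2^p : ℕ) : ℤ) ∣ ((if i % 2 = 1 then 2^p - (w * zz N i * P) % 2^p else w * zz N i * P : ℕ) : ℤ)
        - 4 * tau N i := by
      apply hS
      split_ifs with h2
      · have hi : (-1:ℤ)^i = -1 := Odd.neg_one_pow (Nat.odd_iff.2 h2)
        rw [hi, Nat.cast_sub (Nat.mod_lt _ hpos).le, Int.natCast_mod]
        have := Int.emod_add_mul_ediv ((w * zz N i * P : ℕ):ℤ) ((2^p : ℕ):ℤ)
        refine ⟨1 + ((w * zz N i * P : ℕ):ℤ) / ((2^p : ℕ):ℤ), ?_⟩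
        linear_combination (-1) * this
      · have hi : (-1:ℤ)^i = 1 := Even.neg_one_pow (Nat.even_iff.2 (by omega))
        rw [hi, one_mul, sub_self]; exact dvd_zero _
    generalize (if i % 2 = 1 then 2^p - (w * zz N i * P) % 2^p else w * zz N i * P : ℕ) = T at hT ⊢
    have hmod : ∀ (x : ℕ) (y : ℤ), ((2^p : ℕ) : ℤ) ∣ (x : ℤ) - y → ((2^p : ℕ) : ℤ) ∣ ((x % 2^p : ℕ) : ℤ) - y := by
      intro x y h
      rw [Int.natCast_mod]
      have := Int.emod_add_mul_ediv (x:ℤ) ((2^p : ℕ):ℤ)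
      have e : (x:ℤ) % ((2^p : ℕ):ℤ) - y = ((x:ℤ) - y) - ((2^p : ℕ):ℤ) * ((x:ℤ) / ((2^p : ℕ):ℤ)) := by
        linear_combination this
      rw [e]; exact h.sub (dvd_mul_right _ _)
    apply hmod
    obtain _ | i := i
    · rw [if_pos rfl]; exact hT
    · rw [if_neg (by omega), Nat.add_sub_cancel]
      have hP2 : (P * (i+1) * rp (2^p) (i+1+N-1) k) % 2^p ≡ (i+1).ascFactorial (N+(k+1)-2) [MOD 2^p] := by
        refine (Nat.mod_modEq _ _).trans ?_
        refine ((hP.mul_right _).mul (rp_eq _ _ _)).trans ?_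
        obtain ⟨N, rfl⟩ : ∃ M, N = M+2 := ⟨N-2, by omega⟩
        rw [show N + 2 + (k+1) - 2 = 1 + (N + k) by omega, asc_add, asc_add,
          show i+1+(N+2)-1 = i+1+1+N by omega, show N+2-2 = N by omega]
        rw [show (i+1).ascFactorial 1 = i+1 by simp [Nat.ascFactorial]]
        rw [show (i + 1 + 1).ascFactorial N * (i + 1) * (i + 1 + 1 + N).ascFactorial k = (i + 1) * ((i + 1 + 1).ascFactorial N * (i + 1 + 1 + N).ascFactorial k) by ring]
      have h := ih (N+(k+1)) i _ (by omega) hW.2 (by rw [List.length_cons] at hl; linarith) hP2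
      have e : lev k N (i+1) = tau N (i+1) + lev k (N+(k+1)) i := rfl
      rw [e, Nat.cast_add]
      have := hT.add h
      generalize ((evL _ _ _ _ _ _ : ℕ) : ℤ) = E at this ⊢
      rw [show (T:ℤ) + E - 4 * (tau N (i+1) + lev k (N+(k+1)) i) = (T - 4 * tau N (i+1)) + (E - 4 * lev k (N+(k+1)) i) by ring]
      exact this

lemma fv_eq (k r : ℕ) (ws : List ℕ) (PP q : ℕ) : fv k r ws PP q =
    if 2 ≤ r then evL PP k ws r q (rp PP (q+1) (r-2)) else
     (if q % 2 = 1 then (PP-1) * (if r = 0 then 8 else 16*q+4) else (if r = 0 then 8 else 16*q+4)) +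
     (if q = 0 then 0 else evL PP k ws (r+(k+1)) (q-1) (rp PP q (r+(k+1)-2))) := by
  show cond (Nat.ble 2 r) _ (cond (Nat.beq (q%2) 1) ((PP-1) * cond (Nat.beq r 0) _ _) (cond (Nat.beq r 0) _ _) + cond (Nat.beq q 0) _ _) = _
  simp only [nble, nbeq, Bool.cond_decide]
  rfl

lemma fv_spec (k pm p r q : ℕ) (hk : 2 ≤ k) (hp : p ≤ pm) (hr : r < k+1) (ws : List ℕ)
    (hW : WOK k (2^pm) (if 2 ≤ r then r else r+(k+1)) ws)
    (hl : pm ≤ (if 2 ≤ r then r else r+(k+1)) + ws.length * (k+1)) :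
    ((2^p : ℕ) : ℤ) ∣ fv k r ws (2^p) q - 4 * lucasL k ((k+1)*q+r) := by
  rw [lL_lev hk q r hr, fv_eq]
  by_cases h : 2 ≤ r
  · rw [if_pos h] at hW hl ⊢
    exact evL_spec k pm p hp ws r q _ h hW hl (rp_eq _ _ _)
  · rw [if_neg h] at hW hl ⊢
    have hpos : 0 < 2^p := by positivity
    have h0 : ((2^p : ℕ) : ℤ) ∣ ((if q % 2 = 1 then (2^p-1) * (if r = 0 then 8 else 16*q+4) else (if r = 0 then 8 else 16*q+4) : ℕ) : ℤ) - 4 * tau r q := by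
      have ht : 4 * tau r q = (-1)^q * ((if r = 0 then 8 else 16*q+4 : ℕ) : ℤ) := by
        obtain rfl | rfl : r = 0 ∨ r = 1 := by omega
        · simp [tau]; ring
        · simp [tau]; ring
      rw [ht]
      generalize (if r = 0 then 8 else 16*q+4 : ℕ) = C
      split_ifs with h2
      · rw [Odd.neg_one_pow (Nat.odd_iff.2 h2), Nat.cast_mul, Nat.cast_sub hpos, Nat.cast_one]
        exact ⟨C, by ring⟩
      · rw [Even.neg_one_pow (Nat.even_iff.2 (by omega)), one_mul, sub_self]; exact dvd_zero _
    generalize (if q % 2 = 1 then (2^p-1) * (if r = 0 then 8 else 16*q+4) else (if r = 0 then 8 else 16*q+4) : ℕ) = T at h0 ⊢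
    obtain _ | q := q
    · rw [if_pos rfl]; exact h0
    · rw [if_neg (by omega), Nat.add_sub_cancel]
      have h1 := evL_spec k pm p hp ws (r+(k+1)) q _ (by omega) hW hl (rp_eq _ _ _)
      have e : lev k r (q+1) = tau r (q+1) + lev k (r+(k+1)) q := rfl
      rw [e, Nat.cast_add]
      have := h0.add h1
      generalize ((evL _ _ _ _ _ _ : ℕ) : ℤ) = E at this ⊢
      rw [show (T:ℤ) + E - 4 * (tau r (q+1) + lev k (r+(k+1)) q) = (T - 4 * tau r (q+1)) + (E - 4 * lev k (r+(k+1)) q) by ring]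
      exact this

lemma mk_succ (k PPm Q n N f : ℕ) (K : List ℕ → Bool) (h : mk k PPm Q (n+1) N f K = true) :
    ∃ w, 2^N ≤ PPm ∧ (w * f) % Q = 2^N ∧
      mk k PPm Q n (N+(k+1)) ((f * rp Q (N+1) (k+1)) % Q) (fun ws => K ((w % PPm) :: ws)) = true := by
  change (frc (2^N) fun t => frc (Nat.gcd f t) fun g =>
    frc (Nat.mod (Nat.mul (inv2 (Nat.div f g) Q) (Nat.div t g)) Q) fun w =>
    cond (and (Nat.ble t PPm) (Nat.beq (Nat.mod (Nat.mul w f) Q) t))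
      (frc (Nat.mod w PPm) fun w' => frc (Nat.add N (Nat.succ k)) fun N' =>
        frc (Nat.mod (Nat.mul f (rp Q (Nat.succ N) (Nat.succ k))) Q) fun f' =>
        mk k PPm Q n N' f' (fun ws => K (w' :: ws))) false) = true at h
  simp only [frc_eq] at h
  generalize Nat.mod (Nat.mul (inv2 (Nat.div f (Nat.gcd f (2^N))) Q) (Nat.div (2^N) (Nat.gcd f (2^N)))) Q = w at h
  rw [nble, nbeq] at h
  by_cases h1 : 2^N ≤ PPm
  · by_cases h2 : Nat.mod (Nat.mul w f) Q = 2^N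
    · rw [decide_eq_true h1, decide_eq_true h2] at h
      exact ⟨w, h1, h2, h⟩
    · rw [decide_eq_true h1, decide_eq_false h2] at h; simp at h
  · rw [decide_eq_false h1] at h; simp at h

lemma wok_step (pm N w f : ℕ) (hN : 2 ≤ N) (h1 : 2^N ≤ 2^pm) (hf : f ≡ N.factorial [MOD 2^pm * 2^pm])
    (h2 : (w * f) % (2^pm * 2^pm) = 2^N) (i : ℕ) :
    ((2^pm : ℕ) : ℤ) ∣ 4 * tau N i - (-1)^i * (w % 2^pm : ℕ) * ((i+1).ascFactorial (N-2) : ℤ) * zz N i := by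
  obtain ⟨M, rfl⟩ : ∃ M, N = M+2 := ⟨N-2, by omega⟩
  rw [Nat.add_sub_cancel]
  have hp : M+2 ≤ pm := (Nat.pow_le_pow_iff_right (by norm_num)).1 h1
  have ht := tau_asc M i
  set F : ℤ := ((M+2).factorial : ℤ) with hF
  set A : ℤ := ((i+1).ascFactorial M : ℤ)
  set X : ℤ := 4 * tau (M+2) i - (-1)^i * w * A * zz (M+2) i with hX
  have hQ : ((2:ℤ)^(2*pm)) ∣ 2^(M+2) - w * F := by
    have : w * (M+2).factorial ≡ 2^(M+2) [MOD 2^pm*2^pm] := by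
      rw [← h2]
      exact ((hf.symm.mul_left w)).trans (Nat.mod_modEq _ _).symm
    have := Nat.modEq_iff_dvd.1 this
    push_cast at this
    rw [two_mul, pow_add]; exact this
  have hFX : ((2:ℤ)^(2*pm)) ∣ F * X := by
    have : F * X = ((-1)^i * A * zz (M+2) i) * (2^(M+2) - w * F) := by
      rw [hX]; linear_combination ht
    rw [this]; exact hQ.mul_left _
  have h2X : ((2:ℤ)^(2*pm)) ∣ 2^(M+2) * X := by
    have : (2:ℤ)^(M+2) * X = (2^(M+2) - w * F) * X + w * (F * X) := by ring
    rw [this]; exact (hQ.mul_right _).add (hFX.mul_left _)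
  have hXd : ((2:ℤ)^pm) ∣ X := by
    have : ((2:ℤ)^(M+2)) * 2^pm ∣ 2^(M+2) * X := by
      rw [← pow_add]; exact (pow_dvd_pow 2 (by omega)).trans h2X
    exact Int.dvd_of_mul_dvd_mul_left (by positivity) this
  have hw : ((2:ℤ)^pm) ∣ (w:ℤ) - ((w % 2^pm : ℕ) : ℤ) := by
    have := Nat.modEq_iff_dvd.1 (Nat.mod_modEq w (2^pm))
    push_cast at this ⊢; exact this
  have e : 4 * tau (M+2) i - (-1)^i * ((w % 2^pm : ℕ) : ℤ) * A * zz (M+2) i =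
    X + ((w:ℤ) - ((w % 2^pm : ℕ) : ℤ)) * ((-1)^i * A * zz (M+2) i) := by rw [hX]; ring
  rw [e]; rw [Nat.cast_pow]
  exact hXd.add (hw.mul_right _)

lemma mk_spec (k pm : ℕ) : ∀ (n N f : ℕ) (K : List ℕ → Bool), 2 ≤ N →
    f ≡ N.factorial [MOD 2^pm * 2^pm] → mk k (2^pm) (2^pm*2^pm) n N f K = true →
    ∃ ws, WOK k (2^pm) N ws ∧ ws.length = n ∧ K ws = true := by
  intro n
  induction n with
  | zero => intro N f K _ _ h; exact ⟨[], trivial, rfl, h⟩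
  | succ n ih =>
    intro N f K hN hf h
    obtain ⟨w, h1, h2, h3⟩ := mk_succ _ _ _ _ _ _ _ h
    obtain ⟨ws, a, b, c⟩ := ih _ _ _ (by omega) (by
      refine (Nat.mod_modEq _ _).trans ((hf.mul (rp_eq _ _ _)).trans ?_)
      rw [Nat.factorial_mul_ascFactorial]) h3
    exact ⟨_ :: ws, ⟨wok_step pm N w f hN h1 hf h2, a⟩, by simp [b], c⟩

lemma srch_succ (fv : ℕ → ℕ → ℕ) (a PPm : ℕ) (ok : ℕ → ℕ → Bool) (u J c : ℕ)
    (h : srch fv a PPm ok (u+1) J c = true) (hok : ok J c = false) (hJ : J ≠ 1) :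
    ∃ PP v d g, PP = (if 16*(J*J) ≤ PPm then 16*(J*J) else PPm) ∧
      v = (9 * fv PP c + 4*a) % PP ∧ d = (9 * fv PP (c+J) + (PP-1) * (9 * fv PP c)) % PP ∧ g = Nat.gcd d PP ∧
      (v % g = 0 → (g = PP ∧ srch fv a PPm ok u (2*J) c = true ∧ srch fv a PPm ok u (2*J) (c+J) = true) ∨
        (g ≠ PP ∧ ∃ z, z % (PP/g) = z ∧ (v + z * d) % PP = 0 ∧ srch fv a PPm ok u (J * (PP / g)) (c + J*z) = true)) := by
  change (cond (ok J c) true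
    (cond (Nat.beq J 1) (and (srch fv a PPm ok u 2 0) (srch fv a PPm ok u 2 1))
      (frc (frc (Nat.mul 16 (Nat.mul J J)) fun p => cond (Nat.ble p PPm) p PPm) fun PP =>
        frc (Nat.add c J) fun c1 =>
        frc (fv PP (Nat.sub (Nat.add u c) u)) fun x0 =>
        frc (Nat.mod (Nat.add (Nat.mul 9 x0) (Nat.mul 4 a)) PP) fun v =>
        frc (Nat.mod (Nat.add (Nat.mul 9 (fv PP (Nat.sub (Nat.add c1 u) u))) (Nat.mul (Nat.sub PP 1) (Nat.mul 9 x0))) PP)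
          fun d => frc (Nat.gcd d PP) fun g => cond (Nat.beq (Nat.mod v g) 0)
        (cond (Nat.beq g PP) (frc (Nat.mul 2 J) fun J2 => and (srch fv a PPm ok u J2 c) (srch fv a PPm ok u J2 c1))
          (frc (Nat.div PP g) fun mm =>
            frc (Nat.mod (Nat.mul (Nat.mul (Nat.sub mm 1) (Nat.div v g)) (inv2 (Nat.div d g) mm)) mm)
            fun z => cond (Nat.beq (Nat.mod (Nat.add v (Nat.mul z d)) PP) 0)
              (frc (Nat.mul J mm) fun J2 => frc (Nat.add c (Nat.mul J z)) fun c2 => srch fv a PPm ok u J2 c2) false))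
        true))) = true at h
  rw [hok, nbeq, decide_eq_false hJ] at h
  simp only [frc_eq, cond_false] at h
  have e1 : Nat.sub (Nat.add u c) u = c := Nat.add_sub_cancel_left u c
  have e2 : Nat.sub (Nat.add (Nat.add c J) u) u = c + J := Nat.add_sub_cancel (c+J) u
  rw [e1, e2, nble, Bool.cond_decide] at h
  generalize hPP : (if Nat.mul 16 (Nat.mul J J) ≤ PPm then Nat.mul 16 (Nat.mul J J) else PPm) = PP at h
  generalize hv : Nat.mod (Nat.add (Nat.mul 9 (fv PP c)) (Nat.mul 4 a)) PP = v at h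
  generalize hd : Nat.mod (Nat.add (Nat.mul 9 (fv PP (c+J))) (Nat.mul (Nat.sub PP 1) (Nat.mul 9 (fv PP c)))) PP = d at h
  generalize hg : Nat.gcd d PP = g at h
  refine ⟨PP, v, d, g, by first | rfl | exact hPP.symm, by first | rfl | exact hv.symm, by first | rfl | exact hd.symm, by first | rfl | exact hg.symm, ?_⟩
  intro hv0
  rw [nmod, hv0, nbeq, decide_eq_true rfl, cond_true, nbeq, Bool.cond_decide] at h
  split_ifs at h with hgP
  · left
    exact ⟨hgP, (Bool.and_eq_true _ _ ▸ h :)⟩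
  · right
    rw [nbeq, Bool.cond_decide] at h
    split_ifs at h with h5
    exact ⟨hgP, Nat.mod (Nat.mul (Nat.mul (Nat.sub (Nat.div PP g) 1) (Nat.div v g)) (inv2 (Nat.div d g) (Nat.div PP g)))
      (Nat.div PP g), Nat.mod_mod _ _, h5, h⟩

def JS (F : ℕ → ℤ) : Prop := ∀ j, 1 ≤ j → ∀ c z : ℕ, (2:ℤ)^(2*j+2) ∣ F (c + z*2^j) - (F c + z * (F (c+2^j) - F c))

lemma srch_spec (F : ℕ → ℤ) (hF : JS F) (fv : ℕ → ℕ → ℕ) (a pm : ℕ) (ok : ℕ → ℕ → Bool)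
    (hfv : ∀ p q, p ≤ pm → ((2^p : ℕ) : ℤ) ∣ fv (2^p) q - 4 * F q) :
    ∀ u j c, (j = 0 → c = 0) → srch fv a (2^pm) ok u (2^j) c = true →
    ∀ z : ℕ, (2:ℤ)^pm ∣ 4 * (9 * F (c + 2^j*z) + a) →
      ∃ j' c' z', ok (2^j') c' = true ∧ c + 2^j*z = c' + 2^j'*z' := by
  intro u
  induction u with
  | zero => intro j c _ h; exact absurd h (by change ¬ (false = true); simp)
  | succ u ih =>
    intro j c hjc h z hz
    by_cases hok : ok (2^j) c = true
    · exact ⟨j, c, z, hok, rfl⟩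
    rw [Bool.not_eq_true] at hok
    by_cases hj : j = 0
    · subst hj
      obtain rfl := hjc rfl
      have h' : (srch fv a (2^pm) ok u 2 0 && srch fv a (2^pm) ok u 2 1) = true := by
        have h0 : (cond (ok (2^0) 0) true (srch fv a (2^pm) ok u 2 0 && srch fv a (2^pm) ok u 2 1)) = true := h
        rw [hok] at h0; exact h0
      rw [Bool.and_eq_true] at h'
      obtain ⟨h1, h2⟩ := h'
      rcases Nat.even_or_odd' z with ⟨y, rfl | rfl⟩
      · obtain ⟨j', c', z', a1, a2⟩ := ih 1 0 (by simp) h1 y (by rw [show 0+2^1*y = 0+2^0*(2*y) by ring]; exact hz)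
        exact ⟨j', c', z', a1, by rw [← a2]; ring⟩
      · obtain ⟨j', c', z', a1, a2⟩ := ih 1 1 (by simp) h2 y (by rw [show 1+2^1*y = 0+2^0*(2*y+1) by ring]; exact hz)
        exact ⟨j', c', z', a1, by rw [← a2]; ring⟩
    have hj1 : 1 ≤ j := Nat.one_le_iff_ne_zero.2 hj
    obtain ⟨PP, v, d, g, hPP, hv, hd, hg, H⟩ := srch_succ fv a _ ok u _ c h hok (by
      have : 2 ≤ 2^j := by calc 2 = 2^1 := rfl
                           _ ≤ 2^j := Nat.pow_le_pow_right (by norm_num) hj1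
      omega)
    obtain ⟨p, hpm, hp2, rfl⟩ : ∃ p, p ≤ pm ∧ p ≤ 2*j+4 ∧ PP = 2^p := by
      have e : 16*(2^j*2^j) = 2^(2*j+4) := by rw [pow_add, two_mul, pow_add]; ring
      rw [e] at hPP
      split_ifs at hPP with h7
      · exact ⟨2*j+4, (Nat.pow_le_pow_iff_right (by norm_num)).1 h7, le_rfl, hPP⟩
      · have := (Nat.pow_lt_pow_iff_right (by norm_num : 1 < 2)).1 (not_le.1 h7)
        exact ⟨pm, le_rfl, by omega, hPP⟩
    have hpos : 1 ≤ 2^p := Nat.one_le_two_pow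
    -- congruences
    have f0 := hfv p c hpm
    have f1 := hfv p (c+2^j) hpm
    generalize fv (2^p) c = x0 at *
    generalize fv (2^p) (c+2^j) = x1 at *
    have hv' : ((2^p:ℕ):ℤ) ∣ (v:ℤ) - (4 * (9 * F c + a)) := by
      have h1 : ((2^p:ℕ):ℤ) ∣ ((9 * x0 + 4*a : ℕ) : ℤ) - v := by
        rw [hv]; exact Nat.modEq_iff_dvd.1 (Nat.mod_modEq _ _)
      have := (f0.mul_left 9).sub h1
      rw [show (v:ℤ) - (4 * (9 * F c + a)) = 9 * (x0 - 4 * F c) - (((9 * x0 + 4*a : ℕ) : ℤ) - v) by push_cast; ring]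
      exact this
    have hd' : ((2^p:ℕ):ℤ) ∣ (d:ℤ) - 36 * (F (c+2^j) - F c) := by
      have h1 : ((2^p:ℕ):ℤ) ∣ ((9 * x1 + (2^p-1) * (9 * x0) : ℕ) : ℤ) - d := by
        rw [hd]; exact Nat.modEq_iff_dvd.1 (Nat.mod_modEq _ _)
      have h4 : ((2^p:ℕ):ℤ) ∣ ((2^p:ℕ):ℤ) * (9 * x0) := dvd_mul_right _ _
      have := (((f1.mul_left 9).sub (f0.mul_left 9)).sub h1).add h4
      rw [Nat.cast_add, Nat.cast_mul (2^p-1), Nat.cast_sub hpos] at this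
      generalize F (c+2^j) = F1 at *
      generalize F c = F0 at *
      generalize ((2^p:ℕ):ℤ) = P at *
      have e : (d:ℤ) - 36 * (F1 - F0) = 9 * (↑x1 - 4 * F1) - 9 * (↑x0 - 4 * F0) - (((9 * x1 : ℕ):ℤ) + (P - ((1:ℕ):ℤ)) * ((9 * x0:ℕ):ℤ) - ↑d) + P * (9 * ↑x0) := by
        push_cast; ring
      rw [e]; exact this
    have hlin : ∀ z : ℕ, ((2^p:ℕ):ℤ) ∣ 4 * (9 * F (c + 2^j*z) + a) - (v + z * d) := by
      intro z
      have h1 := (mul_dvd_mul_left 4 (hF j hj1 c z)).mul_left 9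
      have h1' : ((2^p:ℕ):ℤ) ∣ 9 * (4 * (F (c + z*2^j) - (F c + z * (F (c+2^j) - F c)))) := by
        refine dvd_trans ?_ h1
        push_cast
        calc (2:ℤ)^p ∣ 2^(2*j+4) := pow_dvd_pow 2 hp2
          _ = 4 * 2^(2*j+2) := by ring
      have := (h1'.sub hv').sub (hd'.mul_left z)
      rw [mul_comm (2^j) z]
      generalize F (c+z*2^j) = Fz at *
      generalize F (c+2^j) = F1 at *
      generalize F c = F0 at *
      have e : 4 * (9 * Fz + (a:ℤ)) - (v + z * d) = 9 * (4 * (Fz - (F0 + z * (F1 - F0)))) - (v - 4 * (9 * F0 + a)) - z * (d - 36 * (F1 - F0)) := by ring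
      rw [e]; exact this
    have hzd : ((2^p:ℕ):ℤ) ∣ v + z * d := by
      have h1 : ((2^p:ℕ):ℤ) ∣ 4 * (9 * F (c + 2^j*z) + a) := by
        refine dvd_trans ?_ hz
        push_cast; exact pow_dvd_pow 2 hpm
      have := h1.sub (hlin z)
      rwa [sub_sub_cancel] at this
    have hzd' : 2^p ∣ v + z * d := by exact_mod_cast hzd
    have hgd : g ∣ d := hg ▸ Nat.gcd_dvd_left _ _
    have hgP : g ∣ 2^p := hg ▸ Nat.gcd_dvd_right _ _
    have hvg : v % g = 0 := by
      apply Nat.mod_eq_zero_of_dvd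
      exact (Nat.dvd_add_left (hgd.mul_left z)).1 (hgP.trans hzd')
    rcases H hvg with ⟨_, h1, h2⟩ | ⟨hne, z0, hz0r, hz0, h1⟩
    · rw [show 2 * 2^j = 2^(j+1) by ring] at h1 h2
      rcases Nat.even_or_odd' z with ⟨y, rfl | rfl⟩
      · obtain ⟨j', c', z', a1, a2⟩ := ih (j+1) c (by simp) h1 y (by rw [show c+2^(j+1)*y = c+2^j*(2*y) by ring]; exact hz)
        exact ⟨j', c', z', a1, by rw [← a2]; ring⟩
      · obtain ⟨j', c', z', a1, a2⟩ := ih (j+1) (c+2^j) (by simp) h2 y (by rw [show c+2^j+2^(j+1)*y = c+2^j*(2*y+1) by ring]; exact hz)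
        exact ⟨j', c', z', a1, by rw [← a2]; ring⟩
    · -- class
      have hgpos : 0 < g := Nat.pos_of_dvd_of_pos hgP (by positivity)
      obtain ⟨t, ht1, rfl⟩ := (Nat.dvd_prime_pow Nat.prime_two).1 hgP
      rw [Nat.pow_div ht1 (by norm_num)] at hz0r
      rw [Nat.pow_div ht1 (by norm_num), ← pow_add] at h1
      have hz0' : 2^p ∣ v + z0 * d := Nat.dvd_of_mod_eq_zero hz0
      have hzz : z0 ≡ z [MOD 2^(p-t)] := by
        have e1 : d * z0 ≡ d * z [MOD 2^p] := by
          have : v + z0 * d ≡ v + z * d [MOD 2^p] :=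
            ((Nat.modEq_zero_iff_dvd.2 hz0').trans (Nat.modEq_zero_iff_dvd.2 hzd').symm)
          rw [mul_comm d, mul_comm d]; exact Nat.ModEq.add_left_cancel' v this
        have := Nat.ModEq.cancel_left_div_gcd (by positivity) e1
        rwa [Nat.gcd_comm, ← hg, Nat.pow_div ht1 (by norm_num)] at this
      obtain ⟨y, hy⟩ : ∃ y, z = z0 + 2^(p-t) * y := by
        refine ⟨z / 2^(p-t), ?_⟩
        have h8 : z0 % 2^(p-t) = z % 2^(p-t) := hzz
        rw [hz0r] at h8; rw [h8]; exact (Nat.mod_add_div _ _).symm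
      have e3 : c + 2^j*z0 + 2^(j+(p-t))*y = c + 2^j*z := by rw [hy, pow_add]; ring
      obtain ⟨j', c', z', a1, a2⟩ := ih (j+(p-t)) (c+2^j*z0) (by omega) h1 y (by rw [e3]; exact hz)
      exact ⟨j', c', z', a1, by rw [← a2, e3]⟩

lemma JS_lucas {k : ℕ} (hk : 2 ≤ k) (r : ℕ) : JS (fun q => lucasL k ((k+1)*q+r)) := by
  intro j hj c z
  have := recS_lin (recS_lucas hk) hj ((k+1)*c+r) z
  simp only
  rw [show (k+1)*(c+z*2^j)+r = (k+1)*c+r+z*(2^j*(k+1)) by ring,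
    show (k+1)*(c+2^j)+r = (k+1)*c+r+2^j*(k+1) by ring]
  exact this

lemma allL_iff {α : Type} (p : α → Bool) (l : List α) : allL p l = true ↔ ∀ x ∈ l, p x = true := by
  induction l with
  | nil => simp [allL]
  | cons x l ih =>
    have : allL p (x :: l) = (p x && allL p l) := rfl
    rw [this, Bool.and_eq_true, ih]; simp

lemma anyL_iff {α : Type} (p : α → Bool) (l : List α) : anyL p l = true ↔ ∃ x ∈ l, p x = true := by
  induction l with
  | nil => simp [anyL]
  | cons x l ih =>
    have : anyL p (x :: l) = (p x || anyL p l) := rfl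
    rw [this, Bool.or_eq_true, ih]; simp

lemma chkr_eq (k r n pm J0 : ℕ) (st : List (ℕ × ℕ)) (ok : ℕ → ℕ → ℕ → Bool) : chkr k r n pm J0 st ok =
    mk k (2^pm) (2^pm*2^pm) n (if 2 ≤ r then r else r+(k+1)) (rp (2^pm*2^pm) 1 (if 2 ≤ r then r else r+(k+1)))
      (fun ws => allL (fun p => srch (fv k r ws) p.1 (2^pm) (ok p.1) 60 J0 (p.2 % J0)) st) := by
  unfold chkr
  simp only [frc_eq, nble, Bool.cond_decide]
  rfl

lemma chkr_spec {k : ℕ} (hk : 2 ≤ k) (r n pm j : ℕ) (hr : r < k+1) (st : List (ℕ × ℕ)) (ok : ℕ → ℕ → ℕ → Bool)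
    (hl : pm ≤ (if 2 ≤ r then r else r+(k+1)) + n * (k+1)) (h : chkr k r n pm (2^j) st ok = true)
    (a c : ℕ) (hac : (a, c) ∈ st) (z : ℕ)
    (hz : (2:ℤ)^pm ∣ 4 * (9 * lucasL k ((k+1)*(c % 2^j + 2^j * z)+r) + a)) :
    ∃ j' c' z', ok a (2^j') c' = true ∧ c % 2^j + 2^j*z = c' + 2^j'*z' := by
  rw [chkr_eq] at h
  obtain ⟨ws, h1, h2, h3⟩ := mk_spec k pm n _ _ _ (by split_ifs <;> omega) (by
    refine (rp_eq _ _ _).trans ?_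
    rw [Nat.one_ascFactorial]) h
  rw [allL_iff] at h3
  have h4 := h3 _ hac
  subst h2
  exact srch_spec _ (JS_lucas hk r) (fv k r ws) a pm (ok a)
    (fun p q hp => fv_spec k pm p r q hk hp hr ws h1 hl) 60 j _ (by rintro rfl; simp [Nat.mod_one]) h4 z hz

lemma mk_one (k k' PPm Q N f : ℕ) (K : List ℕ → Bool) : mk k PPm Q 1 N f K = mk k' PPm Q 1 N f K := by
  have : ∀ k, mk k PPm Q 1 N f K = (frc (2^N) fun t => frc (Nat.gcd f t) fun g =>
    frc (Nat.mod (Nat.mul (inv2 (Nat.div f g) Q) (Nat.div t g)) Q) fun w =>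
    cond (and (Nat.ble t PPm) (Nat.beq (Nat.mod (Nat.mul w f) Q) t))
      (frc (Nat.mod w PPm) fun w' => frc (Nat.add N (Nat.succ k)) fun N' =>
        frc (Nat.mod (Nat.mul f (rp Q (Nat.succ N) (Nat.succ k))) Q) fun f' =>
        (K (w' :: []))) false) := fun k => rfl
  rw [this, this]
  simp only [frc_eq]

lemma srch_congr (f : ℕ → ℕ → ℕ) (g : ℕ → ℕ → ℕ) (h : ∀ x y, f x y = g x y) : srch f = srch g := by
  have : f = g := by funext x y; exact h x y
  rw [this]

lemma chkr_ind (k r pm J0 : ℕ) (st : List (ℕ × ℕ)) (ok : ℕ → ℕ → ℕ → Bool) :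
    chkr k r (if 2 ≤ r then 1 else 0) pm J0 st ok = chkr 0 r (if 2 ≤ r then 1 else 0) pm J0 st ok := by
  rw [chkr_eq, chkr_eq]
  by_cases h : 2 ≤ r
  · simp only [if_pos h]
    obtain ⟨w, hw⟩ : ∃ w : List ℕ → List ℕ, True := ⟨id, trivial⟩
    have key : ∀ w, fv k r [w] = fv 0 r [w] := by
      intro w
      funext PP q
      rw [fv_eq, fv_eq, if_pos h, if_pos h, evL_cons, evL_cons]
      simp only [evL_nil]
    rw [mk_one k 0]
    have : ∀ K K' : List ℕ → Bool, (∀ w, K [w] = K' [w]) → ∀ N f, mk 0 (2^pm) (2^pm*2^pm) 1 N f K = mk 0 (2^pm) (2^pm*2^pm) 1 N f K' := by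
      intro K K' hKK N f
      have e : ∀ K, mk 0 (2^pm) (2^pm*2^pm) 1 N f K = (frc (2^N) fun t => frc (Nat.gcd f t) fun g =>
        frc (Nat.mod (Nat.mul (inv2 (Nat.div f g) (2^pm*2^pm)) (Nat.div t g)) (2^pm*2^pm)) fun w =>
        cond (and (Nat.ble t (2^pm)) (Nat.beq (Nat.mod (Nat.mul w f) (2^pm*2^pm)) t))
        (frc (Nat.mod w (2^pm)) fun w' => frc (Nat.add N (Nat.succ 0)) fun N' =>
        frc (Nat.mod (Nat.mul f (rp (2^pm*2^pm) (Nat.succ N) (Nat.succ 0))) (2^pm*2^pm)) fun f' =>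
        (K (w' :: []))) false) := fun k => rfl
      rw [e, e]
      simp only [hKK]
    apply this
    intro w
    rw [key]
  · simp only [if_neg h]
    have key : fv k r [] = fv 0 r [] := by
      funext PP q
      rw [fv_eq, fv_eq, if_neg h, if_neg h]
      simp only [evL_nil]
    show allL _ _ = allL _ _
    rw [key]

lemma chkI_spec {k : ℕ} (hk : 2 ≤ k) (pm : ℕ) (ok : ℕ → ℕ → ℕ → ℕ → Bool) (h : chkI pm ok = true)
    (hp : pm ≤ k + 1) (r a q : ℕ) (hr : r ≤ 5) (hrk : r ≤ k) (ha : 1 ≤ a) (ha' : a ≤ 9)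
    (hz : (2:ℤ)^pm ∣ 4 * (9 * lucasL k ((k+1)*q+r) + a)) :
    ∃ j' c' z', ok r a (2^j') c' = true ∧ q = c' + 2^j'*z' := by
  unfold chkI at h
  rw [allL_iff] at h
  have hs : (r, st0) ∈ stA := by
    unfold stA; interval_cases r <;> simp
  have h1 : chkr 0 r (cond (Nat.ble 2 r) 1 0) pm 1 st0 (ok r) = true := h _ hs
  rw [nble, Bool.cond_decide, ← chkr_ind k] at h1
  have := chkr_spec hk r _ pm 0 (by omega) st0 (ok r) (by split_ifs <;> omega) h1 a 0
    (by unfold st0; interval_cases a <;> simp) q (by simpa [Nat.mod_one] using hz)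
  simpa [Nat.mod_one] using this

/-- bounded version -/
lemma chkB_spec {k : ℕ} (hk : 2 ≤ k) (j Bd : ℕ) (st : List (ℕ × List (ℕ × ℕ))) (h : chkB k (2^j) st Bd = true)
    (r a q c : ℕ) (hrk : r ≤ k) (l : List (ℕ × ℕ)) (hl : (r, l) ∈ st) (hac : (a, c) ∈ l)
    (hc : q % 2^j = c % 2^j) (hq : q < Bd) (P : ℕ) (hP : Nat.log2 Bd + 20 ≤ P + 2)
    (hz : (2:ℤ)^P ∣ 9 * lucasL k ((k+1)*q+r) + a) : False := by
  unfold chkB at h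
  rw [frc_eq, allL_iff] at h
  have h1 := h _ hl
  generalize hpm : Nat.add (Nat.log2 Bd) 20 = pm at h1
  have hpm' : pm ≤ P + 2 := by rw [← hpm]; exact hP
  simp only [nble, Bool.cond_decide] at h1
  rw [if_pos hrk] at h1
  have := chkr_spec hk r _ pm j (by omega) l _ (by
    rw [ndiv, nsub]
    change pm ≤ _ + (pm + k - (if 2 ≤ r then r else r+(k+1))) / (k+1) * (k+1)
    generalize (if 2 ≤ r then r else r+(k+1)) = N0
    have := Nat.div_add_mod (pm + k - N0) (k+1)
    have h2 := Nat.mod_lt (pm + k - N0) (show 0 < k+1 by omega)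
    rw [mul_comm] at this
    omega) h1 a c hac (q / 2^j) (by
      rw [← hc, Nat.mod_add_div]
      refine (pow_dvd_pow 2 hpm').trans ?_
      rw [pow_add, mul_comm]
      exact mul_dvd_mul (by norm_num) hz)
  obtain ⟨j', c', z', h5, h6⟩ := this
  rw [← hc, Nat.mod_add_div] at h6
  have : Bd ≤ c' := by simpa using h5
  have : c' ≤ q := by rw [h6]; exact Nat.le_add_right _ _
  omega
lemma chk_eq (k J0 : ℕ) (st : List (ℕ × List (ℕ × ℕ))) (h : chk k J0 st = true) :
    ∃ Bd, Bd = (k+1)^35*2^240 ∧ chkB k J0 st Bd = true := by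
  unfold chk at h
  rw [frc_eq] at h
  exact ⟨_, rfl, h⟩

set_option maxRecDepth 100000 in
theorem sI1 : chkI 588 (fun _ _ _ c => Nat.ble (2^572) c) = true := by decide +kernel
theorem sI2 : chkI 711 (fun _ _ _ c => Nat.ble (2^695) c) = true := by decide +kernel
theorem sI3 : chkI 748 (fun _ _ _ c => Nat.ble (2^730) c) = true := by decide +kernel
theorem sB : chkI 20 (okS (2^16) stB) = true := by decide +kernel
theorem sC : chkI 62 (okS (2^57) stC) = true := by decide +kernel
theorem sD : chkI 306 (okS (2^300) stD) = true := by decide +kernel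

set_option maxRecDepth 100000 in
set_option maxHeartbeats 0 in
theorem ckA (k : ℕ) (h : 2 ≤ k) (h' : k < 20) : chk k 1 stA = true := by
  interval_cases k <;> decide +kernel
set_option maxHeartbeats 0 in
theorem ckB (k : ℕ) (h : 20 ≤ k) (h' : k < 62) : chk k (2^15) stB = true := by
  interval_cases k <;> decide +kernel

set_option maxRecDepth 100000 in
set_option maxHeartbeats 0 in
theorem ckC (k : ℕ) (h : 62 ≤ k) (h' : k < 372) : chk k (2^34) stC = true := by
  interval_cases k <;> decide +kernel
set_option maxHeartbeats 0 in
theorem ckD (k : ℕ) (h : 372 ≤ k) (h' : k < 590) : chk k (2^290) stD = true := by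
  interval_cases k <;> decide +kernel

lemma okS_spec {t : ℕ} {st : List (ℕ × List (ℕ × ℕ))} {r a J c : ℕ} (h : okS (2^t) st r a J c = true) :
    2^t ∣ J ∧ ∃ l, (r, l) ∈ st ∧ (a, c % 2^t) ∈ l := by
  unfold okS at h
  rw [Bool.and_eq_true, anyL_iff] at h
  obtain ⟨h1, ⟨r', l⟩, hl, h2⟩ := h
  change (Nat.beq r r' && anyL _ l) = true at h2
  rw [Bool.and_eq_true, anyL_iff, nbeq, decide_eq_true_eq] at h2
  obtain ⟨rfl, ⟨a', c'⟩, hx, h3⟩ := h2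
  change (Nat.beq a a' && Nat.beq (Nat.mod c (2^t)) c') = true at h3
  rw [Bool.and_eq_true, nbeq, nbeq, decide_eq_true_eq, decide_eq_true_eq] at h3
  obtain ⟨rfl, rfl⟩ := h3
  rw [nbeq, decide_eq_true_eq] at h1
  exact ⟨Nat.dvd_of_mod_eq_zero h1, l, hl, hx⟩

lemma tierS {k : ℕ} (hk : 2 ≤ k) (pm t j : ℕ) (hjt : j ≤ t) (st : List (ℕ × List (ℕ × ℕ)))
    (h : chkI pm (okS (2^t) st) = true) (h' : chk k (2^j) st = true)
    (hp : pm ≤ k + 1) (r a q : ℕ) (hr : r ≤ 5) (hrk : r ≤ k) (ha : 1 ≤ a) (ha' : a ≤ 9)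
    (P : ℕ) (hP : Nat.log2 ((k+1)^35*2^240) + 20 ≤ P + 2) (hP2 : pm ≤ P)
    (hq : q < (k+1)^35*2^240)
    (hz : (2:ℤ)^P ∣ 9 * lucasL k ((k+1)*q+r) + a) : False := by
  obtain ⟨j', c', z', h1, h2⟩ := chkI_spec hk pm _ h hp r a q hr hrk ha ha'
    (((pow_dvd_pow 2 hP2).trans hz).mul_left _)
  obtain ⟨h3, l, h4, h5⟩ := okS_spec h1
  obtain ⟨Bd, hB, h6⟩ := chk_eq _ _ _ h'
  refine chkB_spec hk j Bd st h6 r a q _ hrk l h4 h5 ?_ (hB ▸ hq) P (hB ▸ hP) hz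
  rw [h2]
  have : 2^j ∣ 2^t := pow_dvd_pow 2 hjt
  rw [Nat.mod_mod_of_dvd _ this]
  exact (Nat.ModEq.trans (Nat.ModEq.add_left c' (Nat.modEq_zero_iff_dvd.2 ((this.trans h3).mul_right z'))) (by rw [add_zero]))

lemma tierI {k : ℕ} (hk : 2 ≤ k) (pm e : ℕ)
    (h : chkI pm (fun _ _ _ c => Nat.ble (2^e) c) = true)
    (hp : pm ≤ k + 1) (r a q : ℕ) (hr : r ≤ 5) (hrk : r ≤ k) (ha : 1 ≤ a) (ha' : a ≤ 9)
    (P : ℕ) (hP2 : pm ≤ P) (hq : q < 2^e)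
    (hz : (2:ℤ)^P ∣ 9 * lucasL k ((k+1)*q+r) + a) : False := by
  obtain ⟨j', c', z', h1, h2⟩ := chkI_spec hk pm _ h hp r a q hr hrk ha ha'
    (((pow_dvd_pow 2 hP2).trans hz).mul_left _)
  rw [nble, decide_eq_true_eq] at h1
  have : c' ≤ q := by rw [h2]; exact Nat.le_add_right _ _
  omega

set_option exponentiation.threshold 2000 in
theorem thmB {k : ℕ} (hk : 2 ≤ k) (hk' : k < 16383) (r a q : ℕ) (hrk : r ≤ k) (ha : 1 ≤ a) (ha' : a ≤ 9)
    (hq : q < (k+1)^35*2^240) (hz : (2:ℤ)^800 ∣ 9 * lucasL k ((k+1)*q+r) + a) : False := by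
  by_cases hr : 6 ≤ r
  · rw [lL_lev hk q r (by omega)] at hz
    obtain ⟨M, rfl⟩ : ∃ M, r = M + 2 := ⟨r-2, by omega⟩
    have h1 : (2:ℤ)^4 ∣ lev k (M+2) q := (pow_dvd_pow 2 (by omega)).trans (lev_dvd k q M)
    have h2 : (2:ℤ)^4 ∣ 9 * lev k (M+2) q + a := (pow_dvd_pow 2 (by norm_num)).trans hz
    have h3 : (2:ℤ)^4 ∣ a := (Int.dvd_add_right (h1.mul_left 9)).1 h2
    norm_num at h3
    omega
  have hr : r ≤ 5 := by omega
  have hlog : k < 590 → Nat.log2 ((k+1)^35*2^240) + 20 ≤ 800 + 2 := by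
    intro h
    have : Nat.log2 ((k+1)^35*2^240) < 782 := by
      rw [Nat.log2_lt (by positivity)]
      calc (k+1)^35*2^240 ≤ 590^35*2^240 := Nat.mul_le_mul_right _ (Nat.pow_le_pow_left (by omega) _)
        _ < 2^782 := by norm_num
    omega
  by_cases h1 : k < 20
  · obtain ⟨Bd, hB, h6⟩ := chk_eq _ _ _ (ckA k hk h1)
    exact chkB_spec hk 0 Bd stA h6 r a q 0 hrk st0 (by unfold stA; interval_cases r <;> simp)
      (by unfold st0; interval_cases a <;> simp) (by simp [Nat.mod_one]) (hB ▸ hq) 800 (hB ▸ hlog (by omega)) hz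
  by_cases h2 : k < 62
  · exact tierS hk 20 16 15 (by norm_num) stB sB (ckB k (by omega) h2) (by omega) r a q hr hrk ha ha' 800
      (hlog (by omega)) (by norm_num) hq hz
  by_cases h3 : k < 372
  · exact tierS hk 62 57 34 (by norm_num) stC sC (ckC k (by omega) h3) (by omega) r a q hr hrk ha ha' 800
      (hlog (by omega)) (by norm_num) hq hz
  by_cases h4 : k < 590
  · exact tierS hk 306 300 290 (by norm_num) stD sD (ckD k (by omega) h4) (by omega) r a q hr hrk ha ha' 800
      (hlog (by omega)) (by norm_num) hq hz
  by_cases h5 : k < 711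
  · refine tierI hk 588 572 sI1 (by omega) r a q hr hrk ha ha' 800 (by norm_num) (hq.trans_le ?_) hz
    calc (k+1)^35*2^240 ≤ 711^35*2^240 := Nat.mul_le_mul_right _ (Nat.pow_le_pow_left (by omega) _)
        _ ≤ 2^572 := by norm_num
  by_cases h6 : k < 8192
  · refine tierI hk 711 695 sI2 (by omega) r a q hr hrk ha ha' 800 (by norm_num) (hq.trans_le ?_) hz
    calc (k+1)^35*2^240 ≤ 8192^35*2^240 := Nat.mul_le_mul_right _ (Nat.pow_le_pow_left (by omega) _)
        _ ≤ 2^695 := by norm_num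
  · refine tierI hk 748 730 sI3 (by omega) r a q hr hrk ha ha' 800 (by norm_num) (hq.trans_le ?_) hz
    calc (k+1)^35*2^240 ≤ 16384^35*2^240 := Nat.mul_le_mul_right _ (Nat.pow_le_pow_left (by omega) _)
        _ ≤ 2^730 := by norm_num

structure IsA (k : ℕ) (α : ℝ) : Prop where
  lo : 1.6 < α
  hi : α < 2
  eq : α^k*(2-α) = 1

lemma exists_A {k : ℕ} (hk : 2 ≤ k) : ∃ α, IsA k α := by
  have hc : ContinuousOn (fun x : ℝ => x^k*(2-x)) (Set.Icc 1.6 2) := by fun_prop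
  have := intermediate_value_Ioo' (by norm_num : (1.6:ℝ) ≤ 2) hc
  have h1 : (1:ℝ) ∈ Set.Ioo ((2:ℝ)^k*(2-2)) ((1.6:ℝ)^k*(2-1.6)) := by
    constructor
    · simp
    · have : (1.6:ℝ)^2 ≤ 1.6^k := pow_le_pow_right₀ (by norm_num) hk
      norm_num at this ⊢; linarith
  obtain ⟨x, ⟨hx1, hx2⟩, hx⟩ := this h1
  exact ⟨x, hx1, hx2, hx⟩

def nm (α : ℝ) : ℝ := (2*α-1)*(α-1)
def dn (k : ℕ) (α : ℝ) : ℝ := α - k*(2-α)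

lemma kpow {k : ℕ} (hk : 2 ≤ k) : (k:ℝ) ≤ 0.79 * 1.6^k := by
  induction k, hk using Nat.le_induction with
  | base => norm_num
  | succ m hm ih =>
    have : (2:ℝ) ≤ m := by exact_mod_cast hm
    rw [pow_succ]; push_cast; linarith

namespace IsA
variable {k : ℕ} {α : ℝ}
lemma pos (h : IsA k α) : 0 < α := by linarith [h.lo]
lemma dn_lo (h : IsA k α) (hk : 2 ≤ k) : 0.8 ≤ dn k α := by
  have h1 := kpow hk
  have h2 : (1.6:ℝ)^k ≤ α^k := pow_le_pow_left₀ (by norm_num) h.lo.le k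
  have h3 : (k:ℝ)*(2-α) ≤ 0.79 := by
    have : (k:ℝ)*(2-α) ≤ 0.79 * α^k * (2-α) := by
      apply mul_le_mul_of_nonneg_right _ (by linarith [h.hi])
      linarith
    rw [mul_assoc, h.eq] at this; linarith
  unfold dn; linarith [h.lo]
lemma dn_hi (h : IsA k α) : dn k α ≤ 2 := by
  have : 0 ≤ (k:ℝ)*(2-α) := mul_nonneg (by positivity) (by linarith [h.hi])
  unfold dn; linarith [h.hi]
lemma nm_lo (h : IsA k α) : 1.32 ≤ nm α := by
  unfold nm; nlinarith [h.lo]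
lemma nm_hi (h : IsA k α) : nm α ≤ 3 := by
  unfold nm; nlinarith [h.lo, h.hi]
lemma c_lo (h : IsA k α) (hk : 2 ≤ k) : 0.66 ≤ nm α / dn k α := by
  rw [le_div_iff₀ (by linarith [h.dn_lo hk])]
  linarith [h.dn_hi, h.nm_lo]
lemma c_hi (h : IsA k α) (hk : 2 ≤ k) : nm α / dn k α ≤ 3.75 := by
  rw [div_le_iff₀ (by linarith [h.dn_lo hk])]
  linarith [h.dn_lo hk, h.nm_hi]

lemma geo (h : IsA k α) : (2-α) * ∑ j ∈ Finset.range k, α^j = 1 := by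
  have h1 := mul_geom_sum α k
  have h2 := h.eq
  have h3 : α - 1 ≠ 0 := by linarith [h.lo]
  apply mul_left_cancel₀ h3
  calc (α-1) * ((2-α) * ∑ j ∈ Finset.range k, α^j) = (2-α) * ((α-1) * ∑ j ∈ Finset.range k, α^j) := by ring
    _ = _ := by rw [h1]; linarith

/-- Binet approximation -/
lemma binet0 (h : IsA k α) (hk : 2 ≤ k) (m : ℕ) :
    |(genLucas k m : ℝ) - nm α / dn k α / α^(k-1) * α^m| ≤ 4 := by
  set u : ℕ → ℝ := fun m => (genLucas k m : ℝ) with hu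
  set c := nm α / dn k α with hc
  have hα := h.pos
  have hd := h.dn_lo hk
  have hcl := h.c_lo hk
  have hch := h.c_hi hk
  have hrec : ∀ m, k ≤ m → u (m+1) = 2 * u m - u (m-k) := by
    intro m hm; simp only [hu]; rw [gL_rec hk hm]; push_cast; ring
  obtain ⟨j0, rfl⟩ : ∃ j, k = j + 2 := ⟨k-2, by omega⟩
  set k := j0 + 2 with hkk
  have hW : ∀ i, u (k+i) - (2-α) * ∑ j ∈ Finset.range k, α^j * u (k+i-1-j) = nm α * α^i := by
    intro i
    induction i with
    | zero =>
      have e2 : u (k+0) = 3 := by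
        have := lL_2 hk; unfold lucasL at this
        simp only [hu]; rw [show k + 0 = 2 + k - 2 by omega, this]; norm_num
      have e1 : u (k-1) = 1 := by simp only [hu]; rw [gL_1 hk]; norm_num
      have e0 : u (k-2) = 2 := by simp only [hu]; rw [gL_0 hk]; norm_num
      rw [hkk, Finset.sum_range_succ', Finset.sum_range_succ', Finset.sum_eq_zero, ← hkk, e2]
      · simp only [add_zero, zero_add, Nat.sub_sub, pow_zero, pow_one, Nat.sub_zero]
        rw [show k - (1+1) = k-2 by rfl, e1, e0]; unfold nm; ring
      · intro i hi
        simp only [Finset.mem_range] at hi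
        simp only [hu]
        rw [gL_lt (by omega)]; simp
    | succ i ih =>
      have h1 := hrec (k+i) (by omega)
      rw [show k+i-k = i by omega] at h1
      have s1 : ∑ j ∈ Finset.range k, α^j * u (k+(i+1)-1-j) =
          u (k+i) + α * ∑ j ∈ Finset.range (k-1), α^j * u (k+i-1-j) := by
        rw [hkk, Finset.sum_range_succ', ← hkk]
        rw [Finset.mul_sum, add_comm]
        congr 1
        · simp
        · apply Finset.sum_congr (by congr 1)
          intro j _
          rw [show k + (i+1) - 1 - (j+1) = k+i-1-j by omega]; ring
      have s2 : ∑ j ∈ Finset.range k, α^j * u (k+i-1-j) =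
          ∑ j ∈ Finset.range (k-1), α^j * u (k+i-1-j) + α^(k-1) * u i := by
        rw [hkk, Finset.sum_range_succ]
        congr 3
        omega
      rw [s2] at ih
      rw [s1, show k+(i+1) = k+i+1 by ring, h1]
      have e := h.eq
      have : α^k = α * α^(k-1) := by rw [← pow_succ']; congr 1
      rw [this] at e
      rw [pow_succ]
      linear_combination α * ih + u i * e
  set v : ℕ → ℝ := fun m => u m - c / α^(k-1) * α^m with hv
  have hdc : c * dn k α = nm α := by rw [hc]; field_simp
  have hV : ∀ i, v (k+i) = (2-α) * ∑ j ∈ Finset.range k, α^j * v (k+i-1-j) := by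
    intro i
    have h1 := hW i
    have h2 : ∑ j ∈ Finset.range k, α^j * v (k+i-1-j) = ∑ j ∈ Finset.range k, α^j * u (k+i-1-j)
        - k * (c / α^(k-1) * α^(k+i-1)) := by
      simp only [hv, mul_sub, Finset.sum_sub_distrib]
      congr 1
      rw [Finset.sum_congr rfl (g := fun _ => c / α^(k-1) * α^(k+i-1))]
      · simp
      · intro j hj
        have hj' := Finset.mem_range.1 hj
        have : α^(k+i-1) = α^j * α^(k+i-1-j) := by rw [← pow_add]; congr 1; omega
        rw [this]; ring
    rw [h2]
    simp only [hv]
    have e1 : α^(k+i) = α^(k-1) * (α * α^i) := by rw [← pow_succ', ← pow_add]; congr 1; omega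
    have e2 : α^(k+i-1) = α^(k-1) * α^i := by rw [← pow_add]; congr 1; omega
    have hp : α^(k-1) ≠ 0 := by positivity
    rw [e1, e2]
    have e3 : c / α^(k-1) * (α^(k-1) * (α * α^i)) = c * α * α^i := by field_simp
    have e4 : c / α^(k-1) * (α^(k-1) * α^i) = c * α^i := by field_simp
    rw [e3, e4]
    have hd' : c * (α - k*(2-α)) = nm α := hdc
    linear_combination h1 - α^i * hd'
  have key : ∀ m, |v m| ≤ 4 := by
    intro m
    induction m using Nat.strong_induction_on with
    | _ m ih =>
      by_cases hm : k ≤ m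
      · obtain ⟨i, rfl⟩ : ∃ i, m = k + i := ⟨m-k, by omega⟩
        rw [hV, abs_mul, abs_of_pos (by linarith [h.hi] : 0 < 2-α)]
        calc (2-α) * |∑ j ∈ Finset.range k, α^j * v (k+i-1-j)|
            ≤ (2-α) * ∑ j ∈ Finset.range k, α^j * 4 := by
              apply mul_le_mul_of_nonneg_left _ (by linarith [h.hi])
              refine (Finset.abs_sum_le_sum_abs _ _).trans (Finset.sum_le_sum ?_)
              intro j hj
              rw [abs_mul, abs_of_pos (by positivity : 0 < α^j)]
              exact mul_le_mul_of_nonneg_left (ih _ (by omega)) (by positivity)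
          _ = 4 := by rw [← Finset.sum_mul, ← mul_assoc, h.geo, one_mul]
      · have hc' : 0 ≤ c / α^(k-1) * α^m ∧ c / α^(k-1) * α^m ≤ 3.75 := by
          constructor
          · have : 0 ≤ c := by linarith
            positivity
          · have : α^m ≤ α^(k-1) := pow_le_pow_right₀ (by linarith [h.lo]) (by omega)
            calc c / α^(k-1) * α^m ≤ c / α^(k-1) * α^(k-1) := by
                  apply mul_le_mul_of_nonneg_left this
                  have : 0 ≤ c := by linarith
                  positivity
              _ = c := by field_simp
              _ ≤ 3.75 := hch
        have hu' : 0 ≤ u m ∧ u m ≤ 2 := by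
          rcases lt_or_ge m (k-2) with h3 | h3
          · simp only [hu]; rw [gL_lt h3]; norm_num
          · obtain h4 | h4 : m = k-2 ∨ m = k-1 := by omega
            · simp only [hu]; rw [h4, gL_0 hk]; norm_num
            · simp only [hu]; rw [h4, gL_1 hk]; norm_num
        simp only [hv]
        rw [abs_le]; constructor <;> linarith [hc'.1, hc'.2, hu'.1, hu'.2]
  exact key m

lemma binet (h : IsA k α) (hk : 2 ≤ k) {n : ℕ} (hn : 1 ≤ n) :
    |(lucasL k n : ℝ) - nm α / dn k α * α^(n-1)| ≤ 4 := by
  have := h.binet0 hk (n+k-2)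
  have hα := h.pos
  rw [show n + k - 2 = (k-1) + (n-1) by omega, pow_add] at this
  have e : nm α / dn k α / α^(k-1) * (α^(k-1) * α^(n-1)) = nm α / dn k α * α^(n-1) := by field_simp
  rw [e] at this
  unfold lucasL
  rw [show n + k - 2 = (k-1) + (n-1) by omega]
  exact this
end IsA

namespace IsA
variable {k : ℕ} {α : ℝ}
open Polynomial IntermediateField in
lemma root_le (h : IsA k α) (hk : 2 ≤ k) (β : ℂ) (hβ : β^k*(2-β) = 1) (hne : β ≠ α) : ‖β‖ ≤ 1 := by
  by_contra hgt
  push Not at hgt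
  set x := ‖β‖ with hx
  have hα := h.pos
  have hx0 : 0 < x := by linarith
  have hn : x^k * ‖2-β‖ = 1 := by rw [hx, ← norm_pow, ← norm_mul, hβ, norm_one]
  -- sum of inverse powers is one
  have hβ1 : β ≠ 1 := by rintro rfl; simp at hx; linarith
  have hsum : β^k = ∑ j ∈ Finset.range k, β^j := by
    have h1 := mul_geom_sum β k
    have h3 : β - 1 ≠ 0 := sub_ne_zero.2 hβ1
    apply mul_left_cancel₀ h3
    rw [h1]; linear_combination -hβ
  have hsumα : α^k = ∑ j ∈ Finset.range k, α^j := by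
    have h1 := mul_geom_sum α k
    have h3 : α - 1 ≠ 0 := by linarith [h.lo]
    apply mul_left_cancel₀ h3
    rw [h1]; linear_combination -h.eq
  have hle : x^k ≤ ∑ j ∈ Finset.range k, x^j := by
    rw [hx, ← norm_pow, hsum]
    refine (norm_sum_le _ _).trans (le_of_eq ?_)
    simp [norm_pow]
  -- monotonicity : for 0<y<z, y^k * Σ z^j < z^k * Σ y^j
  have mono : ∀ y z : ℝ, 0 < y → y < z → y^k * ∑ j ∈ Finset.range k, z^j < z^k * ∑ j ∈ Finset.range k, y^j := by
    intro y z hy hyz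
    rw [Finset.mul_sum, Finset.mul_sum]
    apply Finset.sum_lt_sum_of_nonempty
    · exact ⟨0, Finset.mem_range.2 (by omega)⟩
    · intro j hj
      have hj' := Finset.mem_range.1 hj
      have : ∀ t : ℝ, t^k = t^j * t^(k-j) := fun t => by rw [← pow_add]; congr 1; omega
      rw [this y, this z]
      have hlt : y^(k-j) < z^(k-j) := pow_lt_pow_left₀ hyz hy.le (by omega)
      have hz : 0 < z := by linarith
      have : 0 < y^j * z^j := by positivity
      nlinarith
  have hxα : x ≤ α := by
    by_contra hc
    push Not at hc
    have := mono α x hα hc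
    rw [← hsumα] at this
    have h5 : 0 < α^k := by positivity
    nlinarith
  have hαx : α ≤ x := by
    by_contra hc
    push Not at hc
    have h1 := mono x α hx0 hc
    rw [← hsumα] at h1
    have h5 : 0 < α^k := by positivity
    have h6 : x^k < ∑ j ∈ Finset.range k, x^j := by
      by_contra h7; push Not at h7; nlinarith
    have h8 := mul_geom_sum x k
    have h9 : 2 - x ≤ ‖2-β‖ := by
      have := norm_sub_norm_le (2:ℂ) β
      simpa using this
    have h10 : x^k*(2-x) ≤ 1 := by
      rw [← hn]; exact mul_le_mul_of_nonneg_left h9 (by positivity)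
    nlinarith
  have hxe : x = α := le_antisymm hxα hαx
  have h2 : ‖2-β‖ = 2-α := by
    have e := h.eq
    rw [hxe] at hn
    have h5 : α^k ≠ 0 := by positivity
    apply mul_left_cancel₀ h5; rw [hn, e]
  have n1 : β.re*β.re + β.im*β.im = α^2 := by
    rw [← hxe, hx, ← Complex.normSq_eq_norm_sq, Complex.normSq_apply]
  have n2 : (2-β.re)*(2-β.re) + β.im*β.im = (2-α)^2 := by
    rw [← h2, ← Complex.normSq_eq_norm_sq, Complex.normSq_apply]; simp
  have hre : β.re = α := by nlinarith
  have him : β.im = 0 := by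
    have : β.im*β.im = 0 := by rw [hre] at n1; nlinarith
    simpa using this
  exact hne (Complex.ext (by simp [hre]) (by simp [him]))

open Polynomial in
lemma integral (h : IsA k α) : IsIntegral ℤ (α:ℂ) := by
  refine ⟨X^(k+1) - 2 * X^k + 1, ?_, ?_⟩
  · have : (X^(k+1) - 2 * X^k + 1 : ℤ[X]) = X^(k+1) + (-(2 * X^k) + 1) := by ring
    rw [this]
    apply monic_X_pow_add
    refine (degree_add_le _ _).trans_lt (max_lt ?_ ?_)
    · rw [degree_neg]
      calc (2 * X^k : ℤ[X]).degree = (C 2 * X^k : ℤ[X]).degree := by rfl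
        _ ≤ (k:ℕ) := degree_C_mul_X_pow_le k 2
        _ < ((k+1 : ℕ) : WithBot ℕ) := by exact_mod_cast Nat.lt_succ_self k
    · rw [degree_one]; exact_mod_cast Nat.succ_pos k
  · have e := h.eq
    have : (α:ℂ)^k*(2-α) = 1 := by exact_mod_cast e
    simp
    linear_combination -this

open Polynomial IntermediateField in
lemma liou (h : IsA k α) (hk : 2 ≤ k) (D : ℤ[X]) (hD : aeval α D ≠ 0) (C : ℝ) (hC : 1 ≤ C)
    (hb : ∀ β : ℂ, ‖β‖ ≤ 1 → ‖aeval β D‖ ≤ C) : 1 ≤ |aeval α D| * C^k := by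
  classical
  set z : ℂ := (α:ℂ) with hz
  have e1 : z^k*(1+1-z) = 1 := by
    have e : α^k*(1+1-α) = 1 := by linear_combination h.eq
    rw [hz]; exact_mod_cast e
  have hzi : IsIntegral ℤ z := h.integral
  have hzq : IsIntegral ℚ z := hzi.tower_top
  set K := ℚ⟮z⟯
  have : FiniteDimensional ℚ K := adjoin.finiteDimensional hzq
  set x : K := AdjoinSimple.gen ℚ z with hx
  set y : K := aeval x D with hy
  have hval : ∀ σ : K →ₐ[ℚ] ℂ, σ y = aeval (σ x) D := by
    intro σ
    rw [hy]
    have := (aeval_algHom_apply (σ.restrictScalars ℤ) x D)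
    exact this.symm
  obtain ⟨ι, hx0⟩ : ∃ ι : K →ₐ[ℚ] ℂ, ι x = z := ⟨K.val, AdjoinSimple.coe_gen ℚ z⟩
  have hy0 : ι y = ((aeval α D : ℝ) : ℂ) := by
    have h1 := hval ι
    rw [hx0] at h1
    exact h1.trans (aeval_algebraMap_apply ℂ α D)
  have hyint : IsIntegral ℤ y := by
    have hxi : IsIntegral ℤ x := by
      rw [← isIntegral_algHom_iff (ι.restrictScalars ℤ) ι.injective]
      exact hx0 ▸ hzi
    rw [hy]
    have h3 : Algebra.adjoin ℤ {x} ≤ integralClosure ℤ K :=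
      Algebra.adjoin_le (by rintro _ rfl; exact hxi)
    exact h3 (Polynomial.aeval_mem_adjoin_singleton ℤ x)
  have hyne : y ≠ 0 := by
    intro h0; rw [h0, map_zero] at hy0
    exact hD (by exact_mod_cast hy0.symm)
  obtain ⟨w, hw⟩ := IsIntegrallyClosed.isIntegral_iff.1 (Algebra.isIntegral_norm ℚ hyint)
  have hw0 : w ≠ 0 := by
    rintro rfl
    rw [map_zero] at hw
    exact hyne (Algebra.norm_eq_zero_iff.1 hw.symm)
  have hprod := Algebra.norm_eq_prod_embeddings ℚ ℂ y
  rw [← hw] at hprod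
  have hn : (1:ℝ) ≤ ∏ σ : K →ₐ[ℚ] ℂ, ‖σ y‖ := by
    rw [← norm_prod, ← hprod]
    simp
    have : (1:ℤ) ≤ |w| := Int.one_le_abs hw0
    exact_mod_cast this
  have hsp := Finset.mul_prod_erase Finset.univ (fun σ : K →ₐ[ℚ] ℂ => ‖σ y‖) (Finset.mem_univ ι)
  rw [← hsp] at hn
  simp only [hy0] at hn
  have hcard : (Finset.univ.erase ι : Finset (K →ₐ[ℚ] ℂ)).card ≤ k := by
    rw [Finset.card_erase_of_mem (Finset.mem_univ _), Finset.card_univ, AlgHom.card, adjoin.finrank hzq]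
    have : (minpoly ℚ z).natDegree ≤ k+1 := by
      have hroot : aeval z (X^(k+1) - (X^k + X^k) + 1 : ℚ[X]) = 0 := by
        simp only [map_add, map_sub, map_pow, aeval_X, map_one]
        linear_combination -e1
      have hm : (X^(k+1) - (X^k+X^k) + 1 : ℚ[X]).coeff (k+1) = 1 := by
        rw [coeff_add, coeff_sub, coeff_add, coeff_X_pow, coeff_X_pow, coeff_one]
        simp
      have hne : (X^(k+1) - (X^k+X^k) + 1 : ℚ[X]) ≠ 0 := by intro h0; rw [h0] at hm; simp at hm
      refine (natDegree_le_of_dvd (minpoly.dvd ℚ z hroot) hne).trans ?_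
      compute_degree
    omega
  have hrest : ∏ σ ∈ Finset.univ.erase ι, ‖σ y‖ ≤ C^k := by
    calc ∏ σ ∈ Finset.univ.erase ι, ‖σ y‖ ≤ ∏ σ ∈ (Finset.univ.erase ι : Finset (K →ₐ[ℚ] ℂ)), C := by
          apply Finset.prod_le_prod
          · intro _ _; positivity
          · intro σ hσ
            rw [hval]
            apply hb
            apply h.root_le hk
            · have e2 : x^k*(1+1-x) = 1 := by
                apply ι.injective
                have : ι (x^k*(1+1-x)) = 1 := by
                  rw [map_mul, map_pow, map_sub, map_add, map_one, hx0]; exact e1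
                exact this.trans (map_one ι).symm
              have := congrArg σ e2
              rw [map_mul, map_pow, map_sub, map_add, map_one] at this
              rw [← this]; ring
            · intro h9
              apply (Finset.mem_erase.1 hσ).1
              apply (adjoin.powerBasis hzq).algHom_ext
              rw [adjoin.powerBasis_gen]
              exact h9.trans hx0.symm
      _ = C^((Finset.univ.erase ι : Finset (K →ₐ[ℚ] ℂ)).card) := by rw [Finset.prod_const]
      _ ≤ C^k := pow_le_pow_right₀ hC hcard
  calc 1 ≤ _ := hn
    _ ≤ _ := by
      rw [Complex.norm_real, Real.norm_eq_abs]
      exact mul_le_mul_of_nonneg_left hrest (abs_nonneg _)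
end IsA

lemma sum_ge_tri (N : ℕ) (r : Fin N → ℕ) (hr : ∀ j, r j ≤ N)
    (hinj : ∀ j j', r j = r j' → r j < N → j = j') : N*(N-1)/2 ≤ ∑ j, r j := by
  classical
  have h1 : ∀ j, r j = ∑ m ∈ Finset.range N, if m < r j then 1 else 0 := by
    intro j
    rw [Finset.sum_ite, Finset.sum_const_zero, add_zero, Finset.sum_const, smul_eq_mul, mul_one]
    have : (Finset.range N).filter (· < r j) = Finset.range (r j) := by
      ext m; simp; have := hr j; omega
    rw [this, Finset.card_range]
  rw [Finset.sum_congr rfl (fun j _ => h1 j), Finset.sum_comm]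
  have h2 : ∀ m ∈ Finset.range N, N - 1 - m ≤ ∑ j : Fin N, if m < r j then 1 else 0 := by
    intro m hm
    have hm := Finset.mem_range.1 hm
    rw [Finset.sum_ite, Finset.sum_const_zero, add_zero, Finset.sum_const, smul_eq_mul, mul_one]
    have h3 := Finset.card_filter_add_card_filter_not (s := (Finset.univ : Finset (Fin N))) (fun j => m < r j)
    have h4 : (Finset.univ.filter (fun j : Fin N => ¬ m < r j)).card ≤ (Finset.range (m+1)).card := by
      apply Finset.card_le_card_of_injOn r
      · intro j hj; simp at hj ⊢; omega
      · intro j hj j' hj' e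
        simp at hj hj'
        exact hinj j j' e (by omega)
    rw [Finset.card_range] at h4
    rw [Finset.card_univ, Fintype.card_fin] at h3
    omega
  refine le_trans (le_of_eq ?_) (Finset.sum_le_sum h2)
  rw [Finset.sum_range_reflect (fun i => i) N, Finset.sum_range_id]

lemma det_le_prod (N : ℕ) (M : Matrix (Fin N) (Fin N) ℝ) (g : Fin N → ℝ)
    (hM : ∀ j i, |M j i| ≤ g j) : |M.det| ≤ (N.factorial:ℝ) * ∏ j, g j := by
  rw [← Matrix.det_transpose, Matrix.det_apply]
  refine (Finset.abs_sum_le_sum_abs _ _).trans ?_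
  have : ∀ σ ∈ (Finset.univ : Finset (Equiv.Perm (Fin N))),
      |Equiv.Perm.sign σ • ∏ i, M.transpose (σ i) i| ≤ ∏ j, g j := by
    intro σ _
    have e : |Equiv.Perm.sign σ • ∏ i, M.transpose (σ i) i| = |∏ i, M.transpose (σ i) i| := by
      rcases Int.units_eq_one_or (Equiv.Perm.sign σ) with h | h <;> rw [h] <;> simp
    rw [e, Finset.abs_prod]
    apply Finset.prod_le_prod
    · intro _ _; positivity
    · intro i _; exact hM i (σ i)
  refine (Finset.sum_le_sum this).trans ?_
  rw [Finset.sum_const, Finset.card_univ, Fintype.card_perm, Fintype.card_fin, nsmul_eq_mul]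

lemma det_small (N : ℕ) (M E V c : Fin N → Fin N → ℝ) (G : Fin N → ℝ) (t : ℝ) (ht0 : 0 < t) (ht1 : t ≤ 1)
    (hG : ∀ j, 0 ≤ G j)
    (hM : ∀ j i, M j i = ∑ m, c j m * V m i + E j i)
    (hV : ∀ m i, |V m i| ≤ 1) (hc : ∀ j m, |c j m| ≤ G j * t^(m:ℕ)) (hE : ∀ j i, |E j i| ≤ G j * t^N) :
    |(Matrix.of M).det| ≤ (N.factorial:ℝ) * (N+1)^N * t^(N*(N-1)/2) * ∏ j, G j := by
  classical
  set U : Fin N → Option (Fin N) → Fin N → ℝ := fun j p => match p with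
    | none => E j
    | some m => fun i => c j m * V m i with hU
  set d : Option (Fin N) → ℕ := fun p => match p with
    | none => N
    | some m => (m:ℕ) with hd
  have hMU : Matrix.of M = fun j => ∑ p, U j p := by
    funext j i
    rw [Fintype.sum_option]
    simp only [Matrix.of_apply, hM, Pi.add_apply, Finset.sum_apply, hU]
    ring
  have e1 : (Matrix.of M).det = ∑ r : Fin N → Option (Fin N), Matrix.det (fun j => U j (r j)) := by
    rw [hMU]
    exact (Matrix.detRowAlternating (n := Fin N) (R := ℝ)).toMultilinearMap.map_sum (fun j p => U j p)
  have hPG : 0 ≤ ∏ j, G j := Finset.prod_nonneg (fun j _ => hG j)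
  have key : ∀ r ∈ (Finset.univ : Finset (Fin N → Option (Fin N))),
      |Matrix.det (fun j => U j (r j))| ≤ (N.factorial:ℝ) * (t^(N*(N-1)/2) * ∏ j, G j) := by
    intro r _
    by_cases hr : ∃ j j', j ≠ j' ∧ r j = r j' ∧ r j ≠ none
    · obtain ⟨j, j', hne, he, hn⟩ := hr
      obtain ⟨m, hm⟩ := Option.ne_none_iff_exists'.1 hn
      have hz : Matrix.det (fun j => U j (r j)) = 0 := by
        by_contra h0
        have hli := (Matrix.linearIndependent_rows_iff_isUnit (K := ℝ) (A := (fun j => U j (r j)))).2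
          ((Matrix.isUnit_iff_isUnit_det _).2 (isUnit_iff_ne_zero.2 h0))
        have h1 : U j (r j) = c j m • V m := by rw [hm]; rfl
        have h2 : U j' (r j') = c j' m • V m := by rw [← he, hm]; rfl
        have hpr : LinearIndependent ℝ ![U j (r j), U j' (r j')] := by
          have hi : Function.Injective ![j, j'] := by
            intro a b; fin_cases a <;> fin_cases b <;> simp [hne, hne.symm]
          have := hli.comp ![j, j'] hi
          have e : ((Matrix.row fun j => U j (r j)) ∘ ![j, j']) = ![U j (r j), U j' (r j')] := by
            funext i; fin_cases i <;> rfl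
          rw [e] at this
          exact this
        have hp := (LinearIndependent.pair_iff.1 hpr) (c j' m) (- c j m) (by
          change c j' m • U j (r j) + (- c j m) • U j' (r j') = 0
          rw [h1, h2, smul_smul, smul_smul, ← add_smul]
          ring_nf; simp)
        have h3 := hli.ne_zero j
        apply h3
        change U j (r j) = 0
        rw [h1, neg_eq_zero.1 hp.2, zero_smul]
      rw [hz, abs_zero]
      positivity
    · push Not at hr
      have hd1 : ∀ p, d p ≤ N := by
        intro p; rcases p with _ | m
        · exact le_refl _
        · exact m.2.le
      have hd2 : ∀ p p', d p = d p' → d p < N → p = p' := by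
        intro p p' h h'
        rcases p with _ | m
        · exact absurd h' (lt_irrefl _)
        · rcases p' with _ | m'
          · rw [h] at h'; exact absurd h' (lt_irrefl _)
          · exact congrArg some (Fin.ext h)
      have hs := sum_ge_tri N (fun j => d (r j)) (fun j => hd1 _) (by
        intro j j' h h'
        by_contra hne
        have := hr j j' hne (hd2 _ _ h h')
        simp only [this] at h'
        exact absurd h' (lt_irrefl _))
      have hb := det_le_prod N (fun j => U j (r j)) (fun j => G j * t^(d (r j))) (by
        intro j i
        rcases h : r j with _ | m
        · exact hE j i
        · change |c j m * V m i| ≤ _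
          rw [abs_mul]
          calc |c j m| * |V m i| ≤ (G j * t^(m:ℕ)) * 1 :=
                mul_le_mul (hc j m) (hV m i) (abs_nonneg _) (mul_nonneg (hG j) (by positivity))
            _ = _ := by rw [mul_one])
      refine hb.trans ?_
      apply mul_le_mul_of_nonneg_left _ (by positivity)
      rw [Finset.prod_mul_distrib, Finset.prod_pow_eq_pow_sum, mul_comm]
      exact mul_le_mul_of_nonneg_right (pow_le_pow_of_le_one ht0.le ht1 hs) hPG
  rw [e1]
  refine (Finset.abs_sum_le_sum_abs _ _).trans ((Finset.sum_le_sum key).trans (le_of_eq ?_))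
  rw [Finset.sum_const, Finset.card_univ, Fintype.card_fun, Fintype.card_option, Fintype.card_fin, nsmul_eq_mul]
  push_cast; ring

open Polynomial in
lemma det_coeff_le (n d : ℕ) (M : Matrix (Fin n) (Fin n) ℝ[X]) (hM : ∀ i j, (M i j).natDegree ≤ d) :
    M.det.natDegree ≤ n*d ∧ M.det.coeff (n*d) = (Matrix.of fun i j => (M i j).coeff d).det := by
  constructor
  · rw [Matrix.det_apply]
    apply natDegree_sum_le_of_forall_le
    intro σ _
    have h1 : (∏ i, M (σ i) i).natDegree ≤ n*d := by
      refine (natDegree_prod_le _ _).trans ((Finset.sum_le_sum (fun i _ => hM (σ i) i)).trans ?_)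
      simp
    rcases Int.units_eq_one_or (Equiv.Perm.sign σ) with h | h <;> rw [h] <;> simpa using h1
  · rw [Matrix.det_apply, Matrix.det_apply, finsetSum_coeff]
    apply Finset.sum_congr rfl
    intro σ _
    have h1 := coeff_prod_of_natDegree_le Finset.univ (fun i => M (σ i) i) d (fun i _ => hM _ _)
    rw [Finset.card_univ, Fintype.card_fin] at h1
    rcases Int.units_eq_one_or (Equiv.Perm.sign σ) with h | h <;> rw [h] <;> simpa using h1

open Polynomial in
lemma zero_est (A α2 : ℝ) (hA : 0 < A) (hA1 : A ≠ 1) (h2 : α2 ≠ 0) (K L R2 S Q : ℕ) (hRQ : R2 ≤ Q)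
    (hK : 1 ≤ K) (hKL : K*L ≤ R2*S) (P : ℕ → ℝ[X]) (hP : ∀ l < L, (P l).natDegree ≤ K-1)
    (hvan : ∀ r s : ℕ, r < R2 + L - 1 → s < S →
      ∑ l ∈ Finset.range L, (P l).eval ((r:ℝ) - s*Q) * (A^r*α2^s)^l = 0) : ∀ l < L, P l = 0 := by
  classical
  by_contra hne
  push Not at hne
  obtain ⟨l0, hl0, hl0'⟩ := hne
  set Λ := (Finset.range L).filter (fun l => P l ≠ 0) with hΛ
  set n := Λ.card with hn
  have hn1 : 1 ≤ n := Finset.card_pos.2 ⟨l0, by simp [hΛ, hl0, hl0']⟩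
  have hnL : n ≤ L := by
    have := Finset.card_filter_le (Finset.range L) (fun l => P l ≠ 0)
    rwa [Finset.card_range] at this
  set u : Fin n → ℕ := fun j => Λ.orderEmbOfFin rfl j with hu
  have hui : Function.Injective u := (Λ.orderEmbOfFin rfl).injective
  have huL : ∀ j, u j < L ∧ P (u j) ≠ 0 := by
    intro j
    have := Λ.orderEmbOfFin_mem rfl j
    have h3 := Finset.mem_filter.1 this
    exact ⟨Finset.mem_range.1 h3.1, h3.2⟩
  have hsum : ∀ f : ℕ → ℝ, (∀ l, P l = 0 → f l = 0) → ∑ l ∈ Finset.range L, f l = ∑ j, f (u j) := by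
    intro f hf
    have e1 : ∑ l ∈ Λ, f l = ∑ l ∈ Finset.range L, f l := by
      apply Finset.sum_filter_of_ne
      intro l _ h h'
      exact h (hf l h')
    rw [← e1]
    have e2 : Finset.univ.map (Λ.orderEmbOfFin rfl).toEmbedding = Λ := Finset.map_orderEmbOfFin_univ Λ rfl
    conv_lhs => rw [← e2]
    rw [Finset.sum_map]
    rfl
  set T : Matrix (Fin n) (Fin n) ℝ[X] := Matrix.of fun σ j =>
    X^(K-1-(P (u j)).natDegree) * (C (A^((σ:ℕ)*u j)) * taylor ((σ:ℕ):ℝ) (P (u j))) with hT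
  have hdeg : ∀ i j, (T i j).natDegree ≤ K-1 := by
    intro i j
    rw [hT, Matrix.of_apply]
    refine natDegree_mul_le.trans ?_
    rw [natDegree_X_pow]
    have h3 : (C (A^((i:ℕ)*u j)) * taylor ((i:ℕ):ℝ) (P (u j))).natDegree ≤ (P (u j)).natDegree := by
      refine (natDegree_C_mul_le _ _).trans ?_
      rw [natDegree_taylor]
    have := hP (u j) (huL j).1
    omega
  obtain ⟨hd1, hd2⟩ := det_coeff_le n (K-1) T hdeg
  have hcoef : ∀ i j, (T i j).coeff (K-1) = (P (u j)).leadingCoeff * (A^(u j))^(i:ℕ) := by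
    intro i j
    rw [hT, Matrix.of_apply]
    have := hP (u j) (huL j).1
    conv_lhs => rw [show K-1 = (P (u j)).natDegree + (K-1-(P (u j)).natDegree) by omega]
    rw [add_tsub_cancel_left, coeff_X_pow_mul, coeff_C_mul, coeff_taylor_natDegree, ← pow_mul, mul_comm (u j)]
    ring
  have hdet0 : T.det ≠ 0 := by
    intro h0
    rw [h0, coeff_zero] at hd2
    have e : (Matrix.of fun i j => (T i j).coeff (K-1)) =
        Matrix.of fun i j => (P (u j)).leadingCoeff * ((Matrix.vandermonde (fun j => A^(u j))).transpose i j) := by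
      ext i j
      simp only [Matrix.of_apply, hcoef, Matrix.transpose_apply, Matrix.vandermonde_apply]
    rw [e, Matrix.det_mul_row, Matrix.det_transpose] at hd2
    have hv : (Matrix.vandermonde (fun j => A^(u j))).det ≠ 0 := by
      rw [Matrix.det_vandermonde_ne_zero_iff]
      intro j j' h
      exact hui (pow_right_injective₀ hA hA1 h)
    have hl : ∏ j, (P (u j)).leadingCoeff ≠ 0 :=
      Finset.prod_ne_zero_iff.2 (fun j _ => leadingCoeff_ne_zero.2 (huL j).2)
    exact mul_ne_zero hl hv hd2.symm
  have hroot : ∀ r s : ℕ, r < R2 → s < S → T.det.eval ((r:ℝ) - s*Q) = 0 := by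
    intro r s hr hs
    set x : ℝ := (r:ℝ) - s*Q with hx
    have e0 : T.det.eval x = ((evalRingHom x).mapMatrix T).det := RingHom.map_det (evalRingHom x) T
    have e1 : (evalRingHom x).mapMatrix T = Matrix.of fun i j => (x^(K-1-(P (u j)).natDegree)) *
        ((Matrix.of fun (i j : Fin n) => A^((i:ℕ)*u j) * (P (u j)).eval (x + (i:ℕ))) i j) := by
      ext i j
      simp [hT, taylor_eval]
    rw [e0, e1, Matrix.det_mul_row]
    have e2 : (Matrix.of fun (i j : Fin n) => A^((i:ℕ)*u j) * (P (u j)).eval (x + (i:ℕ))).det = 0 := by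
      rw [← Matrix.exists_mulVec_eq_zero_iff]
      refine ⟨fun j => (A^r*α2^s)^(u j), ?_, ?_⟩
      · intro h
        have := congrFun h ⟨0, hn1⟩
        have h3 : (A^r*α2^s)^(u ⟨0, hn1⟩) ≠ 0 := by positivity
        exact h3 this
      · funext i
        have := hvan (r+i) s (by have := i.2; omega) hs
        rw [hsum _ (by intro l hl; rw [hl]; simp)] at this
        simp only [Matrix.mulVec, dotProduct, Matrix.of_apply, Pi.zero_apply]
        rw [← this]
        apply Finset.sum_congr rfl
        intro j _
        have e3 : ((r + (i:ℕ) : ℕ):ℝ) - s*Q = x + (i:ℕ) := by rw [hx]; push_cast; ring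
        rw [e3]
        ring
    rw [e2, mul_zero]
  set pts : Finset ℝ := (Finset.range R2 ×ˢ Finset.range S).image (fun p : ℕ × ℕ => (p.1:ℝ) - p.2*Q) with hpts
  have hcard : pts.card = R2*S := by
    rw [hpts, Finset.card_image_of_injOn]
    · simp
    · rintro ⟨r, s⟩ h ⟨r', s'⟩ h' e
      simp at h h' e
      have hr : r < Q := by omega
      have hr' : r' < Q := by omega
      have e' : r + s'*Q = r' + s*Q := by
        have : (r:ℝ) + s'*Q = r' + s*Q := by linarith
        exact_mod_cast this
      have h1 : r = r' := by
        have := congrArg (· % Q) e'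
        simpa [Nat.add_mul_mod_self_right, Nat.mod_eq_of_lt hr, Nat.mod_eq_of_lt hr'] using this
      have h3 : s' = s := by
        subst h1
        exact Nat.eq_of_mul_eq_mul_right (by omega : 0 < Q) (by omega)
      rw [h1, h3]
  apply hdet0
  apply eq_zero_of_natDegree_lt_card_of_eval_eq_zero' _ pts
  · intro x hx
    rw [hpts, Finset.mem_image] at hx
    obtain ⟨⟨r, s⟩, hp, rfl⟩ := hx
    simp at hp
    exact hroot r s hp.1 hp.2
  · rw [hcard]
    calc T.det.natDegree ≤ n*(K-1) := hd1
      _ < n*K := by apply Nat.mul_lt_mul_of_pos_left <;> omega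
      _ ≤ L*K := Nat.mul_le_mul_right _ hnL
      _ ≤ R2*S := by rw [mul_comm]; exact hKL

lemma row_sel {ι : Type*} [Fintype ι] (N : ℕ) (Z : ι → Fin N → ℝ)
    (hker : ∀ v : Fin N → ℝ, (∀ i, ∑ j, Z i j * v j = 0) → v = 0) :
    ∃ f : Fin N → ι, (Matrix.of fun j i => Z (f i) j).det ≠ 0 := by
  classical
  have hrank : (Matrix.of Z).rank = N := by
    have hk : (Matrix.of Z).mulVecLin.ker = ⊥ := by
      rw [Matrix.ker_mulVecLin_eq_bot_iff]
      intro v hv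
      exact hker v (fun i => congrFun hv i)
    unfold Matrix.rank
    rw [LinearMap.finrank_range_of_inj (LinearMap.ker_eq_bot.1 hk)]
    simp
  rw [Matrix.rank_eq_finrank_span_row] at hrank
  obtain ⟨g, hg1, -, hg3⟩ := Submodule.exists_fun_fin_finrank_span_eq ℝ (Set.range (Matrix.of Z).row)
  set ee := finCongr hrank.symm with hee
  choose f hf using fun i => hg1 (ee i)
  refine ⟨f, ?_⟩
  have hli := hg3.comp ee ee.injective
  have e : (g ∘ ee) = (Matrix.of fun i j => Z (f i) j).row := by
    funext i; exact (hf i).symm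
  rw [e] at hli
  have h5 := Matrix.linearIndependent_rows_iff_isUnit.1 hli
  have h6 := ((Matrix.isUnit_iff_isUnit_det _).1 h5).ne_zero
  rw [← Matrix.det_transpose] at h6
  exact h6

lemma det_le_prodC (N : ℕ) (M : Matrix (Fin N) (Fin N) ℂ) (g : Fin N → ℝ)
    (hM : ∀ j i, ‖M j i‖ ≤ g j) : ‖M.det‖ ≤ (N.factorial:ℝ) * ∏ j, g j := by
  rw [← Matrix.det_transpose, Matrix.det_apply]
  refine (norm_sum_le _ _).trans ?_
  have : ∀ σ ∈ (Finset.univ : Finset (Equiv.Perm (Fin N))),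
      ‖Equiv.Perm.sign σ • ∏ i, M.transpose (σ i) i‖ ≤ ∏ j, g j := by
    intro σ _
    have e : ‖Equiv.Perm.sign σ • ∏ i, M.transpose (σ i) i‖ = ‖∏ i, M.transpose (σ i) i‖ := by
      rcases Int.units_eq_one_or (Equiv.Perm.sign σ) with h | h <;> rw [h] <;> simp
    rw [e, norm_prod]
    apply Finset.prod_le_prod
    · intro _ _; positivity
    · intro i _; exact hM i (σ i)
  refine (Finset.sum_le_sum this).trans ?_
  rw [Finset.sum_const, Finset.card_univ, Fintype.card_perm, Fintype.card_fin, nsmul_eq_mul]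

lemma exp_tail (u ρ : ℝ) (hρ : 1 ≤ ρ) (P : ℕ) :
    |Real.exp u - ∑ p ∈ Finset.range P, u^p/p.factorial| ≤ (ρ⁻¹)^P * Real.exp (ρ*|u|) := by
  have hs : ∀ v : ℝ, HasSum (fun p : ℕ => v^p/p.factorial) (Real.exp v) := by
    intro v
    have := NormedSpace.expSeries_div_hasSum_exp (𝔸 := ℝ) v
    rwa [← Real.exp_eq_exp_ℝ] at this
  have h1 := (hasSum_nat_add_iff' P).2 (hs u)
  have h2 := (hasSum_nat_add_iff' P).2 (hs (ρ*|u|))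
  have h3 : HasSum (fun p : ℕ => (ρ⁻¹)^P * ((ρ*|u|)^(p+P)/(p+P).factorial)) _ := h2.mul_left ((ρ⁻¹)^P)
  have hρ0 : 0 < ρ := by linarith
  have h4 := tsum_of_norm_bounded h3 (f := fun p : ℕ => u^(p+P)/(p+P).factorial) (by
    intro p
    rw [norm_div, norm_pow, Real.norm_eq_abs, Real.norm_eq_abs, Nat.abs_cast, ← mul_div_assoc]
    gcongr
    rw [mul_pow, pow_add ρ, inv_pow]
    have : 1 ≤ ρ^p := one_le_pow₀ hρ
    have h5 : (ρ^P)⁻¹ * (ρ^p*ρ^P*|u|^(p+P)) = ρ^p * |u|^(p+P) := by field_simp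
    rw [h5]
    have : 0 ≤ |u|^(p+P) := by positivity
    nlinarith)
  rw [h1.tsum_eq, Real.norm_eq_abs] at h4
  refine h4.trans ?_
  apply mul_le_mul_of_nonneg_left _ (by positivity)
  have : 0 ≤ ∑ p ∈ Finset.range P, (ρ*|u|)^p/p.factorial := Finset.sum_nonneg (fun p _ => by positivity)
  linarith

lemma term_le_exp (u : ℝ) (hu : 0 ≤ u) (p : ℕ) : u^p/p.factorial ≤ Real.exp u := by
  have h := Real.sum_le_exp_of_nonneg hu (p+1)
  refine le_trans ?_ h
  rw [Finset.sum_range_succ]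
  have : 0 ≤ ∑ p ∈ Finset.range p, u^p/p.factorial := Finset.sum_nonneg (fun p _ => by positivity)
  linarith

lemma sum_divNat (K L : ℕ) : ∑ j : Fin (K*L), ((j.divNat : Fin K) : ℕ) = L * (K*(K-1)/2) := by
  have := Fintype.sum_equiv finProdFinEquiv (fun p : Fin K × Fin L => (p.1:ℕ)) (fun j => ((j.divNat : Fin K) : ℕ))
    (by intro p; congr 1; exact (congrArg Prod.fst (finProdFinEquiv.symm_apply_apply p)).symm)
  rw [← this, Fintype.sum_prod_type]
  simp only [Finset.sum_const, Finset.card_univ, Fintype.card_fin, smul_eq_mul]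
  rw [← Finset.mul_sum, Fin.sum_univ_eq_sum_range (fun i => i), Finset.sum_range_id]

lemma sum_modNat (K L : ℕ) : ∑ j : Fin (K*L), ((j.modNat : Fin L) : ℕ) = K * (L*(L-1)/2) := by
  have := Fintype.sum_equiv finProdFinEquiv (fun p : Fin K × Fin L => (p.2:ℕ)) (fun j => ((j.modNat : Fin L) : ℕ))
    (by intro p; congr 1; exact (congrArg Prod.snd (finProdFinEquiv.symm_apply_apply p)).symm)
  rw [← this, Fintype.sum_prod_type]
  simp only [Finset.sum_const, Finset.card_univ, Fintype.card_fin, smul_eq_mul]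
  rw [Fin.sum_univ_eq_sum_range (fun i => i), Finset.sum_range_id]

lemma interp_log (k K L N T0 T1 : ℕ) (hN : N = K*L) (hT0 : T0 = L * (K*(K-1)/2)) (hT1 : T1 = K * (L*(L-1)/2))
    (hK : 1 ≤ K) (hL : 1 ≤ L)
    (sc h0 ρ B θ F Δ : ℝ) (hsc : 0 < sc) (hsc1 : sc ≤ Real.exp h0) (hρ0 : 0 < ρ) (hB0 : 0 < B) (hF : 0 ≤ F) (hΔ : 0 ≤ Δ)
    (hfac : F ≤ ((N:ℝ)+1)^N)
    (hup : Δ ≤ F * ((N:ℝ)+1)^N * (ρ⁻¹)^(N*(N-1)/2) * (2^N * ((ρ*B)^T0 * Real.exp (ρ*|θ| * B*T1))))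
    (hlow : 1 ≤ sc^T1 * Δ * (F * (B^T0 * (Real.exp h0)^T1))^k) :
    ((K*L:ℝ)-1)*Real.log ρ ≤ 2*(k+2)*Real.log (K*L+1) + 2*Real.log 2
      + (K-1)*(Real.log ρ + (k+1)*Real.log B) + (L-1)*((k+1)*h0+ρ*B*|θ|) := by
  have hfin : 1 ≤ ((Real.exp h0)^T1 * (((N:ℝ)+1)^N * ((N:ℝ)+1)^N * (ρ⁻¹)^(N*(N-1)/2) *
      (2^N * ((ρ*B)^T0 * Real.exp (ρ*|θ| * B*T1))))) * (((N:ℝ)+1)^N * (B^T0 * (Real.exp h0)^T1))^k := by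
    refine hlow.trans ?_
    have q1 : sc^T1 ≤ (Real.exp h0)^T1 := pow_le_pow_left₀ hsc.le hsc1 _
    have q2 : Δ ≤ ((N:ℝ)+1)^N * ((N:ℝ)+1)^N * (ρ⁻¹)^(N*(N-1)/2) * (2^N * ((ρ*B)^T0 * Real.exp (ρ*|θ| * B*T1))) := by
      refine hup.trans ?_
      apply mul_le_mul_of_nonneg_right _ (by positivity)
      apply mul_le_mul_of_nonneg_right _ (by positivity)
      apply mul_le_mul_of_nonneg_right hfac (by positivity)
    apply mul_le_mul
    · exact mul_le_mul q1 q2 hΔ (by positivity)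
    · apply pow_le_pow_left₀ (by positivity)
      exact mul_le_mul_of_nonneg_right hfac (by positivity)
    · positivity
    · positivity
  have hlog := Real.log_nonneg hfin
  have hN1 : (0:ℝ) < N+1 := by positivity
  have hNpos : 1 ≤ N := hN ▸ Nat.mul_pos hK hL
  rw [Real.log_mul (by positivity) (by positivity), Real.log_mul (by positivity) (by positivity),
    Real.log_mul (by positivity) (by positivity), Real.log_mul (by positivity) (by positivity),
    Real.log_mul (by positivity) (by positivity), Real.log_mul (by positivity) (by positivity),
    Real.log_mul (by positivity) (by positivity), Real.log_exp, Real.log_pow, Real.log_pow,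
    Real.log_pow, Real.log_pow, Real.log_pow, Real.log_pow, Real.log_mul (by positivity) (by positivity),
    Real.log_mul (by positivity) (by positivity), Real.log_mul (by positivity) (by positivity),
    Real.log_pow, Real.log_pow, Real.log_pow, Real.log_exp, Real.log_inv] at hlog
  have c0 : (T0:ℝ) = N*(K-1)/2 := by
    have : 2 * (K*(K-1)/2) = K*(K-1) := Nat.mul_div_cancel' (Nat.even_mul_pred_self K).two_dvd
    have h3 : ((2 * (K*(K-1)/2) : ℕ):ℝ) = K*(K-1) := by rw [this]; push_cast [Nat.cast_sub hK]; ring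
    rw [hT0, hN]; push_cast at h3 ⊢; linear_combination (L:ℝ)/2*h3
  have c1 : (T1:ℝ) = N*(L-1)/2 := by
    have : 2 * (L*(L-1)/2) = L*(L-1) := Nat.mul_div_cancel' (Nat.even_mul_pred_self L).two_dvd
    have h3 : ((2 * (L*(L-1)/2) : ℕ):ℝ) = L*(L-1) := by rw [this]; push_cast [Nat.cast_sub hL]; ring
    rw [hT1, hN]; push_cast at h3 ⊢; linear_combination (K:ℝ)/2*h3
  have c2 : ((N*(N-1)/2 : ℕ):ℝ) = N*(N-1)/2 := by
    have : 2 * (N*(N-1)/2) = N*(N-1) := Nat.mul_div_cancel' (Nat.even_mul_pred_self N).two_dvd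
    have h3 : ((2 * (N*(N-1)/2) : ℕ):ℝ) = N*(N-1) := by rw [this]; push_cast [Nat.cast_sub hNpos]; ring
    push_cast at h3 ⊢; linarith
  rw [c0, c1, c2] at hlog
  have hNR : (0:ℝ) < N := by exact_mod_cast hNpos
  have hNc : ((K:ℝ)*L) = N := by rw [hN]; push_cast; ring
  rw [hNc]
  have hfinal : (N:ℝ)/2 * (((N:ℝ)-1)*Real.log ρ) ≤ (N:ℝ)/2 * (2*(k+2)*Real.log (N+1) + 2*Real.log 2
      + (K-1)*(Real.log ρ + (k+1)*Real.log B) + (L-1)*((k+1)*h0+ρ*B*|θ|)) := by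
    linear_combination hlog
  exact le_of_mul_le_mul_left hfinal (by positivity)

set_option maxHeartbeats 1000000 in
open Polynomial in
/-- The interpolation determinant inequality. -/
theorem interp {k : ℕ} {α : ℝ} (h : IsA k α) (hk : 2 ≤ k) (K L R2 S Q : ℕ) (hK : 1 ≤ K) (hL : 1 ≤ L)
    (hRQ : R2 ≤ Q) (hKL : K*L ≤ R2*S) (M : ℕ → ℕ → ℤ[X]) (A α2 sc δ ρ B h0 : ℝ)
    (hA : 0 < A) (hA1 : A ≠ 1) (h2 : 0 < α2) (hsc : 0 < sc) (hsc1 : sc ≤ Real.exp h0) (hh0 : 0 ≤ h0)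
    (hM : ∀ r s, r < R2+L-1 → s < S → aeval α (M r s) = sc * (A^r*α2^s))
    (hMb : ∀ r s, r < R2+L-1 → s < S → ∀ β : ℂ, ‖β‖ ≤ 1 → ‖aeval β (M r s)‖ ≤ Real.exp h0)
    (hB : ((R2+L-1:ℕ):ℝ) + Q*S ≤ B) (hB1 : 1 ≤ B) (hρ : 1 ≤ ρ) (hδ : A^Q*α2 = 1+δ)
    (hδ1 : ∀ p ≤ L*S, |(1+δ)^p - 1| ≤ (ρ⁻¹)^(K*L)) :
    ((K*L:ℝ)-1)*Real.log ρ ≤ 2*(k+2)*Real.log (K*L+1) + 2*Real.log 2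
      + (K-1)*(Real.log ρ + (k+1)*Real.log B) + (L-1)*((k+1)*h0+ρ*B*|Real.log A|) := by
  classical
  set N := K*L with hN
  set θ := Real.log A with hθ
  have hρ0 : 0 < ρ := by linarith
  have hB0 : 0 < B := by linarith
  let κ : Fin N → ℕ := fun j => ((j.divNat : Fin K) : ℕ)
  let ℓ : Fin N → ℕ := fun j => ((j.modNat : Fin L) : ℕ)
  have hκ : ∀ j, κ j < K := fun j => (j.divNat : Fin K).2
  have hℓ : ∀ j, ℓ j < L := fun j => (j.modNat : Fin L).2
  have hKN : ∀ j, κ j ≤ N := fun j => (hκ j).le.trans (Nat.le_mul_of_pos_right K hL)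
  -- row selection
  let Z : (Fin (R2+L-1) × Fin S) → Fin N → ℝ := fun i j =>
    (((i.1:ℕ):ℝ) - ((i.2:ℕ):ℝ)*Q)^(κ j) * (A^(i.1:ℕ)*α2^(i.2:ℕ))^(ℓ j)
  obtain ⟨φ, hφ⟩ := row_sel N Z (by
    intro v hv
    let P : ℕ → ℝ[X] := fun l => if hl : l < L then
      ∑ q : Fin K, C (v (finProdFinEquiv (q, ⟨l, hl⟩))) * X^(q:ℕ) else 0
    have hz := zero_est A α2 hA hA1 h2.ne' K L R2 S Q hRQ hK hKL P (by
      intro l hl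
      simp only [P, dif_pos hl]
      apply natDegree_sum_le_of_forall_le
      intro q _
      refine (natDegree_C_mul_X_pow_le _ _).trans ?_
      have := q.2; omega) (by
      intro r s hr hs
      have e1 := hv (⟨r, hr⟩, ⟨s, hs⟩)
      rw [← e1, ← finProdFinEquiv.sum_comp, Fintype.sum_prod_type_right, ← Fin.sum_univ_eq_sum_range]
      apply Finset.sum_congr rfl
      intro l _
      simp only [P, dif_pos l.2, eval_finsetSum, Finset.sum_mul]
      apply Finset.sum_congr rfl
      intro q _
      have e2 : κ (finProdFinEquiv (q, l)) = q :=
        congrArg (fun p : Fin K × Fin L => (p.1:ℕ)) (finProdFinEquiv.symm_apply_apply (q, l))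
      have e3 : ℓ (finProdFinEquiv (q, l)) = l :=
        congrArg (fun p : Fin K × Fin L => (p.2:ℕ)) (finProdFinEquiv.symm_apply_apply (q, l))
      simp only [Z, e2, e3, eval_mul, eval_C, eval_pow, eval_X]
      ring)
    funext j
    obtain ⟨⟨q, l⟩, rfl⟩ := finProdFinEquiv.surjective j
    have e1 := congrArg (fun p => coeff p (q:ℕ)) (hz l l.2)
    simp only [P, dif_pos l.2, finsetSum_coeff, coeff_C_mul, coeff_X_pow, coeff_zero] at e1
    simpa [Fin.val_inj] using e1)
  let r : Fin N → ℕ := fun i => ((φ i).1 : ℕ)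
  let s : Fin N → ℕ := fun i => ((φ i).2 : ℕ)
  have hr : ∀ i, r i < R2+L-1 := fun i => (φ i).1.2
  have hs : ∀ i, s i < S := fun i => (φ i).2.2
  let xz : Fin N → ℤ := fun i => (r i : ℤ) - s i * Q
  let x : Fin N → ℝ := fun i => (r i : ℝ) - s i * Q
  have hxz : ∀ i, ((xz i : ℤ):ℝ) = x i := by intro i; simp only [xz, x]; push_cast; ring
  have hxB : ∀ i, |x i| ≤ B := by
    intro i
    have h1 : (r i:ℝ) ≤ ((R2+L-1:ℕ):ℝ) := by exact_mod_cast (hr i).le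
    have h3 : (s i:ℝ) ≤ S := by exact_mod_cast (hs i).le
    have h4 : (s i:ℝ)*Q ≤ Q*S := by rw [mul_comm]; exact mul_le_mul_of_nonneg_left h3 (by positivity)
    have h5 : (0:ℝ) ≤ (s i:ℝ)*Q := by positivity
    have h6 : (0:ℝ) ≤ r i := by positivity
    rw [abs_le]; constructor <;> simp only [x] <;> linarith
  let Mx : Fin N → Fin N → ℝ := fun j i => (x i)^(κ j) * (A^(r i)*α2^(s i))^(ℓ j)
  have hφ' : (Matrix.of Mx).det ≠ 0 := hφ
  -- rewriting of the entries
  have hAex : Real.exp θ = A := Real.exp_log hA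
  have hent : ∀ i, A^(r i)*α2^(s i) = Real.exp (θ * x i) * (1+δ)^(s i) := by
    intro i
    have e1 : Real.exp (θ * x i) * (A^Q)^(s i) = A^(r i) := by
      rw [← hAex, ← Real.exp_nat_mul, ← Real.exp_nat_mul, ← Real.exp_nat_mul, ← Real.exp_add]
      congr 1
      simp only [x]; ring
    rw [← hδ, mul_pow, ← mul_assoc, e1]
  have hδpos : 0 < 1+δ := by rw [← hδ]; positivity
  let G : Fin N → ℝ := fun j => 2 * ((ρ*B)^(κ j) * Real.exp (ρ*(ℓ j)*|θ| * B))
  let c : Fin N → Fin N → ℝ := fun j m => if κ j ≤ (m:ℕ) then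
    B^(κ j) * ((ℓ j * θ * B)^((m:ℕ)-κ j)/((m:ℕ)-κ j).factorial) else 0
  let V : Fin N → Fin N → ℝ := fun m i => (x i/B)^(m:ℕ)
  let E : Fin N → Fin N → ℝ := fun j i => Mx j i - ∑ m, c j m * V m i
  have hV : ∀ m i, |V m i| ≤ 1 := by
    intro m i
    simp only [V]
    rw [abs_pow]
    apply pow_le_one₀ (abs_nonneg _)
    rw [abs_div, abs_of_pos hB0, div_le_one hB0]
    exact hxB i
  have hG0 : ∀ j, 0 ≤ G j := fun j => by simp only [G]; positivity
  have hc : ∀ j m, |c j m| ≤ G j * (ρ⁻¹)^(m:ℕ) := by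
    intro j m
    simp only [c]
    split_ifs with hjm
    · set p := (m:ℕ) - κ j with hp
      have hm : (m:ℕ) = κ j + p := by omega
      have e1 := term_le_exp (ρ*(ℓ j)*|θ| * B) (by positivity) p
      rw [abs_mul, abs_div, abs_pow, abs_pow, abs_of_pos hB0, Nat.abs_cast, hm, abs_mul, abs_mul, abs_of_pos hB0, Nat.abs_cast]
      have e2 : B^(κ j) * (((ℓ j:ℝ)*|θ| * B)^p/p.factorial) =
          ((ρ*B)^(κ j) * ((ρ*(ℓ j)*|θ| * B)^p/p.factorial)) * (ρ⁻¹)^(κ j+p) := by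
        rw [pow_add, inv_pow, inv_pow]
        rw [show ρ*(ℓ j:ℝ)*|θ| * B = ρ*((ℓ j:ℝ)*|θ| * B) by ring, mul_pow ρ, mul_pow ρ]
        field_simp
      rw [e2]
      apply mul_le_mul_of_nonneg_right _ (by positivity)
      have e3 : (ρ*B)^(κ j) * ((ρ*(ℓ j)*|θ| * B)^p/p.factorial) ≤ (ρ*B)^(κ j) * Real.exp (ρ*(ℓ j)*|θ| * B) :=
        mul_le_mul_of_nonneg_left e1 (by positivity)
      have e4 : 0 ≤ (ρ*B)^(κ j) * Real.exp (ρ*(ℓ j)*|θ| * B) := by positivity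
      simp only [G]; linarith
    · rw [abs_zero]; have := hG0 j; positivity
  have hE : ∀ j i, |E j i| ≤ G j * (ρ⁻¹)^N := by
    intro j i
    have hxi := hxB i
    set u := ℓ j * θ * x i with hu
    have hua : |u| ≤ ℓ j * |θ| * B := by
      rw [hu, abs_mul, abs_mul, Nat.abs_cast]
      exact mul_le_mul_of_nonneg_left hxi (by positivity)
    have e1 : Mx j i = (x i)^(κ j) * Real.exp u + (x i)^(κ j) * Real.exp u * ((1+δ)^(s i * ℓ j) - 1) := by
      simp only [Mx]
      rw [hent, mul_pow, ← Real.exp_nat_mul, ← pow_mul, hu, show (ℓ j:ℝ)*(θ*x i) = ℓ j*θ*x i by ring]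
      ring
    have e2 : ∑ m, c j m * V m i = (x i)^(κ j) * ∑ p ∈ Finset.range (N - κ j), u^p/p.factorial := by
      have e3 : ∀ m : Fin N, c j m * V m i = (fun m : ℕ => if κ j ≤ m then
          (x i)^(κ j) * (u^(m-κ j)/(m-κ j).factorial) else 0) m := by
        intro m
        simp only [c, V]
        split_ifs with hjm
        · set p := (m:ℕ) - κ j with hp
          have hm : (m:ℕ) = κ j + p := by omega
          rw [hm, div_pow, pow_add, pow_add, hu]
          rw [show (ℓ j:ℝ)*θ*B = (ℓ j*θ)*B by ring, mul_pow _ B, mul_pow _ (x i)]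
          field_simp
        · rw [zero_mul]
      rw [Finset.sum_congr rfl (fun m _ => e3 m), Fin.sum_univ_eq_sum_range (fun m : ℕ => if κ j ≤ m then
          (x i)^(κ j) * (u^(m-κ j)/(m-κ j).factorial) else 0) N]
      have e4 : N = κ j + (N - κ j) := by have := hKN j; omega
      rw [Finset.mul_sum]
      conv_lhs => rw [e4]
      rw [Finset.sum_range_add]
      rw [Finset.sum_eq_zero (s := Finset.range (κ j))]
      · rw [zero_add]
        apply Finset.sum_congr rfl
        intro p _
        simp
      · intro m hm
        rw [if_neg]; have := Finset.mem_range.1 hm; omega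
    have e5 : E j i = (x i)^(κ j) * (Real.exp u - ∑ p ∈ Finset.range (N - κ j), u^p/p.factorial)
        + (x i)^(κ j) * Real.exp u * ((1+δ)^(s i * ℓ j) - 1) := by
      simp only [E]
      rw [e1, e2]; ring
    have t1 := exp_tail u ρ hρ (N-κ j)
    have t2 := hδ1 (s i * ℓ j) (by rw [mul_comm]; exact Nat.mul_le_mul (hℓ j).le (hs i).le)
    have t3 : |x i|^(κ j) ≤ B^(κ j) := pow_le_pow_left₀ (abs_nonneg _) hxi _
    have t4 : Real.exp (ρ*|u|) ≤ Real.exp (ρ*(ℓ j)*|θ| * B) := by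
      apply Real.exp_le_exp.2
      rw [show ρ*(ℓ j:ℝ)*|θ| * B = ρ*(ℓ j*|θ| * B) by ring]
      exact mul_le_mul_of_nonneg_left hua hρ0.le
    have t5 : Real.exp u ≤ Real.exp (ρ*(ℓ j)*|θ| * B) := by
      refine le_trans (Real.exp_le_exp.2 ?_) t4
      have := le_abs_self u
      nlinarith [abs_nonneg u]
    set X1 := Real.exp (ρ*(ℓ j)*|θ| * B) with hX1
    have hX0 : 0 < X1 := Real.exp_pos _
    have s1 : |(x i)^(κ j) * (Real.exp u - ∑ p ∈ Finset.range (N - κ j), u^p/p.factorial)|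
        ≤ (ρ*B)^(κ j) * X1 * (ρ⁻¹)^N := by
      rw [abs_mul, abs_pow]
      calc _ ≤ B^(κ j) * ((ρ⁻¹)^(N-κ j) * X1) := by
            apply mul_le_mul t3 (t1.trans (mul_le_mul_of_nonneg_left t4 (by positivity))) (abs_nonneg _) (by positivity)
        _ = (ρ*B)^(κ j) * X1 * (ρ⁻¹)^N := by
            have : (ρ⁻¹)^N = (ρ⁻¹)^(κ j) * (ρ⁻¹)^(N-κ j) := by rw [← pow_add]; congr 1; have := hKN j; omega
            rw [this, mul_pow, inv_pow, inv_pow]; field_simp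
    have s2 : |(x i)^(κ j) * Real.exp u * ((1+δ)^(s i * ℓ j) - 1)| ≤ (ρ*B)^(κ j) * X1 * (ρ⁻¹)^N := by
      rw [abs_mul, abs_mul, abs_pow, abs_of_pos (Real.exp_pos u)]
      have : |x i|^(κ j) ≤ (ρ*B)^(κ j) := t3.trans (pow_le_pow_left₀ hB0.le (by nlinarith) _)
      gcongr
    rw [e5]
    refine (abs_add_le _ _).trans ?_
    simp only [G]; linarith
  have hup := det_small N Mx E V c G ρ⁻¹ (by positivity) (inv_le_one_of_one_le₀ hρ) hG0
    (by intro j i; simp only [E]; ring) hV hc hE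
  -- the determinant as polynomial
  let Dm : Matrix (Fin N) (Fin N) ℤ[X] := Matrix.of fun j i => C ((xz i)^(κ j)) * (M (r i) (s i))^(ℓ j)
  set T0 := L * (K*(K-1)/2) with hT0
  set T1 := K * (L*(L-1)/2) with hT1
  have hsκ : ∑ j, κ j = T0 := sum_divNat K L
  have hsℓ : ∑ j, ℓ j = T1 := sum_modNat K L
  have hval : aeval α Dm.det = sc^T1 * (Matrix.of Mx).det := by
    have e1 : aeval α Dm.det = ((aeval α).mapMatrix Dm).det := AlgHom.map_det (aeval α) Dm
    have e2 : (aeval α).mapMatrix Dm = Matrix.of fun j i => sc^(ℓ j) * (Matrix.of Mx) j i := by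
      ext j i
      simp only [AlgHom.mapMatrix_apply, Matrix.map_apply, Matrix.of_apply, Dm, Mx, map_mul, map_pow]
      rw [hM (r i) (s i) (hr i) (hs i), mul_pow sc]
      simp [hxz]; ring
    rw [e1, e2, Matrix.det_mul_column, Finset.prod_pow_eq_pow_sum, hsℓ]
  have hlow := h.liou hk Dm.det (by rw [hval]; exact mul_ne_zero (by positivity) hφ')
    ((N.factorial:ℝ) * (B^T0 * (Real.exp h0)^T1)) (by
      have e1 : (1:ℝ) ≤ N.factorial := by exact_mod_cast Nat.factorial_pos N
      have e2 : 1 ≤ B^T0 := one_le_pow₀ hB1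
      have e3 : 1 ≤ (Real.exp h0)^T1 := one_le_pow₀ (Real.one_le_exp hh0)
      nlinarith [mul_le_mul e2 e3 (by norm_num) (by positivity), one_le_mul_of_one_le_of_one_le e2 e3]) (by
      intro β hβ
      have e1 : aeval β Dm.det = ((aeval β).mapMatrix Dm).det := AlgHom.map_det (aeval β) Dm
      rw [e1]
      refine (det_le_prodC N _ (fun j => B^(κ j) * (Real.exp h0)^(ℓ j)) ?_).trans (le_of_eq ?_)
      · intro j i
        simp only [AlgHom.mapMatrix_apply, Matrix.map_apply, Matrix.of_apply, Dm, map_mul, map_pow]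
        rw [norm_mul, norm_pow, norm_pow]
        have := hMb (r i) (s i) (hr i) (hs i) β hβ
        have h3 : ‖aeval β (C (xz i))‖ ≤ B := by
          have : ‖((xz i : ℤ):ℂ)‖ = |x i| := by rw [← hxz, Complex.norm_intCast]
          simpa [hxz] using hxB i
        gcongr
      · rw [Finset.prod_mul_distrib, Finset.prod_pow_eq_pow_sum, Finset.prod_pow_eq_pow_sum, hsκ, hsℓ])
  have hPG : ∏ j, G j = 2^N * ((ρ*B)^T0 * Real.exp (ρ*|θ| * B*T1)) := by
    simp only [G]
    rw [Finset.prod_mul_distrib, Finset.prod_mul_distrib, Finset.prod_pow_eq_pow_sum, hsκ, ← Real.exp_sum]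
    simp only [Finset.prod_const, Finset.card_univ, Fintype.card_fin]
    congr 3
    rw [← hsℓ]; push_cast; rw [Finset.mul_sum]
    apply Finset.sum_congr rfl; intro j _; ring
  rw [hval, abs_mul, abs_of_pos (by positivity : 0 < sc^T1)] at hlow
  have hfac : (N.factorial:ℝ) ≤ (N+1)^N := by
    have : N.factorial ≤ (N+1)^N := N.factorial_le_pow.trans (Nat.pow_le_pow_left (by omega) _)
    exact_mod_cast this
  rw [hPG] at hup
  exact interp_log k K L N T0 T1 hN hT0 hT1 hK hL sc h0 ρ B θ N.factorial _ hsc hsc1 hρ0 hB0 (by positivity)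
    (abs_nonneg _) hfac hup hlow

lemma log_le_two_sqrt (z : ℝ) (hz : 0 ≤ z) : Real.log (z+1) ≤ 2*Real.sqrt z := by
  have h1 : z+1 ≤ (Real.sqrt z + 1)^2 := by nlinarith [Real.sq_sqrt hz, Real.sqrt_nonneg z]
  have h2 : Real.log (z+1) ≤ Real.log ((Real.sqrt z+1)^2) := Real.log_le_log (by linarith) h1
  rw [Real.log_pow] at h2
  have h3 := Real.log_le_sub_one_of_pos (by positivity : 0 < Real.sqrt z + 1)
  push_cast at h2
  linarith

lemma ml {a b c : ℝ} (hc : 0 ≤ c) (h : a ≤ b) : c*a ≤ c*b := mul_le_mul_of_nonneg_left h hc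
lemma ge_mul_l {a c : ℝ} (hc : 0 ≤ c) (h : 1 ≤ a) : c ≤ c*a := le_mul_of_one_le_right hc h

set_option maxHeartbeats 4000000 in
lemma params (k1 l b n X E G : ℝ) (hk1 : 3 ≤ k1) (hl : 1 ≤ l) (hlk : l ≤ k1) (hb : 50 ≤ b) (hE : 1 ≤ E)
    (hEX : E ≤ X) (hG : 0 ≤ G) (h1 : X^2*(G+4) ≤ n)
    (h2 : 100*(k1^4*b^2/l^3)*(15*n/X+1.5*X^2+G*X) ≤ n/2) :
    ∃ L S R K : ℕ, 1 ≤ L ∧ 1 ≤ K ∧ K*L ≤ R*S ∧ 1 ≤ S ∧ ((R:ℝ)+1)*E ≤ n-1 ∧ (L:ℝ) ≤ R ∧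
      (S:ℝ)*(n/E) + 2*(n/E) ≤ n*(4*L*(k1/l)+3) ∧ (4*L*(k1/l)+3)^4 ≤ n ∧
      l*(R*S)+Real.log (2*(L*S)) ≤ 100*(k1^4*b^2/l^3)*(15*n/X+1.5*X^2+G*X) ∧
      2*(k1+1)*Real.log (K*L+1) + 2*Real.log 2 + (K-1)*(l+k1*b) +
        (L-1)*((R+L-1)*(0.8*k1*E) + S*(k1*(15*n/(X*E)+1.5*E+G))) < ((K*L:ℝ)-1)*l ∧ 3000 ≤ X := by
  have hl0 : 0 < l := by linarith
  have hX1 : 1 ≤ X := by linarith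
  have hX0 : 0 < X := by linarith
  have hE0 : 0 < E := by linarith
  have hnX : 4*X^2 ≤ n := by nlinarith [mul_nonneg (sq_nonneg X) hG]
  have hn0 : 0 < n := by nlinarith
  obtain ⟨v, hv⟩ : ∃ v, v = k1/l := ⟨_, rfl⟩
  have hvl : v*l = k1 := by rw [hv]; field_simp
  have hv1 : 1 ≤ v := by rw [hv, le_div_iff₀ hl0]; linarith
  have hvk : v ≤ k1 := by rw [hv]; exact div_le_self (by linarith) hl
  obtain ⟨Λ, hΛ⟩ : ∃ Λ, Λ = v*b := ⟨_, rfl⟩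
  have hΛ1 : 50 ≤ Λ := by rw [hΛ]; exact hb.trans (le_mul_of_one_le_left (by linarith) hv1)
  have hΛl : Λ*l = k1*b := by rw [hΛ, ← hvl]; ring
  have hY : k1^4*b^2/l^3 = Λ^2*v*k1 := by
    rw [div_eq_iff (by positivity), hΛ, ← hvl]; ring
  obtain ⟨Z, hZ⟩ : ∃ Z, Z = 15*n/X+1.5*X^2+G*X := ⟨_, rfl⟩
  rw [hY, ← hZ] at h2
  rw [hY, ← hZ, ← hv]
  have hnXp : 0 < n/X := by positivity
  have hZ1 : 15*(n/X) ≤ Z := by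
    rw [hZ]; have : 0 ≤ G*X := by positivity
    have := sq_nonneg X; rw [mul_div_assoc]; linarith
  have hZ2 : 1.5*X^2 ≤ Z := by
    rw [hZ]; have : 0 ≤ G*X := by positivity
    have : 0 ≤ 15*n/X := by positivity
    linarith
  have hX2 : 1 ≤ X^2 := one_le_pow₀ hX1
  have hXX2 : 1*X ≤ X^2 := by rw [sq]; exact mul_le_mul_of_nonneg_right hX1 hX0.le
  have hZ0 : 0 < Z := by linarith
  have hXbig : 3000*(Λ^2*v*k1) ≤ X := by
    have h3 : 100*(Λ^2*v*k1)*(15*(n/X)) ≤ n/2 := by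
      refine le_trans ?_ h2
      apply mul_le_mul_of_nonneg_left hZ1; positivity
    have h4 : n = (n/X)*X := by field_simp
    have h5 : (n/X)*(3000*(Λ^2*v*k1)) ≤ (n/X)*X := by linarith
    exact le_of_mul_le_mul_left h5 hnXp
  have hX3000 : 3000 ≤ X := by
    have : 1 ≤ Λ^2*v*k1 := by
      have h5 : 1 ≤ Λ^2 := one_le_pow₀ (by linarith)
      have h6 : 1 ≤ Λ^2*v := one_le_mul_of_one_le_of_one_le h5 hv1
      exact one_le_mul_of_one_le_of_one_le h6 (by linarith)
    linarith
  obtain ⟨u2, hu2⟩ : ∃ u, u = 15*n/(X*E)+1.5*E+G := ⟨_, rfl⟩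
  rw [← hu2]
  have hXE : X*E ≤ n/4 := by have := ml hX0.le hEX; linarith
  have hu60 : 60 ≤ u2 := by
    rw [hu2]
    have : 60 ≤ 15*n/(X*E) := by rw [le_div_iff₀ (by positivity)]; linarith
    linarith
  have hEu : E*u2 ≤ Z := by
    have h3 : E*(15*n/(X*E)) = 15*n/X := by field_simp
    rw [hu2, hZ, mul_add, mul_add, h3]
    have h4 : E*E ≤ X*X := mul_le_mul hEX hEX hE0.le hX0.le
    have h5 := ml hG hEX
    linarith
  -- L
  obtain ⟨L, hL⟩ : ∃ L : ℕ, L = ⌈2*Λ⌉₊+2 := ⟨_, rfl⟩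
  have hL1 : 2*Λ+2 ≤ (L:ℝ) := by rw [hL]; push_cast; linarith [Nat.le_ceil (2*Λ)]
  have hL2 : (L:ℝ) ≤ 2.06*Λ := by
    have := Nat.ceil_lt_add_one (by linarith : (0:ℝ) ≤ 2*Λ)
    rw [hL]; push_cast; linarith
  have hL0 : (102:ℝ) ≤ L := by linarith
  obtain ⟨p, hp⟩ : ∃ p, p = 4*L*v*E := ⟨_, rfl⟩
  obtain ⟨q, hq⟩ : ∃ q, q = 5*L*v*u2 := ⟨_, rfl⟩
  have hLvL : (L:ℝ) ≤ L*v := ge_mul_l (by linarith) hv1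
  have hLv : (102:ℝ) ≤ L*v := by linarith
  have hLvE : (L:ℝ)*v ≤ L*v*E := ge_mul_l (by linarith) hE
  have hp1 : 4*(L*v) ≤ p := by rw [hp]; linarith
  have hq1 : 300*(L*v) ≤ q := by rw [hq]; have := ml (by linarith : 0 ≤ (L:ℝ)*v) hu60; linarith
  obtain ⟨S, hS⟩ : ∃ S : ℕ, S = ⌈p⌉₊ := ⟨_, rfl⟩
  obtain ⟨R, hR⟩ : ∃ R : ℕ, R = ⌈q⌉₊ := ⟨_, rfl⟩
  have hS1 : p ≤ S := by rw [hS]; exact Nat.le_ceil p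
  have hR1 : q ≤ R := by rw [hR]; exact Nat.le_ceil q
  have hS2 : (S:ℝ) ≤ 1.0025*p := by
    have := Nat.ceil_lt_add_one (by linarith : (0:ℝ) ≤ p)
    rw [hS]; linarith
  have hR2 : (R:ℝ) ≤ 1.0001*q := by
    have := Nat.ceil_lt_add_one (by linarith : (0:ℝ) ≤ q)
    rw [hR]; linarith
  have hLpos : 0 < L := by rw [hL]; omega
  obtain ⟨K, hK⟩ : ∃ K : ℕ, K = R*S/L := ⟨_, rfl⟩
  have hKL : K*L ≤ R*S := by rw [hK]; exact Nat.div_mul_le_self _ _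
  have hKL2 : R*S < K*L+L := by
    have := Nat.lt_div_mul_add (a := R*S) hLpos
    rw [hK]; exact this
  have hKLr : (K:ℝ)*L ≤ R*S := by exact_mod_cast hKL
  have hKLr2 : (R:ℝ)*S ≤ K*L+L := by exact_mod_cast hKL2.le
  have hp0 : 0 < p := by linarith
  have hq0 : 0 < q := by linarith
  have hpq : p*q ≤ R*S := by rw [mul_comm]; exact mul_le_mul hR1 hS1 hp0.le (by positivity)
  have hRS2 : (R:ℝ)*S ≤ 1.003*(p*q) := by
    have : (R:ℝ)*S ≤ (1.0001*q)*(1.0025*p) := mul_le_mul hR2 hS2 (by positivity) (by positivity)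
    have := mul_pos hp0 hq0; linarith
  have hz : 1200*(L*v)^2 ≤ R*S := by
    have : (4*(L*v))*(300*(L*v)) ≤ p*q := mul_le_mul hp1 hq1 (by positivity) (by positivity)
    linarith
  have hLR : (L:ℝ) ≤ R/300 := by linarith
  have hRS1 : (L:ℝ) ≤ R*S := by
    have h8 : (1:ℝ) ≤ S := by linarith
    have := ge_mul_l (by positivity : (0:ℝ) ≤ R) h8
    linarith
  have hK1 : 1 ≤ K := by
    rw [hK, Nat.one_le_div_iff hLpos]; exact_mod_cast hRS1
  have hLL : (L:ℝ)^2 ≤ 4.2436*Λ^2 := by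
    have := pow_le_pow_left₀ (by positivity) hL2 2
    linarith
  have hsS : (1:ℝ) ≤ S := by linarith
  refine ⟨L, S, R, K, hLpos, hK1, hKL, by exact_mod_cast hsS, ?_, by linarith, ?_, ?_, ?_, ?_, hX3000⟩
  · -- (R+1) E ≤ n-1
    have a1 : (R:ℝ)*E ≤ 1.0001*(5*L*v)*Z := by
      calc (R:ℝ)*E ≤ (1.0001*q)*E := mul_le_mul_of_nonneg_right hR2 hE0.le
        _ = 1.0001*(5*L*v)*(E*u2) := by rw [hq]; ring
        _ ≤ _ := mul_le_mul_of_nonneg_left hEu (by positivity)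
    have a2 : (L:ℝ)*v*Z ≤ 2.06*(Λ*v*Z) := by
      have := ml (by positivity : 0 ≤ v*Z) hL2
      linarith
    have a3 : 15000*(Λ*v*Z) ≤ n/2 := by
      refine le_trans ?_ h2
      have : 0 < Λ*v*Z := by positivity
      have h6 : 50*3 ≤ Λ*k1 := mul_le_mul hΛ1 hk1 (by norm_num) (by linarith)
      have h7 : 100*(Λ^2*v*k1)*Z = 100*(Λ*k1)*(Λ*v*Z) := by ring
      rw [h7]; have := ml this.le h6; linarith
    have a4 : E ≤ n/4000 := by have := ml hX0.le hX3000; linarith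
    have a5 : 1 ≤ n/4 := by linarith
    linarith
  · have a1 : (S:ℝ)*(n/E) ≤ (p+1)*(n/E) := by
      apply mul_le_mul_of_nonneg_right _ (by positivity)
      rw [hS]; exact (Nat.ceil_lt_add_one hp0.le).le
    have a2 : p*(n/E) = n*(4*L*v) := by rw [hp]; field_simp
    have a3 : n/E ≤ n := div_le_self hn0.le hE
    linarith
  · have a1 : 4*L*v+3 ≤ 8.3*(Λ*v) := by
      have b1 := ml (by linarith : 0 ≤ v) hL2
      have b2 := ge_mul_l (by linarith : 0 ≤ Λ) hv1
      linarith
    have a2 : (4*L*v+3)^4 ≤ (8.3*(Λ*v))^4 := pow_le_pow_left₀ (by positivity) a1 4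
    refine a2.trans ?_
    have a3 : (3000*(Λ^2*v*v))^2 ≤ X^2 := by
      apply pow_le_pow_left₀ (by positivity)
      refine le_trans ?_ hXbig
      have := ml (by positivity : 0 ≤ Λ^2*v) hvk
      linarith
    have a4 : (8.3*(Λ*v))^4 ≤ 4*(3000*(Λ^2*v*v))^2 := by
      have : 0 ≤ (Λ*v)^4 := by positivity
      have e1 : (8.3*(Λ*v))^4 = 8.3^4*(Λ*v)^4 := by ring
      have e2 : 4*(3000*(Λ^2*v*v))^2 = 36000000*(Λ*v)^4 := by ring
      rw [e1, e2]; norm_num; linarith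
    linarith
  · have a1 : l*(R*S) ≤ 85.2*(Λ^2*v*k1)*Z := by
      have b1 : l*(R*S) ≤ l*(1.003*(p*q)) := mul_le_mul_of_nonneg_left hRS2 hl0.le
      have b2 : l*(1.003*(p*q)) = 20.06*(L:ℝ)^2*(v*k1)*(E*u2) := by rw [hp, hq, ← hvl]; ring
      have b3 : 20.06*(L:ℝ)^2*(v*k1)*(E*u2) ≤ 20.06*(4.2436*Λ^2)*(v*k1)*Z := by gcongr
      have b4 : 0 ≤ Λ^2*(v*k1)*Z := by positivity
      linarith
    have a2 : Real.log (2*(L*S)) ≤ 14*(Λ^2*v*k1)*Z := by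
      have b1 := Real.log_le_sub_one_of_pos (by positivity : (0:ℝ) < 2*(L*S))
      have b2 : (L:ℝ)*S ≤ L*(1.0025*p) := mul_le_mul_of_nonneg_left hS2 (by positivity)
      have b3 : (L:ℝ)*(1.0025*p) = 4.01*(L:ℝ)^2*(v*E) := by rw [hp]; ring
      have b4 : 4.01*(L:ℝ)^2*(v*E) ≤ 4.01*(4.2436*Λ^2)*(v*E) := by gcongr
      have b5 : 1.5*E ≤ Z := by linarith
      have b6 : Λ^2*v*(1.5*E) ≤ Λ^2*v*Z := mul_le_mul_of_nonneg_left b5 (by positivity)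
      have b7 : 0 ≤ Λ^2*v*Z := by positivity
      have b8 : 3*(Λ^2*v*Z) ≤ k1*(Λ^2*v*Z) := mul_le_mul_of_nonneg_right hk1 b7
      linarith
    have a3 : 0 ≤ (Λ^2*v*k1)*Z := by positivity
    linarith
  · obtain ⟨z, hzz⟩ : ∃ z : ℝ, z = R*S := ⟨_, rfl⟩
    rw [← hzz] at hz hKLr hKLr2 hpq hRS1
    have hz0 : 0 ≤ z := by linarith [sq_nonneg ((L:ℝ)*v)]
    have c1 : Real.log (K*L+1) ≤ 2*Real.sqrt z := by
      refine le_trans (Real.log_le_log (by positivity) (by linarith : (K:ℝ)*L+1 ≤ z+1)) (log_le_two_sqrt z hz0)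
    have c2 : 34*(L*v) ≤ Real.sqrt z := by
      apply Real.le_sqrt_of_sq_le
      have := sq_nonneg ((L:ℝ)*v)
      rw [mul_pow]; linarith
    have c3 : ((K:ℝ)-1)*(l+k1*b) ≤ (K-1)*(L*l/2) := by
      apply mul_le_mul_of_nonneg_left
      · have := ml hl0.le hL1
        linarith
      · have : (1:ℝ) ≤ K := by exact_mod_cast hK1
        linarith
    have c4 : (L:ℝ)*(0.8*k1*E) = l*p/5 := by rw [hp, ← hvl]; ring
    have c5 : (L:ℝ)*(k1*u2) = l*q/5 := by rw [hq, ← hvl]; ring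
    have c6 : ((L:ℝ)-1)*((R+L-1)*(0.8*k1*E) + S*(k1*u2)) ≤ l*(z/5+z/1500) + l*z/5 := by
      have d0 : ((L:ℝ)-1)*((R+L-1)*(0.8*k1*E) + S*(k1*u2)) ≤ L*((R+L)*(0.8*k1*E) + S*(k1*u2)) := by
        apply mul_le_mul (by linarith) _ _ (by positivity)
        · have : 0 ≤ 0.8*k1*E := by positivity
          linarith
        · have : 0 ≤ (R:ℝ)+L-1 := by have : (0:ℝ) ≤ R := by positivity
                                     linarith
          positivity
      have d1 : (L:ℝ)*((R+L)*(0.8*k1*E) + S*(k1*u2)) = (R+L)*(l*p/5) + S*(l*q/5) := by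
        rw [← c4, ← c5]; ring
      have d2 : ((R:ℝ)+L)*(l*p/5) ≤ (R+R/300)*(l*S/5) := by gcongr
      have d3 : (S:ℝ)*(l*q/5) ≤ S*(l*R/5) := by gcongr
      rw [hzz]
      linarith
    have hlog2 : Real.log 2 ≤ 1 := by linarith [Real.log_two_lt_d9]
    -- remaining
    have c7 : 2*(k1+1)*Real.log (K*L+1) ≤ 2*(k1+1)*(2*Real.sqrt z) := mul_le_mul_of_nonneg_left c1 (by linarith)
    set w := Real.sqrt z with hw
    have c8 : z = w*w := (Real.mul_self_sqrt hz0).symm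
    have c9 : 68*k1 ≤ l*w/51 := by
      have : l*(34*(L*v)) ≤ l*w := mul_le_mul_of_nonneg_left c2 hl0.le
      have h9 : l*(34*(L*v)) = 34*L*k1 := by rw [← hvl]; ring
      have h10 := ml (by linarith : 0 ≤ k1) hL0
      linarith
    have hw0 : 3000 ≤ w := by linarith [hLv, c2]
    -- (KL-1) l - (K-1) L l/2 ≥ l (z)/2 - l
    have c10 : ((K*L:ℝ)-1)*l - (K-1)*(L*l/2) ≥ l*z/2 - l := by
      have := ml hl0.le hKLr2
      linarith
    have c11 : 2*(k1+1)*(2*w) + 2 + l < 0.09*(l*z) := by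
      rw [c8]
      have e1 : 2*(k1+1)*(2*w) ≤ 6*k1*w := by
        have := ml (by linarith : 0 ≤ w) hk1
        linarith
      have e2 : 6*k1*w ≤ 0.01*l*w*w := by
        have := ml (by linarith : 0 ≤ w) c9
        linarith
      have e3 : 2+l < 0.01*l*w*w := by
        have h1 := ml (by linarith : 0 ≤ w) hw0
        have h3 := ml hl0.le (by linarith : 3000*3000 ≤ w*w)
        linarith
      have e4 : 0 < l*w*w := by positivity
      linarith
    have c12 : 0 ≤ l*z := by positivity
    linarith

namespace IsA
variable {k : ℕ} {α : ℝ}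
lemma inv_int (h : IsA k α) (hk : 2 ≤ k) : IsIntegral ℤ α⁻¹ := by
  have h1 : α⁻¹ = α^(k-1)*(2-α) := by
    have := h.eq
    have hp := h.pos
    obtain ⟨j, rfl⟩ : ∃ j, k = j+1 := ⟨k-1, by omega⟩
    rw [pow_succ] at this
    simp only [Nat.add_sub_cancel]
    field_simp
    linarith
  rw [h1]
  have i : IsIntegral ℤ α := (isIntegral_algebraMap_iff (R := ℤ) (A := ℝ) (B := ℂ) (algebraMap ℝ ℂ).injective).1 h.integral
  exact (i.pow _).mul (IsIntegral.sub (by simpa using isIntegral_algebraMap (R := ℤ) (A := ℝ) (x := 2)) i)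

lemma indep (h : IsA k α) (hk : 2 ≤ k) (e f : ℕ) (he : 1 ≤ e) : α^e/10^f ≠ 1 := by
  intro h1
  have h2 : α^e = 10^f := by field_simp at h1; exact h1
  have hp := h.pos
  rcases Nat.eq_zero_or_pos f with hf | hf
  · subst hf
    have : 1 < α^e := one_lt_pow₀ (by linarith [h.lo]) (by omega)
    rw [h2] at this; norm_num at this
  · have h3 : IsIntegral ℤ ((α⁻¹)^e) := (h.inv_int hk).pow e
    rw [inv_pow, h2] at h3
    have h4 : IsIntegral ℤ (((10:ℚ)^f)⁻¹) := by
      rw [← isIntegral_algebraMap_iff (R := ℤ) (A := ℚ) (B := ℝ) (algebraMap ℚ ℝ).injective]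
      simpa using h3
    obtain ⟨z, hz⟩ := IsIntegrallyClosed.isIntegral_iff.mp h4
    have h5 : (z:ℚ)*10^f = 1 := by
      have : (z:ℚ) = ((10:ℚ)^f)⁻¹ := by simpa using hz
      rw [this]; field_simp
    have h6 : z*10^f = 1 := by exact_mod_cast h5
    have h7 : (10:ℤ)^f ∣ 1 := ⟨z, by rw [← h6]; ring⟩
    have h8 : (10:ℤ) ∣ 1 := (dvd_pow_self 10 (by omega)).trans h7
    norm_num at h8
end IsA

lemma dirich (n1 y X : ℕ) (hn : 1 ≤ n1) (hX : 1 ≤ X) :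
    ∃ e f Q w1 W w' : ℕ, 1 ≤ e ∧ e ≤ X ∧ n1 = e*Q+w1 ∧ w1 < e ∧ w' + y = f*Q+W ∧ w' ≤ 2*W ∧
      |(e:ℝ)*y - f*n1| ≤ n1/X ∧ (W:ℝ) ≤ n1/(X*e)+f := by
  obtain ⟨j, e, he, heX, hj⟩ := Real.exists_int_int_abs_mul_sub_le ((y:ℝ)/n1) hX
  have hn0 : (0:ℝ) < n1 := by exact_mod_cast hn
  have hX0 : (0:ℝ) < X := by exact_mod_cast hX
  have hj0 : 0 ≤ j := by
    have h1 := (abs_le.1 hj).2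
    have h2 : (1:ℝ)/(X+1) < 1 := by rw [div_lt_one (by positivity)]; linarith
    have h3 : 0 ≤ (e:ℝ)*(y/n1) := by
      have : (0:ℝ) ≤ e := by exact_mod_cast he.le
      positivity
    have h4 : (-1:ℝ) < j := by linarith
    have : (-1:ℤ) < j := by exact_mod_cast h4
    omega
  lift j to ℕ using hj0 with f
  lift e to ℕ using he.le
  have he' : 1 ≤ e := by exact_mod_cast he
  have he0 : (0:ℝ) < e := by exact_mod_cast he
  have hd := Nat.div_add_mod n1 e
  have hm := Nat.mod_lt n1 he'
  set Q := n1/e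
  set w1 := n1 % e
  set w2 : ℤ := (y:ℤ) - f*Q with hw2
  have key : |(e:ℝ)*y - f*n1| ≤ n1/X := by
    have h1 : (e:ℝ)*y - f*n1 = n1*(e*(y/n1)-f) := by field_simp
    simp only [Int.cast_natCast] at hj
    rw [h1, abs_mul, abs_of_pos hn0, div_eq_mul_one_div (n1:ℝ) (X:ℝ)]
    refine mul_le_mul_of_nonneg_left (hj.trans ?_) hn0.le
    apply one_div_le_one_div_of_le hX0; linarith
  refine ⟨e, f, Q, w1, w2.natAbs, (w2.natAbs - w2).toNat, he', by exact_mod_cast heX, hd.symm, hm, by zify; rw [Int.toNat_of_nonneg (sub_nonneg.2 (le_abs_self _))]; push_cast; linarith, by omega, key, ?_⟩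
  have h2 : ((w2.natAbs:ℕ):ℝ) = |(w2:ℝ)| := by
    rw [Nat.cast_natAbs]; simp
  rw [h2]
  have h3 : (e:ℝ)*w2 = (e*y-f*n1) + f*w1 := by
    have : (n1:ℝ) = e*Q+w1 := by exact_mod_cast hd.symm
    rw [hw2, this]; push_cast; ring
  have h4 : (e:ℝ)*|(w2:ℝ)| ≤ n1/X + f*e := by
    rw [← abs_of_pos he0, ← abs_mul, h3, abs_of_pos he0]
    refine (abs_add_le _ _).trans (add_le_add key ?_)
    rw [abs_of_nonneg (by positivity)]
    have : (w1:ℝ) ≤ e := by exact_mod_cast hm.le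
    gcongr
  have h5 : (n1:ℝ)/(X*e)+f = (n1/X+f*e)/e := by field_simp
  rw [h5, le_div_iff₀ he0]; linarith

lemma log10_hi : Real.log 10 < 2.3026 := by
  have h : Real.log ((10:ℝ)^28) ≤ Real.log (2^93*1.01) := Real.log_le_log (by positivity) (by norm_num)
  rw [Real.log_mul (by positivity) (by norm_num), Real.log_pow, Real.log_pow] at h
  have := Real.log_two_lt_d9
  have := Real.log_le_sub_one_of_pos (by norm_num : (0:ℝ) < 1.01)
  push_cast at h
  linarith
lemma log10_lo : 2.302 < Real.log 10 := by
  have h : Real.log ((2:ℝ)^93) ≤ Real.log (10^28) := Real.log_le_log (by positivity) (by norm_num)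
  rw [Real.log_pow, Real.log_pow] at h
  have := Real.log_two_gt_d9
  push_cast at h
  linarith

open Polynomial in
lemma polyM {k : ℕ} {α : ℝ} (h : IsA k α) (hk : 2 ≤ k) (e f w1 W w' RR S g : ℕ) (hg : 1 ≤ g) (hw : w' ≤ 2*W) :
    ∃ M : ℕ → ℕ → ℤ[X], (∀ r s, r < RR → s < S → aeval α (M r s) = (10^(f*RR+W*S)*((g:ℝ)*dn k α)^S) *
      ((α^e/10^f)^r*((α^w1*10^w'*(9*nm α))/(10^W*(g*dn k α)))^s)) ∧
    (∀ r s, r < RR → s < S → ∀ β : ℂ, ‖β‖ ≤ 1 → ‖aeval β (M r s)‖ ≤ 10^(f*RR+2*W*S)*(27*k*g:ℝ)^S) := by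
  have hp := h.pos
  have hd : 0 < dn k α := by linarith [h.dn_lo hk]
  have hg0 : (0:ℝ) < g := by exact_mod_cast hg
  refine ⟨fun r s => C ((10:ℤ)^(f*(RR-r)+W*(S-s)+w'*s))*X^(e*r+w1*s)*(9*((2*X-1)*(X-1)))^s*(C (g:ℤ)*(C ((k:ℤ)+1)*X-C (2*(k:ℤ))))^(S-s), ?_, ?_⟩
  · intro r s hr hs
    obtain ⟨r', rfl⟩ := Nat.exists_eq_add_of_lt hr
    obtain ⟨s', rfl⟩ := Nat.exists_eq_add_of_lt hs
    beta_reduce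
    rw [show r+r'+1-r = r'+1 by omega, show s+s'+1-s = s'+1 by omega]
    simp only [map_mul, map_pow, map_sub, map_add, aeval_X, aeval_C, map_one, map_ofNat, map_natCast]
    have e1 : ((k:ℝ)+1)*α-2*k = dn k α := by unfold dn; ring
    rw [e1, show (2*α-1)*(α-1) = nm α from rfl]
    have hd' := hd.ne'
    have hg' := hg0.ne'
    generalize dn k α = d at *
    generalize nm α = m at *
    rw [div_pow, div_pow, mul_pow (_*_) (9*m), mul_pow (α^w1), mul_pow ((10:ℝ)^W), ← pow_mul, ← pow_mul, ← pow_mul, ← pow_mul, ← pow_mul]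
    rw [show (10:ℝ)^(f*(r+r'+1)+W*(s+s'+1)) = 10^(f*(r'+1)+W*(s'+1))*10^(f*r)*10^(W*s) by rw [← pow_add, ← pow_add]; congr 1; ring,
      show ((g:ℝ)*d)^(s+s'+1) = (g*d)^s*(g*d)^(s'+1) by rw [← pow_add]; congr 1, pow_add 10 _ (w'*s), pow_add α]
    have : (g:ℝ)*d ≠ 0 := mul_ne_zero hg' hd'
    field_simp
  · intro r s hr hs β hβ
    simp only [map_mul, map_pow, map_sub, map_add, aeval_X, aeval_C, map_one, map_ofNat, map_natCast]
    rw [norm_mul, norm_mul, norm_mul, norm_pow, norm_pow, norm_pow, norm_pow]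
    have b1 : ‖(10:ℂ)‖ = 10 := by simp
    have b2 : ‖β‖^(e*r+w1*s) ≤ 1 := pow_le_one₀ (norm_nonneg _) hβ
    have b3 : ‖(9:ℂ)*((2*β-1)*(β-1))‖ ≤ 27*k*g := by
      have c1 : ‖2*β-1‖ ≤ 3 := by
        refine (norm_sub_le _ _).trans ?_
        rw [norm_mul]; simp; linarith
      have c2 : ‖β-1‖ ≤ 2 := by
        refine (norm_sub_le _ _).trans ?_
        simp; linarith
      have hk' : (2:ℝ) ≤ k := by exact_mod_cast hk
      have hg' : (1:ℝ) ≤ g := by exact_mod_cast hg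
      calc ‖(9:ℂ)*((2*β-1)*(β-1))‖ = 9*(‖2*β-1‖*‖β-1‖) := by rw [norm_mul, norm_mul]; simp
        _ ≤ 9*(3*2) := by gcongr
        _ ≤ 27*k*g := by nlinarith
    have b4 : ‖(g:ℂ)*(((k:ℂ)+1)*β-2*k)‖ ≤ 27*k*g := by
      have hk' : (2:ℝ) ≤ k := by exact_mod_cast hk
      have c1 : ‖((k:ℂ)+1)*β-2*k‖ ≤ 27*k := by
        refine (norm_sub_le _ _).trans ?_
        have c2 : ‖((k:ℂ)+1)*β‖ ≤ (k+1)*1 := by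
          rw [norm_mul]
          have : ‖(k:ℂ)+1‖ = k+1 := by
            have := Complex.norm_natCast (k+1); push_cast at this; exact this
          rw [this]; gcongr
        have c3 : ‖(2*k:ℂ)‖ = 2*k := by simp
        rw [c3]; linarith
      rw [norm_mul, Complex.norm_natCast]
      calc (g:ℝ)*_ ≤ g*(27*k) := by gcongr
        _ = _ := by ring
    have b5 : (10:ℝ)^(f*(RR-r)+W*(S-s)+w'*s) ≤ 10^(f*RR+2*W*S) := by
      apply pow_le_pow_right₀ (by norm_num)
      have d1 : f*(RR-r) ≤ f*RR := Nat.mul_le_mul_left _ (Nat.sub_le _ _)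
      have d2 : w'*s ≤ 2*W*s := Nat.mul_le_mul_right _ hw
      have d3 : W*(S-s)+W*s = W*S := by rw [← Nat.mul_add]; congr 1; omega
      have d4 : W*s ≤ W*S := Nat.mul_le_mul_left _ hs.le
      nlinarith
    have b6 : (27*k*g:ℝ)^S = (27*k*g)^s*(27*k*g)^(S-s) := by rw [← pow_add]; congr 1; omega
    rw [b6]
    simp only [eq_intCast, Int.cast_pow, Int.cast_ofNat, norm_pow, b1, Int.cast_add, Int.cast_natCast, Int.cast_one, Int.cast_mul]
    calc _ ≤ 10^(f*RR+2*W*S)*1*(27*k*g:ℝ)^s*(27*k*g:ℝ)^(S-s) := by gcongr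
      _ = _ := by ring

lemma thetab (n1 y e f X g : ℝ) (n lα t c G : ℝ) (hn1 : n1 = n-1) (hX3 : 3000 ≤ X) (he : 1 ≤ e) (heX : e ≤ X)
    (hf : 0 ≤ f)
    (hG : 0 ≤ G) (h1 : X^2*(G+4) ≤ n) (hd : |e*y-f*n1| ≤ n1/X)
    (hgc : |g - c| ≤ G) (ht : |t| ≤ 1) (hα : lα ≤ Real.log 2) (heq : c + n1*lα = g + y*Real.log 10 + t)
    (W w0 k Q R S : ℝ) (hk : 2 ≤ k) (hR : 0 ≤ R) (hS : 0 ≤ S) (hQ : Q ≤ n/e) (hQ0 : 0 ≤ Q)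
    (hW : W ≤ n1/(X*e)+f) (hw0 : w0 ≤ G)  :
    (k+1)*((f*R+2*W*S)*Real.log 10+S*w0)+3*k*(R+Q*S)*|e*lα-f*Real.log 10| ≤
      R*(0.8*(k+1)*e)+S*((k+1)*(15*n/(X*e)+1.5*e+G)) := by
  have hX0 : 0 < X := by linarith
  have he0 : 0 < e := by linarith
  have l10 := log10_hi
  have l10' := log10_lo
  have l2 := Real.log_two_lt_d9
  have hXG : X*(G+1)+3*X ≤ n/X := by rw [le_div_iff₀ hX0]; linarith
  have hXX : X*X ≤ n := by have : 0 ≤ X^2*G := by positivity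
                           linarith [sq_nonneg X]
  have hn0 : 0 < n1 := by have := ml hX0.le hX3; linarith
  have h1X : 1/X ≤ 1 := by rw [div_le_one hX0]; linarith
  have hnX : n/X = n1/X + 1/X := by rw [hn1]; ring
  have hXG' : X*(G+1) ≤ n1/X := by linarith
  have heG : e*(G+1) ≤ n1/X := le_trans (mul_le_mul_of_nonneg_right heX (by linarith)) hXG'
  have ha := abs_le.1 hd
  have hb := abs_le.1 hgc
  have hc := abs_le.1 ht
  have hm1 : n1*(e*lα-f*Real.log 10) = (e*y-f*n1)*Real.log 10+e*((g-c)+t) := by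
    have : n1*lα = g + y*Real.log 10 + t - c := by linarith
    calc _ = e*(n1*lα) - f*n1*Real.log 10 := by ring
      _ = _ := by rw [this]; ring
  have hnx0 : 0 < n1/X := by positivity
  have hth : |e*lα-f*Real.log 10| ≤ 3.4/X := by
    have a1 : |n1*(e*lα-f*Real.log 10)| ≤ n1/X*2.3026 + n1/X := by
      rw [hm1]
      refine (abs_add_le _ _).trans (add_le_add ?_ ?_)
      · rw [abs_mul, abs_of_pos (by linarith : 0 < Real.log 10)]
        exact mul_le_mul hd l10.le (by linarith) hnx0.le
      · rw [abs_mul, abs_of_pos he0]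
        refine le_trans (mul_le_mul_of_nonneg_left ?_ he0.le) heG
        exact (abs_add_le _ _).trans (add_le_add hgc ht)
    rw [abs_mul, abs_of_pos hn0] at a1
    have a2 : n1/X*2.3026+n1/X = n1*(3.3026/X) := by ring
    rw [a2] at a1
    have a3 := le_of_mul_le_mul_left a1 hn0
    refine a3.trans ?_
    gcongr; norm_num
  have hX34 : 3.4/X ≤ 0.002 := by rw [div_le_iff₀ hX0]; linarith
  have hfe : f ≤ 0.31*e := by
    have b1 : f*Real.log 10 ≤ e*lα + 0.002 := by linarith [(abs_le.1 hth).1]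
    have b2 : e*lα ≤ e*0.6931471808 := ml he0.le (by linarith)
    have b3 : f*2.302 ≤ f*Real.log 10 := ml hf l10'.le
    linarith
  set nx := n/(X*e) with hnx
  have hnn : n1/(X*e) ≤ nx := by rw [hnx]; gcongr; linarith
  have hnx0 : 0 ≤ nx := by have : 0 < n := by linarith
                           positivity
  have q1 : 3*k*(R*|e*lα-f*Real.log 10|) ≤ R*((k+1)*0.006) := by
    have : R*|e*lα-f*Real.log 10| ≤ R*0.002 := ml hR (hth.trans hX34)
    have := ml (by linarith : 0 ≤ 3*k) this
    have h3 : 0 ≤ R*0.006 := by positivity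
    linarith
  have q2 : 3*k*(Q*S*|e*lα-f*Real.log 10|) ≤ S*((k+1)*(10.2*nx)) := by
    have a1 : Q*|e*lα-f*Real.log 10| ≤ n/e*(3.4/X) := mul_le_mul hQ hth (abs_nonneg _) (hQ0.trans hQ)
    have a2 : n/e*(3.4/X) = 3.4*nx := by rw [hnx]; field_simp
    rw [a2] at a1
    have a3 := ml (mul_nonneg (by linarith : 0 ≤ 3*k) hS) a1
    have a4 : 0 ≤ S*nx := by positivity
    linarith
  have q3 : f*Real.log 10 ≤ 0.714*e := by
    have := mul_le_mul hfe l10.le (by linarith) (by positivity)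
    linarith
  have q4 : (k+1)*(R*(f*Real.log 10)) ≤ (k+1)*(R*(0.714*e)) := by
    apply ml (by linarith); exact ml hR q3
  have q5 : 2*W*Real.log 10+w0 ≤ 4.6052*nx+1.428*e+G := by
    have a1 : W*Real.log 10 ≤ (nx+0.31*e)*2.3026 :=
      mul_le_mul (by linarith) l10.le (by linarith) (by positivity)
    linarith
  have q6 : (k+1)*(S*(2*W*Real.log 10+w0)) ≤ (k+1)*(S*(4.6052*nx+1.428*e+G)) := by
    apply ml (by linarith); exact ml hS q5
  have q7 : R*((k+1)*0.006) ≤ R*((k+1)*(0.006*e)) := by gcongr; linarith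
  have r1 : 0 ≤ R*(k+1)*e := by positivity
  have r2 : 0 ≤ S*(k+1)*e := by positivity
  have r3 : 0 ≤ S*(k+1)*nx := by positivity
  have e1 : 15*n/(X*e) = 15*nx := by rw [hnx]; ring
  rw [e1]
  linarith

lemma dpow (δ ρi : ℝ) (N : ℕ) (hN : N*|δ| ≤ ρi/2) (hρ : ρi ≤ 1) (p : ℕ) (hp : p ≤ N) : |(1+δ)^p-1| ≤ ρi := by
  have h1 : p*|δ| ≤ ρi/2 := le_trans (by gcongr) hN
  have h2 : |(1+δ)^p-1| ≤ (1+|δ|)^p-1 := by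
    have : ∀ p : ℕ, |(1+δ)^p-1| ≤ (1+|δ|)^p-1 := by
      intro p
      induction p with
      | zero => simp
      | succ p ih =>
        have e1 : (1+δ)^(p+1)-1 = ((1+δ)^p-1)*(1+δ)+δ := by ring
        have e2 : (1+|δ|)^(p+1)-1 = ((1+|δ|)^p-1)*(1+|δ|)+|δ| := by ring
        rw [e1, e2]
        refine (abs_add_le _ _).trans (add_le_add ?_ le_rfl)
        rw [abs_mul]
        refine mul_le_mul ih ?_ (abs_nonneg _) (le_trans (abs_nonneg _) ih)
        exact (abs_add_le _ _).trans (by simp)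
    exact this p
  have h3 : (1+|δ|)^p ≤ Real.exp (p*|δ|) := by
    rw [mul_comm, Real.exp_mul, Real.rpow_natCast]
    apply pow_le_pow_left₀ (by positivity)
    linarith [Real.add_one_le_exp |δ|]
  have h4 : 0 ≤ (p:ℝ)*|δ| := by positivity
  have h5 := Real.abs_exp_sub_one_le (x := (p:ℝ)*|δ|) (by rw [abs_of_nonneg h4]; linarith)
  rw [abs_of_nonneg h4] at h5
  have h6 := le_abs_self (Real.exp ((p:ℝ)*|δ|)-1)
  linarith

lemma idA (m d P u F V w Y g : ℝ) (hF : F ≠ 0) (hV : V ≠ 0) (hg : g ≠ 0) (hd : d ≠ 0) (h : w*Y = F*V) :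
    9*(m/d)*(P*u) = g*Y*(P/F*((u*w*(9*m))/(V*(g*d)))) := by
  have : g*Y*(P/F*((u*w*(9*m))/(V*(g*d)))) = 9*(m/d)*(P*u)*((w*Y)/(F*V)) := by field_simp
  rw [this, h, div_self (mul_ne_zero hF hV), mul_one]

set_option maxHeartbeats 4000000 in
theorem Tpp {k : ℕ} {α : ℝ} (h : IsA k α) (hk : 2 ≤ k) (n X g y : ℕ) (G b D δ : ℝ) (hg : 1 ≤ g) (hX : 1 ≤ X)
    (hbn : b = 1.25*Real.log n) (hb : 50 ≤ b) (h1 : (X:ℝ)^2*(G+4) ≤ n)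
    (hD : D = 100*(((k:ℝ)+1)^4*b^2/(Real.log (3*k))^3)*(15*n/X+1.5*X^2+G*X)) (h2 : D ≤ n/2)
    (hG : Real.log (27*k*g) ≤ G) (heq : 9*(nm α/dn k α)*α^(n-1) = g*10^y*(1+δ)) (hδ : |δ| ≤ Real.exp (-D)) : False := by
  have hk2 : (2:ℝ) ≤ k := by exact_mod_cast hk
  have hg1 : (1:ℝ) ≤ g := by exact_mod_cast hg
  have hX1 : (1:ℝ) ≤ X := by exact_mod_cast hX
  have hα := h.pos
  have hdn := h.dn_lo hk
  have hnm := h.nm_lo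
  have hclo := h.c_lo hk
  have hchi := h.c_hi hk
  have h54 : (54:ℝ) ≤ 27*k*g := by nlinarith
  have hlog54 : Real.log 54 ≤ G := (Real.log_le_log (by norm_num) h54).trans hG
  have hlg : Real.log g ≤ G := by
    refine le_trans (Real.log_le_log (by linarith) ?_) hG
    nlinarith
  have hG0 : 0 ≤ G := le_trans (Real.log_nonneg (by norm_num)) hlog54
  have hn4 : (4:ℝ) ≤ n := by nlinarith [one_le_pow₀ (n := 2) hX1]
  have hn4' : 4 ≤ n := by exact_mod_cast hn4
  obtain ⟨l, hl⟩ : ∃ l, l = Real.log (3*k) := ⟨_, rfl⟩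
  have hl1 : 1 ≤ l := by
    rw [hl, Real.le_log_iff_exp_le (by linarith)]
    linarith [Real.exp_one_lt_d9]
  have hlk : l ≤ (k:ℝ)+1 := by
    have e1 : (3*k:ℝ) = 3/2*(2*k) := by ring
    have a1 := Real.log_le_sub_one_of_pos (by norm_num : (0:ℝ) < 3/2)
    have a2 := Real.log_le_sub_one_of_pos (by linarith : (0:ℝ) < k)
    rw [hl, e1, Real.log_mul (by norm_num) (by linarith), Real.log_mul (by norm_num) (by linarith)]
    linarith [Real.log_two_lt_d9]
  obtain ⟨e, f, Q, w1, W, w', he, heX, hnQ, hw1, hw', hw2, hdir, hWb⟩ := dirich (n-1) y X (by omega) hX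
  have he1 : (1:ℝ) ≤ e := by exact_mod_cast he
  have heX' : (e:ℝ) ≤ X := by exact_mod_cast heX
  rw [← hl] at hD
  rw [hD] at h2
  obtain ⟨L, S, R, K, hL, hK, hKL, hS, hRE, hLR, hB1, hB2, hDD, hmain, hX3⟩ :=
    params ((k:ℝ)+1) l b n X e G (by linarith) hl1 hlk hb he1 heX' hG0 h1 h2
  rw [← hD] at hDD
  have hn1 : (((n-1:ℕ):ℕ):ℝ) = n-1 := by rw [Nat.cast_sub (by omega)]; simp
  have hRQ : R ≤ Q := by
    have : ((R+1)*e:ℕ) ≤ n-1 := by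
      have : (((R+1)*e:ℕ):ℝ) ≤ ((n-1:ℕ):ℝ) := by rw [hn1]; push_cast; exact hRE
      exact_mod_cast this
    rw [hnQ] at this
    have h3 : (R+1)*e < (Q+1)*e := by
      calc (R+1)*e ≤ e*Q+w1 := this
        _ < e*Q+e := by omega
        _ = _ := by ring
    have := lt_of_mul_lt_mul_right h3 (Nat.zero_le _)
    omega
  have hLR' : L ≤ R := by exact_mod_cast hLR
  have hRR : ((R+L-1:ℕ):ℝ) = R+L-1 := by rw [Nat.cast_sub (by omega)]; push_cast; ring
  have hL1 : (1:ℝ) ≤ L := by exact_mod_cast hL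
  have hS1 : (1:ℝ) ≤ S := by exact_mod_cast hS
  have hK1 : (1:ℝ) ≤ K := by exact_mod_cast hK
  have hn0 : (0:ℝ) < n := by linarith
  -- δ
  have hRS0 : (0:ℝ) ≤ l*(R*S) := by positivity
  have hLS : (1:ℝ) ≤ L*S := one_le_mul_of_one_le_of_one_le hL1 hS1
  have hexp : Real.exp (-D) ≤ Real.exp (-(l*(R*S)))/(2*(L*S)) := by
    have : Real.exp (-D) ≤ Real.exp (-(l*(R*S)) - Real.log (2*(L*S))) := Real.exp_le_exp.2 (by linarith)
    rwa [Real.exp_sub, Real.exp_log (by positivity)] at this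
  have hδh : (L*S:ℕ)*|δ| ≤ Real.exp (-(l*(R*S)))/2 := by
    have := hδ.trans hexp
    rw [le_div_iff₀ (by positivity)] at this
    push_cast; linarith
  have hexp1 : Real.exp (-(l*(R*S))) ≤ 1 := Real.exp_le_one_iff.2 (by linarith)
  have hδ2 : |δ| ≤ 1/2 := by
    have a1 : |δ| ≤ (L*S:ℕ)*|δ| := by
      push_cast; exact le_mul_of_one_le_left (abs_nonneg _) hLS
    linarith
  have hδab := abs_le.1 hδ2
  have ht : |Real.log (1+δ)| ≤ 1 := by
    rw [abs_le]; constructor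
    · have : Real.log (1/2) ≤ Real.log (1+δ) := Real.log_le_log (by norm_num) (by linarith)
      rw [one_div, Real.log_inv] at this
      linarith [Real.log_two_lt_d9]
    · linarith [Real.log_le_sub_one_of_pos (by linarith : 0 < 1+δ)]
  -- logs
  have hc0 : 0 < nm α/dn k α := by linarith
  have hlogeq : Real.log (9*(nm α/dn k α)) + ((n-1:ℕ):ℝ)*Real.log α = Real.log g + y*Real.log 10 + Real.log (1+δ) := by
    have := congrArg Real.log heq
    rwa [Real.log_mul (x := 9*(nm α/dn k α)) (by positivity) (by positivity), Real.log_mul (x := (g:ℝ)*10^y) (by positivity) (by linarith), Real.log_mul (x := (g:ℝ)) (by positivity) (by positivity), Real.log_pow, Real.log_pow] at this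
  have hgc : |Real.log g - Real.log (9*(nm α/dn k α))| ≤ G := by
    have a1 : Real.log (9*(nm α/dn k α)) ≤ Real.log 54 := Real.log_le_log (by positivity) (by linarith)
    have a2 : 0 ≤ Real.log (9*(nm α/dn k α)) := Real.log_nonneg (by linarith)
    have a3 : 0 ≤ Real.log g := Real.log_nonneg hg1
    rw [abs_le]; constructor <;> linarith
  have hQe : (Q:ℝ) ≤ n/e := by
    rw [le_div_iff₀ (by linarith)]
    have : (Q*e:ℕ) ≤ n := by
      have : e*Q ≤ n-1 := by omega
      rw [mul_comm]; omega
    exact_mod_cast this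
  obtain ⟨M, hM, hMb⟩ := polyM h hk e f w1 W w' (R+L-1) S g hg hw2
  obtain ⟨A, hA⟩ : ∃ A, A = α^e/10^f := ⟨_, rfl⟩
  have hA0 : 0 < A := by rw [hA]; positivity
  have hlogA : Real.log A = e*Real.log α - f*Real.log 10 := by
    rw [hA, Real.log_div (by positivity) (by positivity), Real.log_pow, Real.log_pow]
  obtain ⟨h0, hh0⟩ : ∃ h0, h0 = ((f:ℝ)*(R+L-1:ℕ)+2*W*S)*Real.log 10+S*Real.log (27*k*g) := ⟨_, rfl⟩
  have hexph0 : Real.exp h0 = 10^(f*(R+L-1)+2*W*S)*(27*k*g:ℝ)^S := by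
    rw [hh0, Real.exp_add]
    congr 1
    · rw [mul_comm, Real.exp_mul, Real.exp_log (by norm_num), ← Real.rpow_natCast]; push_cast; rfl
    · rw [mul_comm, Real.exp_mul, Real.exp_log (by linarith), Real.rpow_natCast]
  have hth := thetab ((n-1:ℕ):ℝ) y e f X (Real.log g) n (Real.log α) (Real.log (1+δ)) (Real.log (9*(nm α/dn k α))) G hn1 hX3 he1 heX'
    (by positivity) hG0 h1 hdir hgc ht (Real.log_le_log hα h.hi.le) hlogeq W (Real.log (27*k*g)) k Q ((R+L-1:ℕ):ℝ) S hk2 (by positivity) (by positivity) hQe (by positivity) hWb hG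
  rw [← hlogA, ← hh0] at hth
  have hQS : (0:ℝ) ≤ Q*S := by positivity
  have hRp : (1:ℝ) ≤ R := by linarith
  have hQ1 : (R:ℝ) ≤ Q := by exact_mod_cast hRQ
  have hIN := interp h hk K L R S Q hK hL hRQ hKL M A ((α^w1*10^w'*(9*nm α))/(10^W*(g*dn k α)))
    (10^(f*(R+L-1)+W*S)*((g:ℝ)*dn k α)^S) δ (3*k) (((R+L-1:ℕ):ℝ)+Q*S) h0 hA0 (by rw [hA]; exact h.indep hk e f he)
    (by positivity) (by positivity)
    (by
      rw [hexph0]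
      have d1 : (g:ℝ)*dn k α ≤ 27*k*g := by
        have := ml (by linarith : (0:ℝ) ≤ g) (by linarith [h.dn_hi] : dn k α ≤ 27*k)
        linarith
      apply mul_le_mul _ (pow_le_pow_left₀ (by positivity) d1 S) (by positivity) (by positivity)
      apply pow_le_pow_right₀ (by norm_num)
      have : W*S ≤ 2*(W*S) := by omega
      linarith)
    (by
      rw [hh0]
      have : 0 ≤ Real.log (27*k*g) := Real.log_nonneg (by linarith)
      have : 0 ≤ Real.log 10 := Real.log_nonneg (by norm_num)
      positivity)
    (by rw [hA]; exact hM) (by rw [hexph0]; exact hMb) le_rfl (by rw [hRR]; linarith) (by linarith)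
    (by
      have hgd : (g:ℝ)*10^y ≠ 0 := by positivity
      apply mul_left_cancel₀ hgd
      rw [← heq, hA]
      have e1 : α^(n-1) = (α^e)^Q*α^w1 := by rw [hnQ, pow_add, pow_mul]
      have e2 : (10:ℝ)^w'*10^y = (10^f)^Q*10^W := by rw [← pow_add, ← pow_mul, ← pow_add, hw']
      rw [e1, div_pow]
      exact (idA _ _ _ _ _ _ _ _ _ (by positivity) (by positivity) (by positivity) (by positivity) e2).symm)
    (by
      intro p hp
      have a1 : Real.exp (-(l*(R*S))) ≤ ((3*k:ℝ)⁻¹)^(K*L) := by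
        have : ((3*k:ℝ)⁻¹)^(K*L) = Real.exp (-(l*(K*L:ℕ))) := by
          rw [Real.exp_neg, Real.exp_mul, hl, Real.exp_log (by linarith), Real.rpow_natCast, inv_pow]
        rw [this, Real.exp_le_exp]
        have : ((K*L:ℕ):ℝ) ≤ R*S := by exact_mod_cast hKL
        have := ml (by linarith : 0 ≤ l) this
        linarith
      exact (dpow δ _ (L*S) hδh hexp1 p hp).trans a1)
  rw [← hl] at hIN
  have hBpos : 0 < ((R+L-1:ℕ):ℝ)+Q*S := by rw [hRR]; linarith
  have hlogB : Real.log (((R+L-1:ℕ):ℝ)+Q*S) ≤ b := by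
    have a1 : ((R+L-1:ℕ):ℝ)+Q*S ≤ n*(4*L*(((k:ℝ)+1)/l)+3) := by
      refine le_trans ?_ hB1
      rw [hRR]
      have := mul_le_mul_of_nonneg_right hQe (by linarith : (0:ℝ) ≤ S)
      linarith
    have a2 := Real.log_le_log hBpos a1
    have hu : 0 < 4*L*(((k:ℝ)+1)/l)+3 := by
      have : 0 < l := by linarith
      positivity
    rw [Real.log_mul hn0.ne' hu.ne'] at a2
    have a3 := Real.log_le_log (by positivity) hB2
    rw [Real.log_pow] at a3
    push_cast at a3
    rw [hbn]; linarith
  rw [hRR] at hth hIN hlogB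
  have f1 : ((K:ℝ)-1)*(l+(k+1)*Real.log (R+L-1+Q*S)) ≤ (K-1)*(l+(k+1)*b) := by
    apply ml (by linarith)
    have := ml (by linarith : (0:ℝ) ≤ k+1) hlogB
    linarith
  have f2 := ml (by linarith : (0:ℝ) ≤ (L:ℝ)-1) hth
  have e5 : (2:ℝ)*(k+2) = 2*(k+1+1) := by ring
  rw [e5] at hIN
  linarith only [f1, f2, hIN, hmain]

lemma mono_pow (p : ℕ) (x y : ℝ) (hp : (p:ℝ) ≤ y) (hy0 : 0 < y) (h : y ≤ x) : x^p*Real.exp y ≤ y^p*Real.exp x := by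
  have h1 : x ≤ y*Real.exp ((x-y)/y) := by
    have := Real.add_one_le_exp ((x-y)/y)
    have h2 := ml hy0.le this
    have h3 : y*((x-y)/y+1) = x := by field_simp; ring
    linarith
  have h2 : x^p ≤ y^p*Real.exp (x-y) := by
    have h3 := pow_le_pow_left₀ (by linarith) h1 p
    rw [mul_pow, ← Real.exp_nat_mul] at h3
    refine h3.trans (ml (by positivity) (Real.exp_le_exp.2 ?_))
    rw [← mul_div_assoc, div_le_iff₀ hy0, mul_comm]
    exact ml (by linarith) hp
  have h4 : Real.exp x = Real.exp (x-y)*Real.exp y := by rw [← Real.exp_add]; congr 1; ring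
  rw [h4, ← mul_assoc]
  exact mul_le_mul_of_nonneg_right h2 (Real.exp_pos y).le

lemma numS (Y n G : ℝ) (hY : 1000 ≤ Y) (hG0 : 0 ≤ G) (hG : (G+4)*(1.7*10^7*Y^2) ≤ n) (hn : 4*10^11*Y^3 ≤ n) :
    ∃ X : ℕ, 1 ≤ X ∧ (X:ℝ)^2*(G+4) ≤ n ∧ 100*Y*(15*n/X+1.5*X^2+G*X) ≤ 0.42*n := by
  obtain ⟨X, hX⟩ : ∃ X, X = ⌈4000*Y⌉₊ := ⟨_, rfl⟩
  have h1 : 4000*Y ≤ X := by rw [hX]; exact Nat.le_ceil _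
  have h2 : (X:ℝ) ≤ 4001*Y := by
    have := Nat.ceil_lt_add_one (by linarith : 0 ≤ 4000*Y)
    rw [hX]; linarith
  have hX0 : (0:ℝ) < X := by linarith
  have h3 : (X:ℝ)^2 ≤ (4001*Y)^2 := pow_le_pow_left₀ hX0.le h2 2
  have hn0 : 0 < n := lt_of_lt_of_le (by positivity) hn
  refine ⟨X, by exact_mod_cast (by linarith : (1:ℝ) ≤ X), ?_, ?_⟩
  · have := mul_le_mul_of_nonneg_right h3 (by linarith : 0 ≤ G+4)
    have h4 : 0 ≤ (G+4)*Y^2 := by positivity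
    linarith only [this, hG, h4]
  · have a1 : 100*Y*(15*n/X) ≤ 0.375*n := by
      rw [← mul_div_assoc, div_le_iff₀ hX0]
      have := ml hn0.le h1
      linarith only [this]
    have a2 : 100*Y*(1.5*X^2) ≤ 0.007*n := by
      have := ml (by linarith : 0 ≤ 150*Y) h3
      have h4 : 0 ≤ Y^3 := by positivity
      linarith only [this, hn, h4]
    have a3 : 100*Y*(G*X) ≤ 0.024*n := by
      have := ml (by positivity : 0 ≤ 100*Y*G) h2
      have h4 : 0 ≤ Y^2 := by positivity
      have h5 : 0 ≤ G*Y^2 := by positivity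
      linarith only [this, hG, h4, h5, hn0]
    linarith only [a1, a2, a3, hn0]

lemma numS1 (Y n : ℝ) (hY : 1000 ≤ Y) (hn : 10^33*Y^9 ≤ n) :
    ∃ X : ℕ, 1 ≤ X ∧ (X:ℝ)^2*(Y+4) ≤ n ∧ 100*Y*(15*n/X+1.5*X^2+Y*X)*(2.5*10^7*Y^2) ≤ n := by
  obtain ⟨Z, hZ⟩ : ∃ Z, Z = 6*10^10*Y^3 := ⟨_, rfl⟩
  have hY3 : 1 ≤ Y^3 := one_le_pow₀ (by linarith)
  have hY0 : 0 < Y := by linarith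
  obtain ⟨X, hX⟩ : ∃ X, X = ⌈Z⌉₊ := ⟨_, rfl⟩
  have h1 : Z ≤ X := by rw [hX]; exact Nat.le_ceil _
  have h2 : (X:ℝ) ≤ 7*10^10*Y^3 := by
    have := Nat.ceil_lt_add_one (by linarith : 0 ≤ Z)
    rw [hX]; linarith
  have hX0 : (0:ℝ) < X := by linarith
  have h3 : (X:ℝ)^2 ≤ (7*10^10*Y^3)^2 := pow_le_pow_left₀ hX0.le h2 2
  have hn0 : 0 < n := lt_of_lt_of_le (by positivity) hn
  have hY9 : Y^7 ≤ Y^9 := pow_le_pow_right₀ (by linarith) (by norm_num)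
  have hY97 : Y^6 ≤ Y^9 := pow_le_pow_right₀ (by linarith) (by norm_num)
  have hp : 0 ≤ Y^9 := by positivity
  refine ⟨X, by exact_mod_cast (by linarith : (1:ℝ) ≤ X), ?_, ?_⟩
  · have := mul_le_mul_of_nonneg_right h3 (by linarith : 0 ≤ Y+4)
    have e : (7*10^10*Y^3)^2*(Y+4) = 49*10^20*(Y^7+4*Y^6) := by ring
    linarith only [this, e, hn, hY9, hY97, hp]
  · have a1 : 100*Y*(15*n/X)*(2.5*10^7*Y^2) ≤ 0.625*n := by
      have : 100*Y*(15*n/X)*(2.5*10^7*Y^2) = 3.75*10^10*Y^3*n/X := by ring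
      rw [this, div_le_iff₀ hX0]
      have := ml hn0.le h1
      rw [hZ] at this
      linarith only [this]
    have a2 : 100*Y*(1.5*X^2)*(2.5*10^7*Y^2) ≤ 0.1*n := by
      have := ml (by positivity : 0 ≤ 3.75*10^9*Y^3) h3
      have e : 3.75*10^9*Y^3*(7*10^10*Y^3)^2 = 183.75*10^29*Y^9 := by ring
      linarith only [this, hn, hp, e]
    have a3 : 100*Y*(Y*X)*(2.5*10^7*Y^2) ≤ 0.1*n := by
      have := ml (by positivity : 0 ≤ 2.5*10^9*Y^4) h2
      linarith only [this, hn, hY9, hp]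
    linarith only [a1, a2, a3, hn0]

lemma lam_lo {k : ℝ} (hk : 2 ≤ k) : 1.79 ≤ Real.log (3*k) := by
  have : Real.log (3*2) ≤ Real.log (3*k) := Real.log_le_log (by norm_num) (by linarith)
  rw [Real.log_mul (by norm_num) (by norm_num)] at this
  linarith [Real.log_two_gt_d9, Real.log_three_gt_d9]

lemma lam_hi {k : ℝ} (hk : 2 ≤ k) : Real.log (3*k) ≤ k+1 := by
  have e1 : (3*k:ℝ) = 3/2*(2*k) := by ring
  have a1 := Real.log_le_sub_one_of_pos (by norm_num : (0:ℝ) < 3/2)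
  have a2 := Real.log_le_sub_one_of_pos (by linarith : (0:ℝ) < k)
  rw [e1, Real.log_mul (by norm_num) (by linarith), Real.log_mul (by norm_num) (by linarith)]
  linarith [Real.log_two_lt_d9]

lemma caseII_num (k n b Y : ℝ) (hk : 2 ≤ k) (hn : (k+1)^36*2^240 ≤ n) (hb : b = 1.25*Real.log n)
    (hY : Y = (k+1)^4*b^2/(Real.log (3*k))^3) : 10^33*Y^9 ≤ n := by
  have hl := lam_lo hk
  obtain ⟨l, hll⟩ : ∃ l, l = Real.log (3*k) := ⟨_, rfl⟩
  rw [← hll] at hl hY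
  have hN0 : 0 < (k+1)^36*2^240 := by positivity
  have hn0 := lt_of_lt_of_le hN0 hn
  obtain ⟨y, hy⟩ : ∃ y, y = Real.log ((k+1)^36*2^240) := ⟨_, rfl⟩
  have hy1 : y = 36*Real.log (k+1)+240*Real.log 2 := by
    rw [hy, Real.log_mul (by positivity) (by positivity), Real.log_pow, Real.log_pow]; norm_num
  have hyx : y ≤ Real.log n := by rw [hy]; exact Real.log_le_log hN0 hn
  have hlk : Real.log (k+1) ≤ l - Real.log 2 := by
    rw [hll, ← Real.log_div (by linarith) (by norm_num)]
    exact Real.log_le_log (by linarith) (by linarith)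
  have l2 := Real.log_two_gt_d9
  have l2' := Real.log_two_lt_d9
  have hlk0 : 0 ≤ Real.log (k+1) := Real.log_nonneg (by linarith)
  have hy18 : 18 ≤ y := by linarith
  have hyu : 1.25*y ≤ 45*l+177 := by linarith
  have hyu2 : 1.25*y ≤ 144*l := by linarith
  have hm := mono_pow 18 (Real.log n) y (by exact_mod_cast hy18) (by linarith) hyx
  rw [Real.exp_log hn0, hy, Real.exp_log hN0, ← hy] at hm
  have hl0 : 0 < l := by linarith
  have h1 : (1.25*y)^18 ≤ (22000*l^3)^9 := by
    have : (1.25*y)^2 ≤ 22000*l^3 := by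
      have h3 := pow_le_pow_left₀ (by linarith) hyu2 2
      have h4 := ml (sq_nonneg l) hl
      linarith only [h3, h4, sq_nonneg l]
    have := pow_le_pow_left₀ (sq_nonneg _) this 9
    rwa [← pow_mul] at this
  have h2 : Y^9 = (k+1)^36*(1.25^18*Real.log n^18)/(l^3)^9 := by
    rw [hY, hb, div_pow]; congr 1; ring
  rw [h2, ← mul_div_assoc, div_le_iff₀ (by positivity)]
  rw [mul_pow] at h1
  have h5 := mul_le_mul_of_nonneg_right h1 hn0.le
  rw [mul_pow] at h5
  have hp : 0 ≤ (l^3)^9*n := by positivity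
  have h6 : (10:ℝ)^33*22000^9 ≤ 2^240 := by norm_num
  have h7 := mul_le_mul_of_nonneg_right h6 hp
  have h8 : 2^240*(10^33*((k+1)^36*(1.25^18*Real.log n^18))) ≤ 2^240*(n*(l^3)^9) := by
    calc 2^240*(10^33*((k+1)^36*(1.25^18*Real.log n^18))) = 10^33*1.25^18*(Real.log n^18*((k+1)^36*2^240)) := by ring
      _ ≤ 10^33*1.25^18*(y^18*n) := ml (by positivity) hm
      _ = 10^33*(1.25^18*y^18*n) := by ring
      _ ≤ 10^33*(22000^9*(l^3)^9*n) := ml (by positivity) h5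
      _ = 10^33*22000^9*((l^3)^9*n) := by ring
      _ ≤ 2^240*((l^3)^9*n) := h7
      _ = _ := by ring
  exact le_of_mul_le_mul_left h8 (by positivity)

set_option maxHeartbeats 1000000 in
lemma tier (k : ℕ) (hk : 2 ≤ k) (hk2 : k < 8192) (u l : ℝ) (hu : u = Real.log k) (hl : l = Real.log (3*k)) :
    4*10^11*(((k:ℝ)+1)^12*(80.5+16.25*u)^6) ≤ l^9*(1.3*10^30*(k:ℝ)^8*u^5) := by
  have hk0 : (0:ℝ) < k := by exact_mod_cast (by omega : 0 < k)
  have hl3 : l = Real.log 3 + u := by rw [hl, hu, Real.log_mul (by norm_num) hk0.ne']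
  have l3 := Real.log_three_gt_d9
  have l2 := Real.log_two_gt_d9
  have l2' := Real.log_two_lt_d9
  obtain ⟨i, hi⟩ : ∃ i, i = Nat.log 2 k := ⟨_, rfl⟩
  have h1 : 2^i ≤ k := by rw [hi]; exact Nat.pow_log_le_self 2 (by omega)
  have h2 : k < 2^(i+1) := by rw [hi]; exact Nat.lt_pow_succ_log_self (by norm_num) k
  have hi1 : 1 ≤ i := by
    by_contra h; have : i = 0 := by omega
    subst this; omega
  have hi2 : i ≤ 12 := by
    by_contra h
    have : 2^13 ≤ 2^i := Nat.pow_le_pow_right (by norm_num) (by omega)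
    omega
  have h1r : (2:ℝ)^i ≤ k := by exact_mod_cast h1
  have h2r : (k:ℝ) ≤ 2^(i+1) := by exact_mod_cast h2.le
  have hu1 : 0.693*i ≤ u := by
    have := Real.log_le_log (by positivity) h1r
    rw [Real.log_pow, ← hu] at this
    have h3 : (i:ℝ)*0.693 ≤ i*Real.log 2 := ml (by positivity) (by linarith)
    linarith
  have hu2 : u ≤ 0.6932*(i+1) := by
    have := Real.log_le_log hk0 h2r
    rw [Real.log_pow, ← hu] at this
    push_cast at this
    have h3 : ((i:ℝ)+1)*Real.log 2 ≤ (i+1)*0.6932 := ml (by positivity) (by linarith)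
    linarith
  have hk1 : (k:ℝ)+1 ≤ (1+1/2^i)*k := by
    have : 1 ≤ 1/2^i*(k:ℝ) := by rw [one_div, inv_mul_eq_div, one_le_div (by positivity)]; exact h1r
    linarith
  have hi0 : (1:ℝ) ≤ i := by exact_mod_cast hi1
  have A : ((k:ℝ)+1)^12*(80.5+16.25*u)^6 ≤ ((1+1/2^i)^12*(2^(i+1))^4*(80.5+16.25*(0.6932*(i+1)))^6)*(k:ℝ)^8 := by
    have hu0 : 0 ≤ u := by linarith
    calc ((k:ℝ)+1)^12*(80.5+16.25*u)^6 ≤ ((1+1/2^i)*k)^12*(80.5+16.25*(0.6932*(i+1)))^6 := by gcongr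
      _ = ((1+1/2^i)^12*(k:ℝ)^4*(80.5+16.25*(0.6932*(i+1)))^6)*(k:ℝ)^8 := by ring
      _ ≤ _ := by gcongr
  have B : (1.09+0.693*i)^9*(1.3*10^30*(k:ℝ)^8*(0.693*i)^5) ≤ l^9*(1.3*10^30*(k:ℝ)^8*u^5) := by
    have : 1.09+0.693*(i:ℝ) ≤ l := by linarith
    have hl0 : 0 ≤ l := by linarith
    gcongr
  have C : 4*10^11*((1+1/2^i)^12*(2^(i+1))^4*(80.5+16.25*(0.6932*((i:ℝ)+1)))^6) ≤ (1.09+0.693*i)^9*(1.3*10^30*(0.693*i)^5) := by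
    clear A B hk1 hu1 hu2 h1r h2r h1 h2 hi hi0
    interval_cases i <;> norm_num
  have hk8 : 0 ≤ (k:ℝ)^8 := by positivity
  have D := mul_le_mul_of_nonneg_right C hk8
  linarith only [A, B, D]

lemma caseI_num (k : ℕ) (hk : 2 ≤ k) (hk2 : k < 8192) (n b Y : ℝ)
    (hn : 1.3*10^30*(k:ℝ)^8*Real.log k^5 ≤ n) (hb : b = 1.25*Real.log n)
    (hY : Y = ((k:ℝ)+1)^4*b^2/(Real.log (3*k))^3) : 4*10^11*Y^3 ≤ n := by
  have hk' : (2:ℝ) ≤ k := by exact_mod_cast hk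
  have hl := lam_lo hk'
  obtain ⟨u, hu⟩ : ∃ u, u = Real.log k := ⟨_, rfl⟩
  obtain ⟨l, hll⟩ : ∃ l, l = Real.log (3*k) := ⟨_, rfl⟩
  have ht := tier k hk hk2 u l hu hll
  rw [← hll] at hl hY
  rw [← hu] at hn
  have hu1 : 0.69 ≤ u := by
    have : Real.log 2 ≤ u := by rw [hu]; exact Real.log_le_log (by norm_num) hk'
    linarith [Real.log_two_gt_d9]
  obtain ⟨N, hN⟩ : ∃ N, N = 1.3*10^30*(k:ℝ)^8*u^5 := ⟨_, rfl⟩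
  rw [← hN] at hn ht
  have hN0 : 0 < N := by rw [hN]; positivity
  have hn0 := lt_of_lt_of_le hN0 hn
  obtain ⟨y, hy⟩ : ∃ y, y = Real.log N := ⟨_, rfl⟩
  have hy1 : y = Real.log 1.3+30*Real.log 10+8*u+5*Real.log u := by
    rw [hy, hN, Real.log_mul (by positivity) (by positivity), Real.log_mul (by positivity) (by positivity), Real.log_mul (by positivity) (by positivity), Real.log_pow, Real.log_pow, Real.log_pow, ← hu]; norm_num
  have hyx : y ≤ Real.log n := by rw [hy]; exact Real.log_le_log hN0 hn
  have a1 := Real.log_le_sub_one_of_pos (by norm_num : (0:ℝ) < 1.3)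
  have a2 := Real.log_le_sub_one_of_pos (by linarith : 0 < u)
  have a3 : 0 ≤ Real.log 1.3 := Real.log_nonneg (by norm_num)
  have a4 : -1 ≤ Real.log u := by
    have : Real.log (1/2) ≤ Real.log u := Real.log_le_log (by norm_num) (by linarith)
    rw [one_div, Real.log_inv] at this
    linarith [Real.log_two_lt_d9]
  have t1 := log10_hi
  have t2 := log10_lo
  have hy6 : 6 ≤ y := by linarith
  have hyu : 1.25*y ≤ 80.5+16.25*u := by linarith
  have hm := mono_pow 6 (Real.log n) y (by exact_mod_cast hy6) (by linarith) hyx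
  rw [Real.exp_log hn0, hy, Real.exp_log hN0, ← hy] at hm
  have hl0 : 0 < l := by linarith
  have h1 : (1.25*y)^6 ≤ (80.5+16.25*u)^6 := pow_le_pow_left₀ (by linarith) hyu 6
  have h2 : Y^3 = ((k:ℝ)+1)^12*(1.25^6*Real.log n^6)/l^9 := by
    rw [hY, hb, div_pow]; congr 1 <;> ring
  rw [h2, ← mul_div_assoc, div_le_iff₀ (by positivity)]
  have h8 : N*(4*10^11*(((k:ℝ)+1)^12*(1.25^6*Real.log n^6))) ≤ N*(n*l^9) := by
    calc N*(4*10^11*(((k:ℝ)+1)^12*(1.25^6*Real.log n^6))) = 4*10^11*((k:ℝ)+1)^12*1.25^6*(Real.log n^6*N) := by ring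
      _ ≤ 4*10^11*((k:ℝ)+1)^12*1.25^6*(y^6*n) := ml (by positivity) hm
      _ = 4*10^11*(((k:ℝ)+1)^12*(1.25*y)^6)*n := by ring
      _ ≤ 4*10^11*(((k:ℝ)+1)^12*(80.5+16.25*u)^6)*n := by gcongr
      _ ≤ (l^9*N)*n := mul_le_mul_of_nonneg_right ht hn0.le
      _ = _ := by ring
  exact le_of_mul_le_mul_left h8 hN0

lemma Tpp' {k : ℕ} {α : ℝ} (h : IsA k α) (hk : 2 ≤ k) (n X g y : ℕ) (G b D : ℝ) (hg : 1 ≤ g) (hX : 1 ≤ X)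
    (hbn : b = 1.25*Real.log n) (hb : 50 ≤ b) (h1 : (X:ℝ)^2*(G+4) ≤ n)
    (hD : D = 100*(((k:ℝ)+1)^4*b^2/(Real.log (3*k))^3)*(15*n/X+1.5*X^2+G*X)) (h2 : D ≤ n/2)
    (hG : Real.log (27*k*g) ≤ G) :
    Real.exp (-D)*(g*10^y) < |9*(nm α/dn k α)*α^(n-1) - g*10^y| := by
  by_contra hc
  push Not at hc
  have hg0 : (0:ℝ) < g := by exact_mod_cast hg
  have hp : (0:ℝ) < g*10^y := by positivity
  set T := 9*(nm α/dn k α)*α^(n-1) with hT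
  refine Tpp h hk n X g y G b D (T/(g*10^y)-1) hg hX hbn hb h1 hD h2 hG (by rw [← hT]; field_simp; ring) ?_
  have : T/(g*10^y)-1 = (T-g*10^y)/(g*10^y) := by field_simp
  rw [this, abs_div, abs_of_pos hp, div_le_iff₀ hp]
  exact hc

lemma Tlow {k : ℕ} {α : ℝ} (h : IsA k α) (hk : 2 ≤ k) (n : ℕ) (hn : 1 ≤ n) :
    3*Real.exp (0.45*n) ≤ 9*(nm α/dn k α)*α^(n-1) := by
  have h1 : Real.exp 0.45 ≤ 1.6 := by
    have h2 : Real.exp 0.45^20 ≤ 1.6^20 := by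
      rw [← Real.exp_nat_mul]
      have e : ((20:ℕ):ℝ)*0.45 = (9:ℕ)*1 := by norm_num
      rw [e, Real.exp_nat_mul]
      refine (pow_le_pow_left₀ (Real.exp_pos 1).le Real.exp_one_lt_d9.le 9).trans ?_
      norm_num
    exact le_of_pow_le_pow_left₀ (by norm_num) (by norm_num) h2
  have h2 : Real.exp (0.45*n) = Real.exp 0.45^(n-1)*Real.exp 0.45 := by
    rw [← pow_succ, Nat.sub_add_cancel hn, ← Real.exp_nat_mul]; congr 1; ring
  have h3 : Real.exp 0.45^(n-1) ≤ α^(n-1) := pow_le_pow_left₀ (Real.exp_pos _).le (by linarith [h.lo]) _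
  rw [h2]
  have h4 := h.c_lo hk
  have h5 := Real.exp_pos 0.45
  have h6 : 0 < α^(n-1) := by have := h.pos; positivity
  have h7 : Real.exp 0.45^(n-1)*Real.exp 0.45 ≤ α^(n-1)*1.6 := mul_le_mul h3 h1 h5.le h6.le
  have h8 := mul_le_mul_of_nonneg_right h4 h6.le
  linarith

lemma Ystuff (k : ℕ) (hk : 2 ≤ k) (n b Y : ℝ) (hn : 10^30 ≤ n) (hbn : b = 1.25*Real.log n)
    (hY : Y = ((k:ℝ)+1)^4*b^2/(Real.log (3*k))^3) : 50 ≤ b ∧ 2500*((k:ℝ)+1) ≤ Y := by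
  have hk' : (2:ℝ) ≤ k := by exact_mod_cast hk
  have hb : 50 ≤ b := by
    have := Real.log_le_log (by positivity) hn
    rw [Real.log_pow] at this
    push_cast at this
    linarith [log10_lo]
  refine ⟨hb, ?_⟩
  have h1 := lam_lo hk'
  have h2 := lam_hi hk'
  have hl0 : 0 < Real.log (3*k) := by linarith
  rw [hY, le_div_iff₀ (by positivity)]
  have h3 := pow_le_pow_left₀ hl0.le h2 3
  have h4 := pow_le_pow_left₀ (by norm_num) hb 2
  calc 2500*((k:ℝ)+1)*Real.log (3*k)^3 ≤ 50^2*((k:ℝ)+1)*((k:ℝ)+1)^3 := by gcongr; norm_num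
    _ = ((k:ℝ)+1)^4*50^2 := by ring
    _ ≤ _ := by gcongr

lemma nine (d : ℕ) : 9*(((10:ℤ)^d-1)/9) = 10^d-1 := by
  apply Int.mul_ediv_cancel'
  have := sub_dvd_pow_sub_pow (10:ℤ) 1 d
  simpa using this

structure Hyp (k n d1 d2 a : ℕ) (b : ℤ) : Prop where
  hk : 2 ≤ k
  hn : (10:ℝ)^30 ≤ n
  hd : d2 < d1
  hd1 : 3 ≤ d1
  ha1 : 1 ≤ a
  ha9 : a ≤ 9
  hb0 : 0 ≤ b
  hb9 : b ≤ 9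
  heq : 9*lucasL k n = a*10^d1 + 9*(b-a)*10^d2 - a

namespace Hyp
variable {k n d1 d2 a : ℕ} {b : ℤ}

lemma n1 (H : Hyp k n d1 d2 a b) : 1 ≤ n := by
  have := H.hn
  have h2 : (1:ℝ) ≤ n := by linarith
  exact_mod_cast h2

lemma close1 (H : Hyp k n d1 d2 a b) {α : ℝ} (h : IsA k α) :
    |9*(nm α/dn k α)*α^(n-1) - (a:ℕ)*10^d1| ≤ 126*10^d2 := by
  have h1 := abs_le.1 (h.binet H.hk H.n1)
  have h2 : 9*(lucasL k n:ℝ) = a*10^d1 + 9*(b-a)*10^d2 - a := by exact_mod_cast H.heq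
  have p : (1:ℝ) ≤ 10^d2 := one_le_pow₀ (by norm_num)
  have ha1 : (1:ℝ) ≤ a := by exact_mod_cast H.ha1
  have ha9 : (a:ℝ) ≤ 9 := by exact_mod_cast H.ha9
  have hb0 : (0:ℝ) ≤ b := by exact_mod_cast H.hb0
  have hb9 : (b:ℝ) ≤ 9 := by exact_mod_cast H.hb9
  have u1 := mul_le_mul_of_nonneg_right (by linarith : (b:ℝ)-a ≤ 9) (by linarith : (0:ℝ) ≤ 10^d2)
  have u2 := mul_le_mul_of_nonneg_right (by linarith : -9 ≤ (b:ℝ)-a) (by linarith : (0:ℝ) ≤ 10^d2)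
  rw [abs_le]; constructor <;> linarith

lemma Tup (H : Hyp k n d1 d2 a b) {α : ℝ} (h : IsA k α) :
    9*(nm α/dn k α)*α^(n-1) ≤ 135*10^d1 := by
  have h1 := (abs_le.1 (H.close1 h)).2
  have ha9 : (a:ℝ) ≤ 9 := by exact_mod_cast H.ha9
  have p : (10:ℝ)^d2 ≤ 10^d1 := pow_le_pow_right₀ (by norm_num) H.hd.le
  have := mul_le_mul_of_nonneg_right ha9 (by positivity : (0:ℝ) ≤ 10^d1)
  linarith

lemma step1 (H : Hyp k n d1 d2 a b) {α : ℝ} (h : IsA k α) (X : ℕ) (c D Y : ℝ) (hX : 1 ≤ X)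
    (hc : c = 1.25*Real.log n) (hY : Y = ((k:ℝ)+1)^4*c^2/(Real.log (3*k))^3) (h1 : (X:ℝ)^2*(Y+4) ≤ n)
    (hD : D = 100*Y*(15*n/X+1.5*X^2+Y*X)) (h2 : D ≤ n/2) : (10:ℝ)^(d1-d2) < 126*Real.exp D := by
  obtain ⟨hc50, hYb⟩ := Ystuff k H.hk n c Y H.hn hc hY
  have hk' : (2:ℝ) ≤ k := by exact_mod_cast H.hk
  have ha1 : (1:ℝ) ≤ a := by exact_mod_cast H.ha1
  have ha9 : (a:ℝ) ≤ 9 := by exact_mod_cast H.ha9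
  have hG : Real.log (27*k*a) ≤ Y := by
    have := Real.log_le_sub_one_of_pos (by positivity : (0:ℝ) < 27*k*a)
    have := ml (by positivity : (0:ℝ) ≤ 27*k) ha9
    linarith
  have h3 := (Tpp' h H.hk n X a d1 Y c D H.ha1 hX hc hc50 h1 (by rw [← hY]; exact hD) h2 hG).trans_le (H.close1 h)
  have e : (10:ℝ)^d1 = 10^(d1-d2)*10^d2 := by rw [← pow_add]; congr 1; have := H.hd; omega
  rw [e, Real.exp_neg] at h3
  have h4 : (Real.exp D)⁻¹*10^(d1-d2) < 126 := by
    have p : (0:ℝ) < 10^d2 := by positivity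
    have h5 : (Real.exp D)⁻¹*10^(d1-d2)*10^d2 ≤ (Real.exp D)⁻¹*(a*(10^(d1-d2)*10^d2)) := by
      have : (Real.exp D)⁻¹*10^(d1-d2)*10^d2*1 ≤ (Real.exp D)⁻¹*10^(d1-d2)*10^d2*a := ml (by positivity) ha1
      linarith
    exact lt_of_mul_lt_mul_right (lt_of_le_of_lt h5 h3) p.le
  rw [inv_mul_lt_iff₀ (Real.exp_pos _)] at h4
  linarith

lemma exp_contra (n : ℝ) (hn : 10^30 ≤ n) (c : ℝ) (hc : c ≤ Real.exp 3000) (h : 3*Real.exp (0.45*n) ≤ c*Real.exp (0.42*n)) : False := by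
  have e : Real.exp (0.45*n) = Real.exp (0.03*n)*Real.exp (0.42*n) := by rw [← Real.exp_add]; congr 1; ring
  rw [e] at h
  have h1 : 3*Real.exp (0.03*n) ≤ c := by
    have := Real.exp_pos (0.42*n)
    apply le_of_mul_le_mul_right _ this
    linarith
  have h2 : Real.exp 3000 ≤ Real.exp (0.03*n) := Real.exp_le_exp.2 (by linarith)
  have := Real.exp_pos 3000
  linarith

lemma d2lt (H : Hyp k n d1 d2 a b) (hk2 : k < 16383) (hN : n < (k+1)^36*2^240) : d2 < 800 := by
  by_contra hc
  push Not at hc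
  have hm := Nat.div_add_mod n (k+1)
  have hr : n % (k+1) < k+1 := Nat.mod_lt n (Nat.succ_pos k)
  apply thmB H.hk hk2 (n % (k+1)) a (n/(k+1)) (by omega) H.ha1 H.ha9
  · rw [Nat.div_lt_iff_lt_mul (Nat.succ_pos k)]
    calc n < (k+1)^36*2^240 := hN
      _ = (k+1)^35*2^240*(k+1) := by generalize k+1 = M; rw [pow_succ M 35, mul_right_comm]
  · rw [hm, H.heq]
    have h10 : ∀ e, 800 ≤ e → (2:ℤ)^800 ∣ 10^e := fun e he =>
      ((pow_dvd_pow_of_dvd (by norm_num) 800).trans (pow_dvd_pow 10 he))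
    have := H.hd
    have := dvd_add (Dvd.dvd.mul_left (h10 d1 (by omega)) (a:ℤ)) (Dvd.dvd.mul_left (h10 d2 hc) (9*(b-a)))
    have e : (a:ℤ)*10^d1 + 9*(b-a)*10^d2 - a + a = a*10^d1 + 9*(b-a)*10^d2 := by ring
    rw [e]; exact this

lemma caseI (H : Hyp k n d1 d2 a b) (hk2 : k < 8192) (hn0 : 1.3*10^30*(k:ℝ)^8*Real.log k^5 ≤ n)
    (hN : n < (k+1)^36*2^240) : False := by
  have hd2 := H.d2lt (by omega) hN
  obtain ⟨α, h⟩ := exists_A H.hk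
  obtain ⟨c, hc⟩ : ∃ c, c = 1.25*Real.log n := ⟨_, rfl⟩
  obtain ⟨Y, hY⟩ : ∃ Y, Y = ((k:ℝ)+1)^4*c^2/(Real.log (3*k))^3 := ⟨_, rfl⟩
  obtain ⟨hc50, hYb⟩ := Ystuff k H.hk n c Y H.hn hc hY
  have hk' : (2:ℝ) ≤ k := by exact_mod_cast H.hk
  have hnum := caseI_num k H.hk hk2 n c Y hn0 hc hY
  have hY3 : 0 ≤ Y^3 := by have : 0 ≤ Y := by linarith
                           positivity
  obtain ⟨X, hX, h1, h2⟩ := numS Y n Y (by linarith) (by linarith)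
    (by
      have := mul_le_mul_of_nonneg_right (by linarith : Y+4 ≤ 2*Y) (by positivity : 0 ≤ 1.7*10^7*Y^2)
      linarith) hnum
  have hnpos := H.hn
  have hs := H.step1 h X c _ Y hX hc hY h1 rfl (by linarith)
  have hT := (Tlow h H.hk n H.n1).trans (H.Tup h)
  have e : (10:ℝ)^d1 = 10^(d1-d2)*10^d2 := by rw [← pow_add]; congr 1; have := H.hd; omega
  rw [e] at hT
  refine exp_contra n H.hn (135*126*10^800) ?_ (hT.trans ?_)
  · have : (10:ℝ) ≤ Real.exp 3 := by
      have := Real.exp_one_gt_d9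
      have e3 : Real.exp 3 = Real.exp 1^3 := by rw [← Real.exp_nat_mul]; norm_num
      rw [e3]
      have := pow_le_pow_left₀ (by norm_num) this.le 3
      refine le_trans (by norm_num) this
    have h3 := pow_le_pow_left₀ (by norm_num) this 806
    rw [← Real.exp_nat_mul] at h3
    calc (135*126*10^800:ℝ) ≤ 10^6*10^800 := mul_le_mul_of_nonneg_right (by norm_num) (by positivity)
      _ = 10^806 := by rw [← pow_add]
      _ ≤ Real.exp (((806:ℕ):ℝ)*3) := h3
      _ ≤ Real.exp 3000 := Real.exp_le_exp.2 (by norm_num)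
  · have p : (10:ℝ)^d2 ≤ 10^800 := pow_le_pow_right₀ (by norm_num) hd2.le
    have h4 := hs.le.trans (ml (by norm_num) (Real.exp_le_exp.2 h2))
    have := mul_le_mul h4 p (by positivity) (by positivity)
    linarith

lemma caseII (H : Hyp k n d1 d2 a b) (hN : (k+1)^36*2^240 ≤ n) : False := by
  obtain ⟨α, h⟩ := exists_A H.hk
  obtain ⟨c, hc⟩ : ∃ c, c = 1.25*Real.log n := ⟨_, rfl⟩
  obtain ⟨Y, hY⟩ : ∃ Y, Y = ((k:ℝ)+1)^4*c^2/(Real.log (3*k))^3 := ⟨_, rfl⟩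
  obtain ⟨hc50, hYb⟩ := Ystuff k H.hk n c Y H.hn hc hY
  have hk' : (2:ℝ) ≤ k := by exact_mod_cast H.hk
  have hnum := caseII_num k n c Y hk' (by exact_mod_cast hN) hc hY
  have hY1 : 1000 ≤ Y := by linarith
  have hY0 : 0 < Y := by linarith
  have hnpos := H.hn
  obtain ⟨X, hX, h1, h2⟩ := numS1 Y n hY1 hnum
  obtain ⟨D, hD⟩ : ∃ D, D = 100*Y*(15*n/X+1.5*X^2+Y*X) := ⟨_, rfl⟩
  rw [← hD] at h2
  have hY2 : 1 ≤ Y^2 := one_le_pow₀ (by linarith)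
  have hD2 : D ≤ n/(2.5*10^7*Y^2) := by rw [le_div_iff₀ (by positivity)]; exact h2
  have hn0 : (0:ℝ) < n := by linarith
  have hDn : D ≤ n/2 := by
    refine hD2.trans (div_le_div_of_nonneg_left hn0.le (by norm_num) (by linarith))
  have hs := H.step1 h X c D Y hX hc hY h1 hD hDn
  obtain ⟨G, hG⟩ : ∃ G, G = n/(2*10^7*Y^2) := ⟨_, rfl⟩
  have hG0 : 0 ≤ G := by rw [hG]; positivity
  have hbig : Y^3*10^20 ≤ n := by
    have : Y^3 ≤ Y^9 := pow_le_pow_right₀ (by linarith) (by norm_num)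
    have h0 : 0 ≤ Y^3 := by positivity
    linarith
  have hY23 : Y^2*1000 ≤ Y^3 := by rw [pow_succ Y 2]; exact ml (by positivity) hY1
  have hGY : G*(2*10^7*Y^2) = n := by rw [hG]; field_simp
  obtain ⟨X', hX', h1', h2'⟩ := numS Y n G hY1 hG0 (by linarith) (by linarith [pow_nonneg hY0.le 3])
  -- g
  have ha1 : (1:ℝ) ≤ a := by exact_mod_cast H.ha1
  have ha9 : (a:ℝ) ≤ 9 := by exact_mod_cast H.ha9
  obtain ⟨m, hm⟩ : ∃ m, m = d1-d2 := ⟨_, rfl⟩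
  have hdm : d1 = m+d2 := by have := H.hd; omega
  have hm1 : 1 ≤ m := by have := H.hd; omega
  rw [← hm] at hs
  have hgz : 1 ≤ (a:ℤ)*10^m+9*(b-a) := by
    have p : (10:ℤ)^1 ≤ 10^m := pow_le_pow_right₀ (by norm_num) hm1
    have ha : (1:ℤ) ≤ a := by exact_mod_cast H.ha1
    have := H.hb0
    nlinarith
  obtain ⟨g, hg⟩ := Int.eq_ofNat_of_zero_le (by linarith : 0 ≤ (a:ℤ)*10^m+9*(b-a))
  have hg1 : 1 ≤ g := by omega
  have hgr : (g:ℝ) = a*10^m+9*(b-a) := by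
    have : ((a:ℤ)*10^m+9*(b-a) : ℤ) = ((g:ℕ):ℤ) := hg
    exact_mod_cast this.symm
  have hgup : (g:ℝ) ≤ 18*10^m := by
    have p : (10:ℝ)^1 ≤ 10^m := pow_le_pow_right₀ (by norm_num) hm1
    have hb9 : (b:ℝ) ≤ 9 := by exact_mod_cast H.hb9
    have := mul_le_mul_of_nonneg_right ha9 (by positivity : (0:ℝ) ≤ 10^m)
    rw [hgr]; linarith
  have hg0 : (1:ℝ) ≤ g := by exact_mod_cast hg1
  have hlogg : Real.log (27*k*g) ≤ G := by
    have a1 : 27*k*(g:ℝ) ≤ 27*k*18*126*Real.exp D := by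
      have : (g:ℝ) ≤ 18*(126*Real.exp D) := by linarith
      have := ml (by positivity : (0:ℝ) ≤ 27*k) this
      linarith
    have a2 := Real.log_le_log (by positivity) a1
    rw [Real.log_mul (by positivity) (Real.exp_pos _).ne', Real.log_exp] at a2
    have a3 := Real.log_le_sub_one_of_pos (by positivity : (0:ℝ) < 27*k*18*126)
    have a4 : 25*Y ≤ n/(10^8*Y^2) := by
      rw [le_div_iff₀ (by positivity)]
      have : 0 ≤ Y^3 := by positivity
      linarith
    have a5 : n/(2.5*10^7*Y^2) + n/(10^8*Y^2) = G := by rw [hG]; field_simp; norm_num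
    linarith
  have hfin := Tpp' h H.hk n X' g d2 G c _ hg1 hX' hc hc50 h1' rfl (by rw [← hY]; linarith) hlogg
  rw [← hY] at hfin
  have hclose : |9*(nm α/dn k α)*α^(n-1) - g*10^d2| ≤ 45 := by
    have u1 := abs_le.1 (h.binet H.hk H.n1)
    have u2 : 9*(lucasL k n:ℝ) = a*10^d1 + 9*(b-a)*10^d2 - a := by exact_mod_cast H.heq
    have u3 : (a:ℝ)*10^d1 + 9*(b-a)*10^d2 = g*10^d2 := by rw [hgr, hdm, pow_add]; ring
    rw [abs_le]; constructor <;> linarith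
  have hf2 := hfin.trans_le hclose
  rw [Real.exp_neg, inv_mul_lt_iff₀ (Real.exp_pos _)] at hf2
  have hT := Tlow h H.hk n H.n1
  have hup := (abs_le.1 hclose).2
  have hexp := Real.exp_le_exp.2 h2'
  have h1e : 1 ≤ Real.exp (0.42*n) := Real.one_le_exp (by linarith)
  refine exp_contra n H.hn 90 ?_ (by linarith)
  linarith [Real.add_one_le_exp 3000]
end Hyp

lemma tau_hi (r i : ℕ) : |tau r i| ≤ 9*2^r*((r:ℤ)+i)^r := by
  match r with
  | 0 => simp [tau, abs_mul]
  | 1 =>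
    simp only [tau, abs_mul, abs_neg_one_pow]
    rw [abs_of_nonneg (by positivity)]
    push_cast
    have : (0:ℤ) ≤ i := by positivity
    ring_nf
    linarith
  | N+2 =>
    have hc : ((N+2+i).choose i : ℤ) ≤ ((N+2:ℕ)+(i:ℤ))^(N+2) := by
      have := Nat.choose_le_pow (N+2+i) (N+2)
      rw [Nat.choose_symm_add] at this
      exact_mod_cast this
    have h1 : ((N+1+i).choose i : ℤ) ≤ (N+2+i).choose i := by
      exact_mod_cast Nat.choose_le_choose i (by omega)
    have h2 : ((N+i).choose i : ℤ) ≤ (N+2+i).choose i := by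
      exact_mod_cast Nat.choose_le_choose i (by omega)
    simp only [tau, abs_mul, abs_neg_one_pow]
    rw [abs_of_nonneg (by positivity : (0:ℤ) ≤ 2^N), one_mul]
    have p0 : (0:ℤ) ≤ (N+1+i).choose i := by positivity
    have p1 : (0:ℤ) ≤ (N+i).choose i := by positivity
    have : |8 * ((N+2+i).choose i : ℤ) - 6 * ((N+1+i).choose i) + ((N+i).choose i)| ≤ 9*((N+2:ℕ)+(i:ℤ))^(N+2) := by
      rw [abs_le]; constructor <;> linarith
    have hp : (2:ℤ)^N ≤ 2^(N+2) := pow_le_pow_right₀ (by norm_num) (by omega)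
    calc _ ≤ (2:ℤ)^(N+2)*(9*((N+2:ℕ)+(i:ℤ))^(N+2)) := mul_le_mul hp this (abs_nonneg _) (by positivity)
      _ = _ := by ring

lemma tau_lo (r i : ℕ) (hi : 1 ≤ i) : 2 ≤ |tau r i| := by
  match r with
  | 0 => simp [tau, abs_mul]
  | 1 =>
    simp only [tau, abs_mul, abs_neg_one_pow]
    rw [abs_of_nonneg (by positivity)]
    omega
  | N+2 =>
    have h1 : ((N+1+i).choose i : ℤ) ≤ (N+2+i).choose i := by
      exact_mod_cast Nat.choose_le_choose i (by omega)
    have h2 : (1:ℤ) ≤ (N+2+i).choose i := by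
      exact_mod_cast Nat.choose_pos (by omega)
    have p1 : (0:ℤ) ≤ (N+i).choose i := by positivity
    simp only [tau, abs_mul, abs_neg_one_pow]
    rw [abs_of_nonneg (by positivity : (0:ℤ) ≤ 2^N), one_mul, abs_of_nonneg (by linarith)]
    have : (1:ℤ) ≤ 2^N := one_le_pow₀ (by norm_num)
    calc (2:ℤ) = 1*2 := by norm_num
      _ ≤ _ := mul_le_mul this (by linarith) (by norm_num) (by positivity)

lemma tau_E (N i M : ℕ) (h : (2:ℤ)^(N+M) ∣ tau (N+2) i) : 2^M ≤ 11*(N+2+i)^3 := by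
  have h0 : (i+1).ascFactorial N = N.factorial*(i+N).choose N := Nat.ascFactorial_eq_factorial_mul_choose i N
  have h1 := tau_asc N i
  obtain ⟨t, ht⟩ := h
  rw [h0, Nat.factorial_succ, Nat.factorial_succ, ht] at h1
  have hf : ((N.factorial:ℕ):ℤ)*2^(N+2) ≠ 0 := by positivity
  have h2 : (2:ℤ)^M*(t*((N+1+1)*(N+1))) = (-1)^i*((i+N).choose N * zz (N+2) i : ℕ) := by
    apply mul_left_cancel₀ hf
    push_cast at h1 ⊢
    rw [pow_add] at h1
    rw [pow_add] at h1 ⊢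
    linear_combination h1
  have h3 : (2:ℤ)^M ∣ ((i+N).choose N * zz (N+2) i : ℕ) := by
    have : (2:ℤ)^M ∣ (-1)^i*((i+N).choose N * zz (N+2) i : ℕ) := ⟨_, h2.symm⟩
    have h5 := this.mul_left ((-1)^i)
    rw [← mul_assoc, ← mul_pow] at h5
    simpa using h5
  have h4 : 2^M ∣ (i+N).choose N * zz (N+2) i := by exact_mod_cast h3
  have ez : zz (N+2) i = (N+1+i)*(2*(N+2)+8*i) + (N+2)*(N+1) := by
    show (N+2+i-1)*(2*(N+2)+8*i) + (N+2)*(N+2-1) = _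
    rw [show N+2+i-1 = N+1+i by omega, show N+2-1 = N+1 by omega]
  have hz0 : zz (N+2) i ≠ 0 := by rw [ez]; positivity
  have hc0 : (i+N).choose N ≠ 0 := (Nat.choose_pos (by omega)).ne'
  rw [Nat.prime_two.pow_dvd_iff_le_factorization (mul_ne_zero hc0 hz0), Nat.factorization_mul hc0 hz0] at h4
  have h6 : 2^(((i+N).choose N).factorization 2) ≤ N+2+i := by
    rcases Nat.eq_zero_or_pos (i+N) with h7 | h7
    · have : N = 0 := by omega
      subst this; simp; omega
    · exact (Nat.pow_factorization_choose_le h7).trans (by omega)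
  have h8 : 2^((zz (N+2) i).factorization 2) ≤ zz (N+2) i := Nat.ordProj_le 2 hz0
  have h9 : zz (N+2) i ≤ 11*(N+2+i)^2 := by rw [ez]; nlinarith
  calc 2^M ≤ 2^(((i+N).choose N).factorization 2 + (zz (N+2) i).factorization 2) :=
        Nat.pow_le_pow_right (by norm_num) h4
    _ ≤ (N+2+i)*(11*(N+2+i)^2) := by rw [pow_add]; exact Nat.mul_le_mul h6 (h8.trans h9)
    _ = _ := by ring

lemma fin8 (d2 a : ℕ) (b : ℤ) (hd : d2 ≤ 3) (ha1 : 1 ≤ a) (ha9 : a ≤ 9) (hb0 : 0 ≤ b) (hb9 : b ≤ 9) :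
    ¬ (256:ℤ) ∣ 9*(b-a)*10^d2 - a := by
  interval_cases d2 <;> interval_cases a <;> norm_num <;> omega

set_option maxRecDepth 100000 in
lemma expo {L : ℕ} (hL : 13 ≤ L) : 9*(35*L+277)+30 ≤ 2^L ∧ 8192 ≤ 2^L ∧ (14 ≤ L → 20*(35*L+277)+80 ≤ 2^L) := by
  induction L, hL using Nat.le_induction with
  | base => norm_num
  | succ L hL ih =>
    rw [pow_succ]
    obtain ⟨i1, i2, i3⟩ := ih
    generalize 2^L = T at *
    refine ⟨by omega, by omega, fun h => ?_⟩
    rcases eq_or_lt_of_le hL with h1 | h1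
    · subst h1; omega
    · have := i3 (by omega); omega

lemma tau_sz (r p e : ℕ) (h : r + (p+1) ≤ 2^e) : |9*tau r (p+1)| ≤ 2^(7+r*(e+1)) := by
  have h1 := tau_hi r (p+1)
  have h2 : ((r:ℤ)+(p+1:ℕ)) ≤ 2^e := by exact_mod_cast h
  have h3 := pow_le_pow_left₀ (by positivity) h2 r
  rw [abs_mul]
  calc |(9:ℤ)| * |tau r (p+1)| ≤ 9*(9*2^r*(2^e)^r) := by
        rw [abs_of_nonneg (by norm_num : (0:ℤ) ≤ 9)]
        refine mul_le_mul_of_nonneg_left (h1.trans (mul_le_mul_of_nonneg_left h3 (by positivity))) (by norm_num)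
    _ ≤ 2^7*2^r*(2^e)^r := by
        have : (0:ℤ) ≤ 2^r*(2^e)^r := by positivity
        linarith
    _ = _ := by rw [← pow_mul, ← pow_add, ← pow_add]; congr 1; ring

lemma pow10 (d : ℕ) : (10:ℤ)^d ≤ 2^(4*d) := by
  rw [pow_mul]; exact pow_le_pow_left₀ (by norm_num) (by norm_num) d

namespace Hyp
variable {k n d1 d2 a : ℕ} {b : ℤ}

lemma d1big (H : Hyp k n d1 d2 a b) (hn : 100*(k+1) ≤ n) : 10*(k+1) ≤ d1 := by
  obtain ⟨α, h⟩ := exists_A H.hk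
  have hT := (Tlow h H.hk n H.n1).trans (H.Tup h)
  have h1 : (10:ℝ)^d1 = Real.exp (d1*Real.log 10) := by
    rw [Real.exp_nat_mul, Real.exp_log (by norm_num)]
  have h2 : (45:ℝ) ≤ Real.exp 10 := by
    have := Real.add_one_le_exp (10/2:ℝ)
    have h3 : Real.exp 10 = Real.exp (10/2)^2 := by rw [← Real.exp_nat_mul]; norm_num
    have h4 := Real.add_one_le_exp (5:ℝ)
    have h5 := Real.exp_one_gt_d9
    have h6 : Real.exp 10 = Real.exp 1^10 := by rw [← Real.exp_nat_mul]; norm_num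
    have h7 : (2:ℝ)^10 ≤ Real.exp 1^10 := pow_le_pow_left₀ (by norm_num) (by linarith) 10
    rw [h6]; linarith
  have h3 : Real.exp (0.45*n) ≤ Real.exp (10+d1*Real.log 10) := by
    rw [Real.exp_add, ← h1]
    have := mul_le_mul_of_nonneg_right h2 (by positivity : (0:ℝ) ≤ 10^d1)
    linarith
  rw [Real.exp_le_exp] at h3
  have h4 := mul_le_mul_of_nonneg_left log10_hi.le (by positivity : (0:ℝ) ≤ d1)
  have h5 : (100*(k+1):ℝ) ≤ n := by exact_mod_cast hn
  have h6 : (10*(k+1):ℝ) ≤ d1 := by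
    have : (0:ℝ) ≤ k := by positivity
    linarith
  exact_mod_cast h6

set_option maxRecDepth 100000 in
lemma caseE (H : Hyp k n d1 d2 a b) (hk2 : 8192 ≤ k) (hN : n < (k+1)^36*2^240)
    (hn : 100*(k+1) ≤ n) : False := by
  have hd1 := H.d1big hn
  have hm := Nat.div_add_mod n (k+1)
  have hr : n % (k+1) < k+1 := Nat.mod_lt n (Nat.succ_pos k)
  have hq : n/(k+1) < (k+1)^35*2^240 := by
    rw [Nat.div_lt_iff_lt_mul (Nat.succ_pos k)]
    calc n < (k+1)^36*2^240 := hN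
      _ = (k+1)^35*2^240*(k+1) := by generalize k+1 = M; rw [pow_succ M 35, mul_right_comm]
  have hq1 : 100 ≤ n/(k+1) := by rw [Nat.le_div_iff_mul_le (Nat.succ_pos k)]; exact hn
  have hlL := lL_lev H.hk (n/(k+1)) _ hr
  rw [hm] at hlL
  have heq := H.heq
  rw [hlL] at heq
  generalize n % (k+1) = r at *
  obtain ⟨p, hp⟩ : ∃ p, n/(k+1) = p+1 := ⟨n/(k+1)-1, by omega⟩
  rw [hp] at hq heq hq1
  have hd2 := fun h => H.d2lt h hN
  obtain ⟨-, -, hd, -, ha1, ha9, hb0, hb9, -⟩ := H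
  clear hN hn hm hlL hp
  -- sizes
  obtain ⟨L, hL⟩ : ∃ L, L = Nat.log2 (k+1) := ⟨_, rfl⟩
  have hL1 : 2^L ≤ k+1 := by rw [hL]; exact Nat.log2_self_le (by omega)
  have hL2 : k+1 < 2^(L+1) := by rw [hL]; exact Nat.lt_log2_self
  have hL13 : 13 ≤ L := by rw [hL, Nat.le_log2 (by omega)]; norm_num; omega
  have hL14 : 16383 ≤ k → 14 ≤ L := by intro h; rw [hL, Nat.le_log2 (by omega)]; norm_num; omega
  obtain ⟨e1, e2, e3⟩ := expo hL13
  have hqe : p+1 < 2^(35*L+275) := by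
    refine hq.trans_le ?_
    calc (k+1)^35*2^240 ≤ (2^(L+1))^35*2^240 := Nat.mul_le_mul_right _ (Nat.pow_le_pow_left hL2.le _)
      _ = 2^(35*L+275) := by rw [← pow_mul, ← pow_add]; congr 1; ring
  obtain ⟨e, he⟩ : ∃ e, e = 35*L+276 := ⟨_, rfl⟩
  have hqe9 : r ≤ 9 → r + (p+1) ≤ 2^e := by
    intro h
    have h2 : 2^4 ≤ 2^(35*L+275) := Nat.pow_le_pow_right (by norm_num) (by omega)
    rw [he, pow_succ]
    generalize 2^(35*L+275) = T at *
    omega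
  clear hq hL
  have htau : r ≤ 9 → |9*tau r (p+1)| ≤ 2^(7+r*(e+1)) := fun h => tau_sz r p e (hqe9 h)
  have htauM : r ≤ 9 → |9*tau r (p+1)| ≤ 2^(k-6) := by
    intro h
    refine (htau h).trans (pow_le_pow_right₀ (by norm_num) ?_)
    have : r*(e+1) ≤ 9*(e+1) := Nat.mul_le_mul_right _ h
    omega
  have h10 : ∀ x y, x ≤ y → (2:ℤ)^x ∣ 10^y := fun x y hxy =>
    ((pow_dvd_pow_of_dvd (by norm_num) x).trans (pow_dvd_pow 10 hxy))
  have hlev : (2:ℤ)^(k-1) ∣ lev k (r+(k+1)) p := by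
    have := lev_dvd k p (r+(k+1)-2)
    rw [show r+(k+1)-2+2 = r+(k+1) by omega] at this
    exact (pow_dvd_pow 2 (by omega)).trans this
  have hlevr : ∀ x, x + 2 ≤ r → (2:ℤ)^x ∣ lev k r (p+1) := by
    intro x hx
    have := lev_dvd k (p+1) (r-2)
    rw [show r-2+2 = r by omega] at this
    exact (pow_dvd_pow 2 (by omega)).trans this
  have ha1' : (1:ℤ) ≤ a := by exact_mod_cast ha1
  have ha9' : (a:ℤ) ≤ 9 := by exact_mod_cast ha9
  have habs : |9*(b-a)*10^d2 - a| ≤ 81*10^d2+9 := by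
    have p : (0:ℤ) ≤ 10^d2 := by positivity
    have u1 := mul_le_mul_of_nonneg_right (by linarith : b-a ≤ 9) p
    have u2 := mul_le_mul_of_nonneg_right (by linarith : -9 ≤ b-a) p
    rw [abs_le]; constructor <;> linarith
  have hsz : ∀ D, d2 ≤ D → 4*D+8 ≤ k-6 → |9*(b-a)*10^d2 - a| ≤ 2^(k-6) := by
    intro D h1 h2
    refine habs.trans ?_
    have h3 := pow10 d2
    have h4 : (1:ℤ) ≤ 2^(4*d2) := one_le_pow₀ (by norm_num)
    calc 81*(10:ℤ)^d2+9 ≤ 2^8*2^(4*d2) := by linarith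
      _ ≤ 2^(k-6) := by rw [← pow_add]; exact pow_le_pow_right₀ (by norm_num) (by omega)
  rw [lev] at heq
  have hdv : (2:ℤ)^(k-1) ∣ 9*tau r (p+1) - (9*(b-a)*10^d2 - a) := by
    have h1 := (h10 (k-1) d1 (by omega)).mul_left (a:ℤ)
    have h2 := dvd_sub h1 (hlev.mul_left 9)
    have e : 9*tau r (p+1) - (9*(b-a)*10^d2 - a) = a*10^d1 - 9*lev k (r+(k+1)) p := by linarith
    rw [e]; exact h2
  have hmain : r ≤ 9 ∧ |9*(b-a)*10^d2 - a| ≤ 2^(k-6) := by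
    by_cases h3 : d2 ≤ 3
    · refine ⟨?_, hsz 3 h3 (by omega)⟩
      by_contra hc
      push Not at hc
      have h1 := hlevr 8 (by omega)
      rw [lev] at h1
      apply fin8 d2 a b h3 ha1 ha9 hb0 hb9
      have h2 := dvd_sub (h1.mul_left 9) ((h10 8 d1 (by omega)).mul_left (a:ℤ))
      rw [heq] at h2
      norm_num at h2
      have e : (a:ℤ)*10^d1 + 9*(b-a)*10^d2 - a - a*10^d1 = 9*(b-a)*10^d2 - a := by ring
      rw [e] at h2; exact h2
    push Not at h3
    have hr5 : r ≤ 5 := by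
      by_contra hc
      push Not at hc
      have h1 := hlevr 4 (by omega)
      rw [lev] at h1
      have h2 := dvd_sub (((h10 4 d1 (by omega)).mul_left (a:ℤ)).add ((h10 4 d2 (by omega)).mul_left (9*(b-a)))) (h1.mul_left 9)
      rw [heq] at h2
      have e : (a:ℤ)*10^d1 + 9*(b-a)*10^d2 - (a*10^d1 + 9*(b-a)*10^d2 - a) = a := by ring
      rw [e] at h2
      norm_num at h2
      omega
    refine ⟨by omega, ?_⟩
    by_cases hk3 : k < 16383
    · exact hsz 800 (hd2 hk3).le (by omega)
    push Not at hk3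
    have e4 := e3 (hL14 hk3)
    have hne : 9*tau r (p+1) + a ≠ 0 := by
      intro h0
      have h1 := tau_lo r (p+1) (by omega)
      rcases le_abs.1 h1 with h2 | h2 <;> linarith
    have hle : |9*tau r (p+1) + a| ≤ 2^(8+5*(e+1)) := by
      have h1 := htau (by omega)
      have h2 : (2:ℤ)^(7+r*(e+1)) ≤ 2^(7+5*(e+1)) := pow_le_pow_right₀ (by norm_num) (by
        have : r*(e+1) ≤ 5*(e+1) := Nat.mul_le_mul_right _ hr5
        omega)
      have h3 := abs_add_le (9*tau r (p+1)) (a:ℤ)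
      rw [abs_of_nonneg (by linarith : (0:ℤ) ≤ a)] at h3
      have h4 : (2:ℤ)^4 ≤ 2^(7+5*(e+1)) := pow_le_pow_right₀ (by norm_num) (by omega)
      have h5 : (2:ℤ)^(8+5*(e+1)) = 2*2^(7+5*(e+1)) := by rw [← pow_succ']; congr 1; omega
      linarith
    obtain ⟨d, hd'⟩ : ∃ d, d = min d2 (k-1) := ⟨_, rfl⟩
    have h5 : (2:ℤ)^d ∣ 9*tau r (p+1) + a := by
      have h1 := (pow_dvd_pow (2:ℤ) (show d ≤ k-1 by omega)).trans hdv
      have h2 := dvd_add h1 ((h10 d d2 (by omega)).mul_left (9*(b-a)))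
      have e : 9*tau r (p+1) - (9*(b-a)*10^d2 - a) + 9*(b-a)*10^d2 = 9*tau r (p+1) + a := by ring
      rw [e] at h2; exact h2
    have h6 : (2:ℤ)^d ≤ 2^(8+5*(e+1)) := by
      refine le_trans ?_ hle
      exact Int.le_of_dvd (abs_pos.2 hne) ((dvd_abs _ _).2 h5)
    have h7 : d ≤ 8+5*(e+1) := (pow_le_pow_iff_right₀ (by norm_num)).1 h6
    exact hsz (8+5*(e+1)) (by omega) (by omega)
  obtain ⟨hr9, hs⟩ := hmain
  have hz : 9*tau r (p+1) - (9*(b-a)*10^d2 - a) = 0 := by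
    refine Int.eq_zero_of_abs_lt_dvd hdv ?_
    have h1 := abs_sub (9*tau r (p+1)) (9*(b-a)*10^d2 - a)
    have h2 := htauM hr9
    have h3 : (2:ℤ)^(k-1) = 2^(k-6)*2^5 := by rw [← pow_add]; congr 1; omega
    have h4 : (0:ℤ) < 2^(k-6) := by positivity
    linarith
  have h9 : 9*lev k (r+(k+1)) p = a*10^d1 := by linarith
  obtain ⟨p', rfl⟩ : ∃ p', p = p'+1 := ⟨p-1, by omega⟩
  rw [lev] at h9
  obtain ⟨N, hN⟩ : ∃ N, r+(k+1) = N+2 := ⟨r+(k+1)-2, by omega⟩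
  rw [hN] at h9
  have h11 : (2:ℤ)^(N+(k+1)) ∣ 9*tau (N+2) (p'+1) := by
    have h1 := (h10 (N+(k+1)) d1 (by omega)).mul_left (a:ℤ)
    have h2 := lev_dvd k p' (N+(k+1))
    rw [show N+(k+1)+2 = N+2+(k+1) by ring] at h2
    have h3 := dvd_sub h1 (h2.mul_left 9)
    have e : a*10^d1 - 9*lev k (N+2+(k+1)) p' = 9*tau (N+2) (p'+1) := by linarith
    rw [e] at h3; exact h3
  have h12 : IsCoprime ((2:ℤ)^(N+(k+1))) 9 := IsCoprime.pow_left ⟨-4, 1, by norm_num⟩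
  have h13 := tau_E N (p'+1) (k+1) (h12.dvd_of_dvd_mul_left h11)
  have h14 : N+2+(p'+1) ≤ 2^(e+1) := by
    have h1 := hqe9 hr9
    have h2 : k+1 ≤ 2^e := hL2.le.trans (Nat.pow_le_pow_right (by norm_num) (by omega))
    rw [pow_succ]
    omega
  have h15 : 2^(k+1) ≤ 2^(4+(e+1)*3) := by
    refine h13.trans ?_
    rw [pow_add, pow_mul]
    exact Nat.mul_le_mul (by norm_num) (Nat.pow_le_pow_left h14 3)
  have h16 : k+1 ≤ 4+(e+1)*3 := (Nat.pow_le_pow_iff_right (by norm_num)).1 h15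
  omega
end Hyp

theorem n_bound_in_k (k n : ℕ) (hk : 2 ≤ k) (hnk : k + 1 ≤ n) (hn : 5 < n)
    (d1 d2 : ℕ) (a b : ℤ) (hd : d2 < d1) (hd1 : 3 ≤ d1) (ha1 : 1 ≤ a) (ha9 : a ≤ 9)
    (hb0 : 0 ≤ b) (hb9 : b ≤ 9)
    (heq : lucasL k n = a * ((10 ^ d1 - 1) / 9) + (b - a) * 10 ^ d2) :
    (n : ℝ) < 1.3 * 10 ^ 30 * (k : ℝ) ^ 8 * Real.log k ^ 5 := by
  by_contra hc
  push Not at hc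
  have hk' : (2:ℝ) ≤ k := by exact_mod_cast hk
  have hl : (0.69:ℝ) ≤ Real.log k := by
    have := Real.log_le_log (by norm_num) hk'
    linarith [Real.log_two_gt_d9]
  have hl5 := pow_le_pow_left₀ (by norm_num) hl 5
  have h7 : (128:ℝ) ≤ (k:ℝ)^7 := by
    have := pow_le_pow_left₀ (by norm_num) hk' 7
    linarith
  have hbig : (10:ℝ)^30*(k+1) ≤ n := by
    refine le_trans ?_ hc
    have h1 : 128*(k:ℝ) ≤ (k:ℝ)^8 := by
      rw [pow_succ]; exact mul_le_mul_of_nonneg_right h7 (by linarith)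
    have h2 : 128*(k:ℝ)*0.69^5 ≤ (k:ℝ)^8*Real.log k^5 := mul_le_mul h1 hl5 (by positivity) (by positivity)
    have h3 : (k:ℝ)+1 ≤ 1.3*((k:ℝ)^8*Real.log k^5) := by linarith
    have := mul_le_mul_of_nonneg_left h3 (by positivity : (0:ℝ) ≤ 10^30)
    linarith
  lift a to ℕ using (by linarith)
  have H : Hyp k n d1 d2 a b := by
    refine ⟨hk, by linarith, hd, hd1, by exact_mod_cast ha1, by exact_mod_cast ha9, hb0, hb9, ?_⟩
    have := nine d1
    rw [heq]
    linear_combination (a:ℤ)*this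
  rcases le_or_gt ((k+1)^36*2^240) n with h | h
  · exact H.caseII h
  rcases lt_or_ge k 8192 with h1 | h1
  · exact H.caseI h1 hc h
  · refine H.caseE h1 h ?_
    have : (100*(k+1):ℝ) ≤ n := by linarith
    exact_mod_cast this
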